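/- For every κ > 0 there exist constants ε > 0, C > 0 and N₀ (depending only on h, the choice of the roots z_p, and κ) such that the following holds. Let N ≥ N₀ be an integer, let d be a positive integer with d ≤ N^ρ, and let σ ∈ (0,1] satisfy σ ≥ (log N)^{−ε·log log log N}. Set Y = σ^{−(k+2)}, M = ⌊(N/b_d)^{1/k}⌋, and S(γ) = (1/(w_d(Y)·N))·∑_{1 ≤ m ≤ M, m ∈ W_d(Y)} h_d'(m)·e(h_d(m)γ). Let q ≤ κ·σ^{−(k+1)} be a positive integer and 1 ≤ a ≤ q with gcd(a,q) = 1. Then: (i) for every γ ∈ 𝔐_{a,q}(N, κ/σ), writing β = γ − a/q, one has |S(γ)| ≤ C·(log N)^{1/4}·q^{−1/2}·min{1, (N·|β|)^{−1}}; and (ii) ∫_{𝔐_{a,q}(N,κ/σ)} |S(γ)|² dγ ≤ C·(log N)^{1/2}/(q·N). -/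

import Mathlib

/-- `γ(g;p)`: the smallest positive integer `γ` such that the derivative `g'` does not vanish
identically modulo `p^γ`. -/
noncomputable def gammaExp (g : Polynomial ℤ) (p : ℕ) : ℕ :=
  sInf {c : ℕ | 0 < c ∧ ¬ ∀ n : ℤ, ((p : ℤ) ^ c) ∣ (Polynomial.derivative g).eval n}

/-- `j(g;p)`: the number of residues `s` modulo `p^{γ(g;p)}` with `g'(s) ≡ 0 (mod p^{γ(g;p)})`. -/
noncomputable def jCount (g : Polynomial ℤ) (p : ℕ) : ℕ := by
  classical
  exact ((Finset.range (p ^ gammaExp g p)).filter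
    (fun s => ((p : ℤ) ^ gammaExp g p) ∣ (Polynomial.derivative g).eval (s : ℤ))).card

/-- `∏_{p ≤ Y} (1 - j(g;p)/p^{γ(g;p)})`, the product being over primes `p ≤ Y`. -/
noncomputable def wProd (g : Polynomial ℤ) (Y : ℝ) : ℝ := by
  classical
  exact ∏ p ∈ (Finset.range (⌊Y⌋₊ + 1)).filter Nat.Prime,
    (1 - (jCount g p : ℝ) / (p : ℝ) ^ gammaExp g p)

/-- `W(g;Y) = {n ∈ ℤ : g'(n) ≢ 0 (mod p^{γ(g;p)}) for all primes p ≤ Y}`. -/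
def WSet (g : Polynomial ℤ) (Y : ℝ) : Set ℤ :=
  {n : ℤ | ∀ p : ℕ, p.Prime → (p : ℝ) ≤ Y →
    ¬ ((p : ℤ) ^ gammaExp g p ∣ (Polynomial.derivative g).eval n)}

/-- `W_q(g;Y) = {n ∈ ℤ : g'(n) ≢ 0 (mod p^{γ(g;p)}) for all primes p ≤ Y with p^{γ(g;p)} ∣ q}`. -/
def WqSet (g : Polynomial ℤ) (Y : ℝ) (q : ℕ) : Set ℤ :=
  {n : ℤ | ∀ p : ℕ, p.Prime → (p : ℝ) ≤ Y → p ^ gammaExp g p ∣ q →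
    ¬ ((p : ℤ) ^ gammaExp g p ∣ (Polynomial.derivative g).eval n)}
/-- `e(x) = e^{2πix}`. -/
noncomputable def e (x : ℝ) : ℂ := Complex.exp (2 * Real.pi * Complex.I * x)


set_option linter.unusedSectionVars false
set_option linter.unusedSimpArgs false

namespace Weil
open Polynomial

section Stepanov
variable {K : Type*} [Field K]

/-- weighted degree predicate -/
def WD (w D : ℕ) (F : K[X][X]) : Prop := ∀ m, (F.coeff m).natDegree ≤ D + w * m

lemma WD.mul {w D E : ℕ} {F G : K[X][X]} (hF : WD w D F) (hG : WD w E G) :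
    WD w (D + E) (F * G) := by
  intro m
  rw [coeff_mul]
  refine natDegree_sum_le_of_forall_le _ _ ?_
  rintro ⟨a, b⟩ hab
  rw [Finset.HasAntidiagonal.mem_antidiagonal] at hab
  simp only at hab ⊢
  refine natDegree_mul_le.trans ?_
  have h1 := hF a
  have h2 := hG b
  subst hab
  rw [mul_add]; omega

lemma WD.mono {w D E : ℕ} {F : K[X][X]} (hF : WD w D F) (h : D ≤ E) : WD w E F :=
  fun m => (hF m).trans (by omega)

lemma WD.sum {w D : ℕ} {ι : Type*} (s : Finset ι) {F : ι → K[X][X]} (hF : ∀ i ∈ s, WD w D (F i)) :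
    WD w D (∑ i ∈ s, F i) := by
  intro m
  rw [finsetSum_coeff]
  exact natDegree_sum_le_of_forall_le _ _ (fun i hi => hF i hi m)

lemma WD.C {w D : ℕ} {r : K[X]} (hr : r.natDegree ≤ D) : WD w D (C r) := by
  intro m
  rw [coeff_C]
  split_ifs
  · omega
  · simp

lemma WD.add {w D : ℕ} {F G : K[X][X]} (hF : WD w D F) (hG : WD w D G) : WD w D (F + G) := by
  intro m
  rw [coeff_add]
  exact natDegree_add_le_of_degree_le (hF m) (hG m)

lemma WD.pow {w : ℕ} {F : K[X][X]} (hF : WD w 0 F) (n : ℕ) : WD w 0 (F ^ n) := by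
  induction n with
  | zero => rw [pow_zero, ← C_1]; exact WD.C (by simp)
  | succ n ih => rw [pow_succ]; exact ih.mul hF

/-- `f(x) ↦ f(x + T)` -/
noncomputable def tau : K[X] →+* K[X][X] :=
  (taylorAlgHom (X : K[X])).toRingHom.comp (mapRingHom C)

lemma tau_coeff (f : K[X]) (m : ℕ) : (tau f).coeff m = hasseDeriv m f := by
  have : tau f = taylor (X : K[X]) (f.map C) := rfl
  rw [this, taylor_coeff]
  have h2 : hasseDeriv m (f.map (C : K →+* K[X])) = (hasseDeriv m f).map C := by
    ext i : 1
    simp [hasseDeriv_coeff]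
  rw [h2, eval_map, eval₂_C_X]

lemma tau_C (c : K) : tau (C c) = C (C c) := by
  have : tau (C c) = taylor (X : K[X]) ((C c).map C) := rfl
  rw [this]; simp

lemma tau_X : tau (X : K[X]) = X + C X := by
  have : tau (X : K[X]) = taylor (X : K[X]) ((X : K[X]).map C) := rfl
  rw [this]; simp

lemma tau_eval (f : K[X]) (x : K) : (tau f).map (evalRingHom x) = taylor x f := by
  ext m
  rw [coeff_map, tau_coeff, taylor_coeff]; rfl

lemma WD_tau {w : ℕ} (r : K[X]) : WD w r.natDegree (tau r) := by
  intro m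
  rw [tau_coeff]
  exact (natDegree_hasseDeriv_le r m).trans (by omega)

lemma WD_u (f : K[X]) : WD (f.natDegree - 1) 0 (tau f - C f) := by
  intro m
  rw [coeff_sub, tau_coeff, coeff_C]
  rcases Nat.eq_zero_or_pos m with rfl | hm
  · simp
  · rw [if_neg hm.ne', sub_zero]
    refine (natDegree_hasseDeriv_le f m).trans ?_
    have : (f.natDegree - 1) * 1 ≤ (f.natDegree - 1) * m := Nat.mul_le_mul_left _ hm
    omega

variable (p : ℕ) [hp : Fact p.Prime] [CharP K p]

/-- trace polynomial -/
noncomputable def gtr (f : K[X]) (n : ℕ) : K[X] := ∑ s ∈ Finset.range n, f ^ p ^ s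

noncomputable def Gtr (f : K[X]) (n : ℕ) : K[X][X] :=
  ∑ s ∈ Finset.range n, (tau f - C f) ^ p ^ s

lemma WD_G (f : K[X]) (n : ℕ) : WD (f.natDegree - 1) 0 (Gtr p f n) :=
  WD.sum _ (fun _ _ => (WD_u f).pow _)

lemma tau_gtr (f : K[X]) (n : ℕ) : tau (gtr p f n) = C (gtr p f n) + Gtr p f n := by
  unfold gtr Gtr
  rw [map_sum, map_sum, ← Finset.sum_add_distrib]
  refine Finset.sum_congr rfl fun s _ => ?_
  rw [map_pow, map_pow, ← add_pow_char_pow]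
  congr 1
  ring

lemma natDegree_gtr (f : K[X]) (hf : 0 < f.natDegree) (n : ℕ) :
    (gtr p f (n + 1)).natDegree = f.natDegree * p ^ n := by
  have key : ∀ n, (gtr p f n).natDegree < f.natDegree * p ^ n := by
    intro n
    induction n with
    | zero => simpa [gtr] using hf
    | succ n ih =>
      have h1 : gtr p f (n + 1) = gtr p f n + f ^ p ^ n := by
        unfold gtr; rw [Finset.sum_range_succ]
      rw [h1]
      refine (natDegree_add_le _ _).trans_lt ?_
      rw [natDegree_pow]
      have h2 : f.natDegree * p ^ n < f.natDegree * p ^ (n + 1) := by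
        have := Nat.pow_lt_pow_right hp.out.one_lt (Nat.lt_succ_self n)
        exact Nat.mul_lt_mul_of_pos_left this hf
      rw [mul_comm (p ^ n)]
      exact max_lt (ih.trans h2) h2
  have h1 : gtr p f (n + 1) = gtr p f n + f ^ p ^ n := by
    unfold gtr; rw [Finset.sum_range_succ]
  rw [h1, natDegree_add_eq_right_of_natDegree_lt, natDegree_pow, mul_comm]
  rw [natDegree_pow, mul_comm (p ^ n)]
  exact key n

/-- The Stepanov polynomial. -/
noncomputable def Psi (f : K[X]) (n A J : ℕ) (v : Fin p × Fin J × Fin A → K) : K[X] :=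
  ∑ t : Fin p × Fin J × Fin A, C (v t) * (X ^ (t.2.2 : ℕ) * gtr p f n ^ (t.1 : ℕ) * (X ^ p ^ n) ^ (t.2.1 : ℕ))

noncomputable def Phi (f : K[X]) (c : K) (n A J : ℕ) (v : Fin p × Fin J × Fin A → K) : K[X][X] :=
  ∑ t : Fin p × Fin J × Fin A, C (C (v t)) *
    (tau (X ^ (t.2.2 : ℕ)) * (C (C c) + Gtr p f n) ^ (t.1 : ℕ) * C (X ^ (t.2.1 : ℕ)))

lemma WD_Phi (f : K[X]) (c : K) (n A J : ℕ) (v : Fin p × Fin J × Fin A → K) :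
    WD (f.natDegree - 1) (A + J) (Phi p f c n A J v) := by
  refine WD.sum _ fun t _ => ?_
  have h1 : WD (f.natDegree - 1) 0 (C (C (v t))) := WD.C (by simp)
  have h2 : WD (f.natDegree - 1) A (tau (X ^ (t.2.2 : ℕ) : K[X])) :=
    (WD_tau _).mono (by rw [natDegree_X_pow]; exact t.2.2.2.le)
  have h3 : WD (f.natDegree - 1) 0 ((C (C c) + Gtr p f n) ^ (t.1 : ℕ)) :=
    ((WD.C (by simp)).add (WD_G p f n)).pow _
  have h4 : WD (f.natDegree - 1) J (C (X ^ (t.2.1 : ℕ) : K[X])) :=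
    WD.C (by rw [natDegree_X_pow]; exact t.2.1.2.le)
  exact (h1.mul ((h2.mul h3).mul h4)).mono (by omega)

lemma taylor_Psi (f : K[X]) (c : K) (n A J : ℕ) (v : Fin p × Fin J × Fin A → K) (x : K)
    (hx : x ^ p ^ n = x) (hc : (gtr p f n).eval x = c) :
    (X : K[X]) ^ p ^ n ∣ taylor x (Psi p f n A J v) - (Phi p f c n A J v).map (evalRingHom x) := by
  rw [← tau_eval]
  unfold Psi Phi
  rw [map_sum, Polynomial.map_sum, Polynomial.map_sum, ← Finset.sum_sub_distrib]
  refine Finset.dvd_sum fun t _ => ?_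
  have e1 : (tau (C (v t) * (X ^ (t.2.2 : ℕ) * gtr p f n ^ (t.1 : ℕ) * (X ^ p ^ n) ^ (t.2.1 : ℕ)))).map
      (evalRingHom x) = C (v t) * ((tau (X ^ (t.2.2 : ℕ))).map (evalRingHom x) *
        (C c + (Gtr p f n).map (evalRingHom x)) ^ (t.1 : ℕ)) * (X ^ p ^ n + C x) ^ (t.2.1 : ℕ) := by
    rw [map_mul, map_mul, map_mul, map_pow _ (gtr p f n), tau_gtr, map_pow _ (X ^ p ^ n),
      map_pow tau X (p ^ n), tau_X, tau_C]
    simp only [Polynomial.map_mul, Polynomial.map_pow, Polynomial.map_add, map_C, map_X,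
      coe_evalRingHom, eval_C, hc, eval_X]
    rw [add_pow_char_pow, ← C_pow, hx]
    ring
  have e2 : (C (C (v t)) * (tau (X ^ (t.2.2 : ℕ)) * (C (C c) + Gtr p f n) ^ (t.1 : ℕ) *
      C (X ^ (t.2.1 : ℕ)))).map (evalRingHom x) =
      C (v t) * ((tau (X ^ (t.2.2 : ℕ))).map (evalRingHom x) *
        (C c + (Gtr p f n).map (evalRingHom x)) ^ (t.1 : ℕ)) * (C x) ^ (t.2.1 : ℕ) := by
    simp only [Polynomial.map_mul, Polynomial.map_pow, Polynomial.map_add, map_C,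
      coe_evalRingHom, eval_C, eval_pow, eval_X, C_pow]
    ring
  rw [e1, e2, ← mul_sub]
  refine Dvd.dvd.mul_left ?_ _
  have := sub_dvd_pow_sub_pow (X ^ p ^ n + C x) (C x) (t.2.1 : ℕ)
  simpa using this

lemma Psi_ne_zero (f : K[X]) (hf : 0 < f.natDegree) (hpf : ¬ p ∣ f.natDegree) (n A J : ℕ)
    (hA : A ≤ p ^ n) (v : Fin p × Fin J × Fin A → K) (hv : v ≠ 0) :
    Psi p f (n + 1) A J v ≠ 0 ∧
      (Psi p f (n + 1) A J v).natDegree ≤ p ^ (n + 1) * (J + f.natDegree) := by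
  have hg := natDegree_gtr p f hf n
  have hgne : gtr p f (n + 1) ≠ 0 := by
    intro h0
    rw [h0, natDegree_zero] at hg
    have : 0 < f.natDegree * p ^ n := Nat.mul_pos hf (pow_pos hp.out.pos _)
    omega
  set T : Fin p × Fin J × Fin A → K[X] := fun t => C (v t) *
    (X ^ (t.2.2 : ℕ) * gtr p f (n+1) ^ (t.1 : ℕ) * (X ^ p ^ (n+1)) ^ (t.2.1 : ℕ)) with hT
  have hTn : ∀ t, v t ≠ 0 → T t ≠ 0 := by
    intro t ht
    simp only [hT]
    have hX : (X : K[X]) ≠ 0 := X_ne_zero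
    exact mul_ne_zero (C_ne_zero.2 ht) (mul_ne_zero (mul_ne_zero (pow_ne_zero _ hX)
      (pow_ne_zero _ hgne)) (pow_ne_zero _ (pow_ne_zero _ hX)))
  have hdeg : ∀ t, v t ≠ 0 → (T t).natDegree =
      (t.2.2 : ℕ) + p ^ n * ((t.1 : ℕ) * f.natDegree + p * (t.2.1 : ℕ)) := by
    intro t ht
    simp only [hT]
    have hX : (X : K[X]) ≠ 0 := X_ne_zero
    rw [natDegree_C_mul ht, natDegree_mul (mul_ne_zero (pow_ne_zero _ hX)
      (pow_ne_zero _ hgne)) (pow_ne_zero _ (pow_ne_zero _ hX)), natDegree_mul (pow_ne_zero _ hX)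
      (pow_ne_zero _ hgne), natDegree_X_pow, natDegree_pow, hg, natDegree_pow, natDegree_X_pow]
    ring
  have hvT : ∀ t, T t ≠ 0 → v t ≠ 0 := by
    intro t ht h0
    apply ht
    simp [hT, h0]
  constructor
  · have hdis : {i | i ∈ Finset.univ ∧ T i ≠ 0}.Pairwise
        (Function.onFun Ne (Polynomial.degree ∘ T)) := by
      rintro s ⟨-, hs⟩ t ⟨-, ht⟩ hst heq
      simp only [Function.comp] at heq
      apply hst
      have h1 := natDegree_eq_of_degree_eq heq
      rw [hdeg s (hvT s hs), hdeg t (hvT t ht)] at h1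
      have hs2 : (s.2.2 : ℕ) < p ^ n := s.2.2.2.trans_le hA
      have ht2 : (t.2.2 : ℕ) < p ^ n := t.2.2.2.trans_le hA
      have h2 : (s.2.2 : ℕ) = t.2.2 := by
        have := congrArg (· % p ^ n) h1
        simpa [Nat.add_mul_mod_self_left, Nat.mod_eq_of_lt hs2, Nat.mod_eq_of_lt ht2] using this
      have h3 : (s.1 : ℕ) * f.natDegree + p * (s.2.1 : ℕ) = (t.1 : ℕ) * f.natDegree + p * (t.2.1 : ℕ) := by
        rw [h2] at h1
        exact Nat.eq_of_mul_eq_mul_left (pow_pos hp.out.pos n) (Nat.add_left_cancel h1)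
      have h4 : (s.1 : ℕ) = t.1 := by
        have h5 : (s.1 : ℕ) * f.natDegree ≡ (t.1 : ℕ) * f.natDegree [MOD p] := by
          have := congrArg (· % p) h3
          simpa [Nat.add_mul_mod_self_left, Nat.ModEq] using this
        have h6 : (s.1 : ℕ) ≡ t.1 [MOD p] :=
          Nat.ModEq.cancel_right_of_coprime ((Nat.Prime.coprime_iff_not_dvd hp.out).2 hpf) h5
        rwa [Nat.ModEq, Nat.mod_eq_of_lt s.1.2, Nat.mod_eq_of_lt t.1.2] at h6
      have h7 : (s.2.1 : ℕ) = t.2.1 := by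
        rw [h4] at h3
        exact Nat.eq_of_mul_eq_mul_left hp.out.pos (Nat.add_left_cancel h3)
      exact Prod.ext (Fin.ext h4) (Prod.ext (Fin.ext h7) (Fin.ext h2))
    have hd := degree_sum_eq_of_disjoint T Finset.univ hdis
    obtain ⟨t, ht⟩ := Function.ne_iff.1 hv
    have hP : Psi p f (n + 1) A J v = ∑ t, T t := rfl
    intro h0
    rw [← hP, h0, degree_zero] at hd
    have := Finset.le_sup (f := fun i => (T i).degree) (Finset.mem_univ t)
    rw [← hd] at this
    exact hTn t ht (degree_eq_bot.1 (le_bot_iff.1 this))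
  · refine natDegree_sum_le_of_forall_le _ _ fun t _ => ?_
    change (T t).natDegree ≤ _
    by_cases ht : v t = 0
    · simp [hT, ht]
    rw [hdeg t ht]
    have h1 : (t.2.2 : ℕ) < p ^ n := t.2.2.2.trans_le hA
    have h2 : (t.1 : ℕ) + 1 ≤ p := t.1.2
    have h3 : (t.2.1 : ℕ) + 1 ≤ J := t.2.1.2
    have h4 : (t.1 : ℕ) * f.natDegree + p * (t.2.1 : ℕ) + 1 ≤ p * (J + f.natDegree) := by
      have := Nat.mul_le_mul_right f.natDegree h2
      have h6 := Nat.mul_le_mul_left p h3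
      have := hp.out.pos
      nlinarith
    have := Nat.mul_le_mul_left (p ^ n) h4
    rw [pow_succ]
    nlinarith

lemma stepanov (f : K[X]) (hf : 0 < f.natDegree) (hpf : ¬ p ∣ f.natDegree) (n A J l : ℕ)
    (hA : A ≤ p ^ n) (hl : l ≤ p ^ (n + 1))
    (hcnt : l * (A + J + (f.natDegree - 1) * l + 1) < p * J * A)
    (c : K) (S : Finset K) (hS : ∀ x ∈ S, x ^ p ^ (n + 1) = x ∧ (gtr p f (n + 1)).eval x = c) :
    S.card * l ≤ p ^ (n + 1) * (J + f.natDegree) := by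
  classical
  set B := A + J + (f.natDegree - 1) * l + 1 with hB
  have hadd : ∀ u v : Fin p × Fin J × Fin A → K, Phi p f c (n+1) A J (u + v) =
      Phi p f c (n+1) A J u + Phi p f c (n+1) A J v := by
    intro u v
    unfold Phi
    rw [← Finset.sum_add_distrib]
    refine Finset.sum_congr rfl fun t _ => ?_
    simp only [Pi.add_apply, C_add, add_mul]
  have hsmul : ∀ (a : K) (v : Fin p × Fin J × Fin A → K), Phi p f c (n+1) A J (a • v) =
      C (C a) * Phi p f c (n+1) A J v := by
    intro a v
    unfold Phi
    rw [Finset.mul_sum]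
    refine Finset.sum_congr rfl fun t _ => ?_
    simp only [Pi.smul_apply, smul_eq_mul, C_mul, mul_assoc]
  let Λ : (Fin p × Fin J × Fin A → K) →ₗ[K] (Fin l × Fin B → K) :=
    { toFun := fun v s => ((Phi p f c (n+1) A J v).coeff s.1).coeff s.2
      map_add' := by intro u v; ext s; simp [hadd]
      map_smul' := by intro a v; ext s; simp [hsmul] }
  have hker : Λ.ker ≠ ⊥ := by
    apply LinearMap.ker_ne_bot_of_finrank_lt
    simp only [Module.finrank_fintype_fun_eq_card, Fintype.card_prod, Fintype.card_fin]
    rw [← mul_assoc]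
    exact hcnt
  obtain ⟨v, hv, hv0⟩ := (Submodule.ne_bot_iff _).1 hker
  obtain ⟨hne, hnd⟩ := Psi_ne_zero p f hf hpf n A J hA v hv0
  have hPhi : ∀ m < l, (Phi p f c (n+1) A J v).coeff m = 0 := by
    intro m hm
    have hw := WD_Phi p f c (n+1) A J v m
    ext i
    rw [coeff_zero]
    by_cases hi : i < B
    · have := congrFun (LinearMap.mem_ker.1 hv) (⟨m, hm⟩, ⟨i, hi⟩)
      simpa [Λ] using this
    · apply coeff_eq_zero_of_natDegree_lt
      have : (f.natDegree - 1) * m ≤ (f.natDegree - 1) * l := Nat.mul_le_mul_left _ hm.le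
      omega
  have hdvd : ∀ x ∈ S, (X - C x) ^ l ∣ Psi p f (n+1) A J v := by
    intro x hx
    obtain ⟨h1, h2⟩ := hS x hx
    have h3 := taylor_Psi p f c (n+1) A J v x h1 h2
    have h4 : (X : K[X]) ^ l ∣ (Phi p f c (n+1) A J v).map (evalRingHom x) := by
      rw [X_pow_dvd_iff]
      intro m hm
      rw [coeff_map, hPhi m hm, map_zero]
    have h5 : (X : K[X]) ^ l ∣ taylor x (Psi p f (n+1) A J v) :=
      by simpa using dvd_add ((pow_dvd_pow X hl).trans h3) h4
    have h6 := map_dvd (taylorEquiv x).symm h5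
    have h7 : (taylorEquiv x).symm (taylor x (Psi p f (n+1) A J v)) = Psi p f (n+1) A J v :=
      (taylorEquiv x).symm_apply_apply _
    rw [h7, map_pow] at h6
    have h8 : (taylorEquiv x).symm X = X - C x := by
      rw [AlgEquiv.symm_apply_eq]
      change X = taylor x (X - C x)
      simp
    rwa [h8] at h6
  have hprod : ∏ x ∈ S, (X - C x) ^ l ∣ Psi p f (n+1) A J v := by
    refine Finset.prod_dvd_of_coprime ?_ hdvd
    intro x _ y _ hxy
    exact (isCoprime_X_sub_C_of_isUnit_sub (sub_ne_zero.2 hxy).isUnit).pow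
  have := (natDegree_le_of_dvd hprod hne).trans hnd
  rw [natDegree_prod _ _ (fun x _ => pow_ne_zero _ (X_sub_C_ne_zero x))] at this
  simpa using this

lemma stepanov_bound (k : ℕ) : ∃ D : ℝ, 0 ≤ D ∧ ∀ (f : K[X]), f.natDegree = k → 0 < k → ¬ p ∣ k →
    ∀ (n : ℕ) (c : K) (S : Finset K),
    (∀ x ∈ S, x ^ p ^ (n + 1) = x ∧ (gtr p f (n + 1)).eval x = c) →
    (S.card : ℝ) ≤ p ^ n + D * (Real.sqrt p) ^ (n + 1) := by
  have hp2 := hp.out.two_le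
  have hp0 := hp.out.pos
  set t : ℕ := p ^ 2 * (2 + k * p) with ht
  refine ⟨2 * (p * k + t) + (2 * t) ^ 4, by positivity, ?_⟩
  intro f hfk hk hpk n c S hS
  have hsq1 : (1:ℝ) ≤ Real.sqrt p := by
    rw [Real.one_le_sqrt]; exact_mod_cast hp0
  have hsqp : (Real.sqrt p) ^ 2 = p := Real.sq_sqrt (by positivity)
  set J : ℕ := p ^ ((n + 1) / 2) with hJ
  have hJ0 : 0 < J := pow_pos hp0 _
  have hJJ : J * J ≤ p ^ (n + 1) := by
    rw [hJ, ← pow_add]; exact Nat.pow_le_pow_right hp0 (by omega)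
  have hJs : (Real.sqrt p) ^ n ≤ (J : ℝ) := by
    rw [hJ]; push_cast
    nth_rw 2 [← hsqp]
    rw [← pow_mul]
    exact pow_le_pow_right₀ hsq1 (by omega)
  by_cases hbig : 2 * t ≤ p * J
  · have ht1 : 1 ≤ t := by rw [ht]; exact Nat.mul_pos (by positivity) (by omega)
    have hn : 1 ≤ n := by
      by_contra h0
      have : n = 0 := by omega
      subst this
      simp only [zero_add, Nat.reduceDiv, pow_zero] at hJ
      rw [hJ, ht] at hbig
      nlinarith [Nat.zero_le (k*p)]
    obtain ⟨l, hl⟩ := Nat.exists_eq_add_of_le (show t ≤ p * J by omega)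
    have hlJ : l ≤ p * J := by omega
    have hlp : l ≤ p ^ (n + 1) := by
      refine hlJ.trans ?_
      rw [hJ, ← pow_succ']
      exact Nat.pow_le_pow_right hp0 (by omega)
    have hcnt : l * (p ^ n + J + (f.natDegree - 1) * l + 1) < p * J * p ^ n := by
      rw [hfk, hl, add_mul]
      obtain ⟨k', rfl⟩ : ∃ k', k = k' + 1 := ⟨k - 1, by omega⟩
      simp only [Nat.add_sub_cancel]
      have hA : J * J ≤ p * p ^ n := by rw [← pow_succ']; exact hJJ
      have hpn : 0 < p ^ n := pow_pos hp0 n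
      have h1 : l * (J + k' * l + 1) ≤ p * J * (J + k' * (p * J) + J) := by
        gcongr
        exact hJ0
      have h2 : p * J * (J + k' * (p * J) + J) = p * (2 + k' * p) * (J * J) := by ring
      have h3 : p * (2 + k' * p) * (J * J) ≤ p * (2 + k' * p) * (p * p ^ n) := by gcongr
      have h4 : p * (2 + k' * p) * (p * p ^ n) < t * p ^ n := by
        have : t * p ^ n = p * (2 + k' * p) * (p * p ^ n) + p ^ 3 * p ^ n := by rw [ht]; ring
        have : 0 < p ^ 3 * p ^ n := by positivity
        omega
      nlinarith
    have key := stepanov p f (hfk ▸ hk) (hfk ▸ hpk) n (p ^ n) J l le_rfl hlp hcnt c S hS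
    rw [hfk] at key
    have keyR : (S.card : ℝ) * l ≤ p ^ (n + 1) * (J + k) := by exact_mod_cast key
    have hlR : (p : ℝ) * J = t + l := by exact_mod_cast hl
    have hbR : 2 * (t : ℝ) ≤ p * J := by exact_mod_cast hbig
    have hJR : (0:ℝ) < J := by exact_mod_cast hJ0
    have hpR : (2:ℝ) ≤ p := by exact_mod_cast hp2
    have hl2 : (p : ℝ) * J / 2 ≤ l := by linarith
    have hlpos : (0:ℝ) < l := lt_of_lt_of_le (by positivity) hl2
    have hsqn : (Real.sqrt p) ^ n * (Real.sqrt p) ^ n = (p:ℝ) ^ n := by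
      rw [← mul_pow, Real.mul_self_sqrt (by positivity)]
    have hE : (p:ℝ) ^ n ≤ (Real.sqrt p) ^ n * J := by
      rw [← hsqn]; gcongr
    have hD : (p:ℝ) ^ n * (p * k + t) ≤ 2 * (p * k + t) * (Real.sqrt p) ^ (n + 1) * l := by
      have h1 : (p:ℝ) ^ n ≤ 2 * (Real.sqrt p) ^ n * l := by
        have : (J:ℝ) ≤ 2 * l := by nlinarith
        calc (p:ℝ) ^ n ≤ (Real.sqrt p) ^ n * J := hE
          _ ≤ (Real.sqrt p) ^ n * (2 * l) := by gcongr
          _ = _ := by ring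
      have h2 : (Real.sqrt p) ^ n ≤ (Real.sqrt p) ^ (n + 1) :=
        pow_le_pow_right₀ hsq1 (by omega)
      calc (p:ℝ) ^ n * (p * k + t) ≤ (2 * (Real.sqrt p) ^ n * l) * (p * k + t) := by gcongr
        _ ≤ (2 * (Real.sqrt p) ^ (n + 1) * l) * (p * k + t) := by gcongr
        _ = _ := by ring
    have hfin : (S.card : ℝ) * l ≤ (p ^ n + 2 * (p * k + t) * (Real.sqrt p) ^ (n + 1)) * l := by
      refine keyR.trans ?_
      have : (p:ℝ) ^ (n + 1) * (J + k) = p ^ n * l + p ^ n * (p * k + t) := by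
        rw [pow_succ]
        have : (l : ℝ) = p * J - t := by linarith
        rw [this]; ring
      rw [this, add_mul]
      linarith
    have := le_of_mul_le_mul_right hfin hlpos
    have h5 : 0 ≤ (2 * (t:ℝ)) ^ 4 * (Real.sqrt p) ^ (n + 1) := by positivity
    nlinarith
  · push Not at hbig
    have hcard : S.card ≤ p ^ (n + 1) := by
      have hne : (X ^ p ^ (n + 1) - X : K[X]) ≠ 0 :=
        FiniteField.X_pow_card_pow_sub_X_ne_zero K (Nat.succ_ne_zero n) hp.out.one_lt
      have h1 : S.val ≤ (X ^ p ^ (n + 1) - X : K[X]).roots := by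
        rw [Multiset.le_iff_subset S.nodup]
        intro x hx
        rw [mem_roots hne]
        simp [(hS x hx).1]
      have h2 := (Multiset.card_le_card h1).trans (card_roots' _)
      rw [FiniteField.X_pow_card_pow_sub_X_natDegree_eq K (Nat.succ_ne_zero n) hp.out.one_lt] at h2
      exact h2
    have h1 : (p:ℝ) ^ (n + 1) ≤ (2 * t) ^ 4 := by
      have h2 : p ^ (n + 1) ≤ (p * J) ^ 4 := by
        rw [hJ, ← pow_succ', ← pow_mul]
        exact Nat.pow_le_pow_right hp0 (by omega)
      have h3 := h2.trans (Nat.pow_le_pow_left hbig.le 4)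
      exact_mod_cast h3
    have h4 : (S.card : ℝ) ≤ p ^ (n + 1) := by exact_mod_cast hcard
    have h5 : (1:ℝ) ≤ (Real.sqrt p) ^ (n + 1) := one_le_pow₀ hsq1
    have h6 : (0:ℝ) ≤ 2 * (p * k + t) := by positivity
    have h7 : (0:ℝ) ≤ (p:ℝ) ^ n := by positivity
    have h8 : (0:ℝ) ≤ (2 * (t:ℝ)) ^ 4 := by positivity
    nlinarith

end Stepanov
end Weil



set_option linter.unusedSectionVars false
set_option linter.unusedSimpArgs false

namespace Weil
open Polynomial

section LF
variable (p : ℕ) [hp : Fact p.Prime] {K : Type*} [Field K] [Algebra (ZMod p) K] [IsAlgClosed K]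
  [Algebra.IsAlgebraic (ZMod p) K] [CharP K p]

lemma fixed_range (x : K) (hx : x ^ p = x) : ∃ c : ZMod p, algebraMap (ZMod p) K c = x := by
  have h1 : x ∈ (⊥ : Subfield K) := (Subfield.mem_bot_iff_pow_eq_self K p).2 hx
  have h2 : (⊥ : Subfield K) ≤ (algebraMap (ZMod p) K).fieldRange := bot_le
  exact h2 h1

lemma aeval_frob (f : (ZMod p)[X]) (x : K) : aeval (x ^ p) f = (aeval x f) ^ p := by
  have := Polynomial.expand_aeval p f x
  rw [← this, ZMod.expand_card, map_pow]

lemma aeval_frob_pow (f : (ZMod p)[X]) (x : K) (i : ℕ) :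
    aeval (x ^ p ^ i) f = (aeval x f) ^ p ^ i := by
  induction i with
  | zero => simp
  | succ i ih => rw [pow_succ, pow_mul, aeval_frob, ih, pow_mul]

lemma minper_pos (x : K) : 0 < Function.minimalPeriod (frobenius K p) x := by
  have hint : IsIntegral (ZMod p) x := Algebra.IsIntegral.isIntegral x
  have hne : minpoly (ZMod p) x ≠ 0 := minpoly.ne_zero hint
  let R := {y : K // aeval y (minpoly (ZMod p) x) = 0}
  have hfin : Finite R := by
    have : Set.Finite {y : K | aeval y (minpoly (ZMod p) x) = 0} := by
      refine (((minpoly (ZMod p) x).rootSet_finite K)).subset ?_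
      intro y hy
      rw [mem_rootSet]; exact ⟨hne, hy⟩
    exact this.to_subtype
  let F : R → R := fun y => ⟨(y : K) ^ p, by
    rw [aeval_frob, y.2, zero_pow hp.out.ne_zero]⟩
  have hF : Function.Injective F := by
    intro a b hab
    have h1 : frobenius K p a = frobenius K p b := congrArg Subtype.val hab
    exact Subtype.ext (frobenius_inj K p h1)
  let x0 : R := ⟨x, minpoly.aeval _ _⟩
  obtain ⟨n, hn, hper⟩ := hF.mem_periodicPts x0
  have hit : ∀ n, ((F^[n] x0 : R) : K) = (frobenius K p)^[n] x := by
    intro n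
    induction n with
    | zero => rfl
    | succ n ih =>
      rw [Function.iterate_succ_apply', Function.iterate_succ_apply', ← ih]; rfl
  have : Function.IsPeriodicPt (frobenius K p) n x := by
    unfold Function.IsPeriodicPt Function.IsFixedPt
    rw [← hit, hper]
  exact this.minimalPeriod_pos hn

lemma mp_map (x : K) : (minpoly (ZMod p) x).map (algebraMap (ZMod p) K) =
    ∏ i ∈ Finset.range (Function.minimalPeriod (frobenius K p) x), (X - C (x ^ p ^ i)) := by
  set D := Function.minimalPeriod (frobenius K p) x with hD
  have hDpos : 0 < D := minper_pos p x
  have hint : IsIntegral (ZMod p) x := Algebra.IsIntegral.isIntegral x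
  have hxD : x ^ p ^ D = x := by
    have := Function.iterate_minimalPeriod (f := frobenius K p) (x := x)
    rwa [iterate_frobenius] at this
  set V : K[X] := ∏ i ∈ Finset.range D, (X - C (x ^ p ^ i)) with hV
  have hVm : V.Monic := monic_prod_of_monic _ _ fun i _ => monic_X_sub_C _
  -- V is Frobenius invariant
  have hVf : V.map (frobenius K p) = V := by
    rw [hV, Polynomial.map_prod]
    have h1 : ∀ i, (X - C (x ^ p ^ i)).map (frobenius K p) = X - C (x ^ p ^ (i + 1)) := by
      intro i
      rw [Polynomial.map_sub, map_X, map_C, frobenius_def, ← pow_mul, pow_succ]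
    simp_rw [h1]
    obtain ⟨D', hD'⟩ : ∃ D', D = D' + 1 := ⟨D - 1, by omega⟩
    rw [hD'] at hxD ⊢
    rw [Finset.prod_range_succ, Finset.prod_range_succ' _ D', hxD, pow_zero, pow_one]
  have hlift : V ∈ lifts (algebraMap (ZMod p) K) := by
    rw [lifts_iff_coeff_lifts]
    intro n
    have h1 : (V.coeff n) ^ p = V.coeff n := by
      conv_rhs => rw [← hVf]
      rw [coeff_map, frobenius_def]
    obtain ⟨c, hc⟩ := fixed_range p _ h1
    exact ⟨c, hc⟩
  obtain ⟨v, hv⟩ := hlift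
  have hv' : v.map (algebraMap (ZMod p) K) = V := hv
  have hdvd1 : (minpoly (ZMod p) x).map (algebraMap (ZMod p) K) ∣ V := by
    rw [← hv']
    apply Polynomial.map_dvd
    apply minpoly.dvd
    rw [aeval_def, ← eval_map, hv', hV, eval_prod]
    exact Finset.prod_eq_zero (Finset.mem_range.2 hDpos) (by simp)
  have hdvd2 : V ∣ (minpoly (ZMod p) x).map (algebraMap (ZMod p) K) := by
    refine Finset.prod_dvd_of_coprime ?_ ?_
    · intro i hi j hj hij
      apply isCoprime_X_sub_C_of_isUnit_sub
      refine (sub_ne_zero.2 ?_).isUnit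
      intro heq
      apply hij
      have := Function.iterate_injOn_Iio_minimalPeriod (f := frobenius K p) (x := x)
      apply this
      · simpa using hi
      · simpa using hj
      · simpa only [iterate_frobenius] using heq
    · intro i _
      rw [dvd_iff_isRoot, IsRoot.def, eval_map, ← aeval_def, aeval_frob_pow, minpoly.aeval,
        zero_pow (pow_ne_zero _ hp.out.ne_zero)]
  exact eq_of_monic_of_associated ((minpoly.monic hint).map _) hVm
    (associated_of_dvd_dvd hdvd1 hdvd2)

lemma mp_natDegree (x : K) : (minpoly (ZMod p) x).natDegree =
    Function.minimalPeriod (frobenius K p) x := by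
  rw [← natDegree_map (algebraMap (ZMod p) K), mp_map, natDegree_prod_of_monic _ _
    (fun i _ => monic_X_sub_C _)]
  simp_rw [natDegree_X_sub_C]
  simp

variable (K) in
/-- sum of `f` over the roots -/
noncomputable def tK (f u : (ZMod p)[X]) : K := ((u.aroots K).map (fun x => aeval x f)).sum

lemma tK_mul (f : (ZMod p)[X]) {u v : (ZMod p)[X]} (hu : u ≠ 0) (hv : v ≠ 0) :
    tK p K f (u * v) = tK p K f u + tK p K f v := by
  unfold tK
  rw [aroots_mul (mul_ne_zero hu hv), Multiset.map_add, Multiset.sum_add]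

lemma tK_pow (f : (ZMod p)[X]) (u : (ZMod p)[X]) (e : ℕ) :
    tK p K f (u ^ e) = e • tK p K f u := by
  unfold tK
  rw [aroots_pow, Multiset.map_nsmul, Multiset.sum_nsmul]

lemma tK_mp (f : (ZMod p)[X]) (x : K) : tK p K f (minpoly (ZMod p) x) =
    ∑ i ∈ Finset.range (minpoly (ZMod p) x).natDegree, (aeval x f) ^ p ^ i := by
  unfold tK
  rw [aroots, mp_map, roots_prod_X_sub_C_aux, mp_natDegree]
  simp [aeval_frob_pow, Finset.sum_eq_multiset_sum]
where
  roots_prod_X_sub_C_aux {n : ℕ} {x : K} : (∏ i ∈ Finset.range n, (X - C (x ^ p ^ i))).roots =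
      (Multiset.range n).map (fun i => x ^ p ^ i) := by
    have : ∏ i ∈ Finset.range n, (X - C (x ^ p ^ i)) =
        (((Multiset.range n).map (fun i => x ^ p ^ i)).map (fun a => X - C a)).prod := by
      rw [Multiset.map_map]; rfl
    rw [this, roots_multiset_prod_X_sub_C]

lemma pow_fix (x : K) : x ^ p ^ (minpoly (ZMod p) x).natDegree = x := by
  rw [mp_natDegree]
  have := Function.iterate_minimalPeriod (f := frobenius K p) (x := x)
  rwa [iterate_frobenius] at this

lemma deg_dvd_iff (x : K) (j : ℕ) : (minpoly (ZMod p) x).natDegree ∣ j ↔ x ^ p ^ j = x := by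
  rw [mp_natDegree, ← Function.isPeriodicPt_iff_minimalPeriod_dvd, Function.IsPeriodicPt,
    Function.IsFixedPt, iterate_frobenius]

lemma tK_cyc (f : (ZMod p)[X]) (x : K) (e : ℕ) :
    tK p K f (minpoly (ZMod p) x ^ e) =
    ∑ i ∈ Finset.range ((minpoly (ZMod p) x).natDegree * e), (aeval x f) ^ p ^ i := by
  rw [tK_pow, tK_mp]
  induction e with
  | zero => simp
  | succ e ih =>
    rw [add_smul, ih, one_smul, Nat.mul_succ, Finset.sum_range_add]
    congr 1
    refine Finset.sum_congr rfl fun i _ => ?_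
    rw [pow_add, pow_mul, ← aeval_frob_pow _ _ _ (_ * _), (deg_dvd_iff p x _).1 (Dvd.intro _ rfl)]

/-- multiplicity -/
lemma mult_iff (u : (ZMod p)[X]) (hu : u ≠ 0) (x : K) (e : ℕ) :
    minpoly (ZMod p) x ^ e ∣ u ↔ e ≤ (u.map (algebraMap (ZMod p) K)).rootMultiplicity x := by
  have hint : IsIntegral (ZMod p) x := Algebra.IsIntegral.isIntegral x
  have hirr := minpoly.irreducible hint
  have hinj := (algebraMap (ZMod p) K).injective
  have hune : u.map (algebraMap (ZMod p) K) ≠ 0 := (Polynomial.map_ne_zero_iff hinj).2 hu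
  constructor
  · intro h
    rw [le_rootMultiplicity_iff hune]
    refine dvd_trans (pow_dvd_pow_of_dvd ?_ e) (by simpa using Polynomial.map_dvd (algebraMap (ZMod p) K) h)
    rw [dvd_iff_isRoot, IsRoot.def, eval_map, ← aeval_def, minpoly.aeval]
  · induction e generalizing u with
    | zero => intro _; simp
    | succ e ih =>
      intro h
      have hroot : aeval x u = 0 := by
        rw [aeval_def, ← eval_map]
        exact (rootMultiplicity_pos hune).1 (by omega)
      obtain ⟨w, hw⟩ := minpoly.dvd _ _ hroot
      have hw0 : w ≠ 0 := by rintro rfl; simp at hw; exact hu hw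
      have hwne : w.map (algebraMap (ZMod p) K) ≠ 0 := (Polynomial.map_ne_zero_iff hinj).2 hw0
      have hmpne : (minpoly (ZMod p) x).map (algebraMap (ZMod p) K) ≠ 0 :=
        (Polynomial.map_ne_zero_iff hinj).2 hirr.ne_zero
      have h1 : rootMultiplicity x ((minpoly (ZMod p) x).map (algebraMap (ZMod p) K)) ≤ 1 := by
        classical
        rw [← count_roots]
        apply Multiset.nodup_iff_count_le_one.1
        exact nodup_roots (PerfectField.separable_of_irreducible hirr).map
      have h2 : e ≤ (w.map (algebraMap (ZMod p) K)).rootMultiplicity x := by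
        rw [hw, Polynomial.map_mul, rootMultiplicity_mul (mul_ne_zero hmpne hwne)] at h
        omega
      rw [hw, pow_succ']
      exact mul_dvd_mul_left _ (ih w hw0 hwne h2)

end LF
end Weil


set_option linter.unusedSectionVars false
set_option linter.unusedSimpArgs false

namespace Weil
open Polynomial

section LF2
variable (p : ℕ) [hp : Fact p.Prime] {K : Type*} [Field K] [Algebra (ZMod p) K] [IsAlgClosed K]
  [Algebra.IsAlgebraic (ZMod p) K] [CharP K p]

lemma mon_finite (n : ℕ) : {u : (ZMod p)[X] | u.Monic ∧ u.natDegree = n}.Finite := by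
  refine Set.Finite.of_injOn (f := fun u (i : Fin (n + 1)) => u.coeff i) (t := Set.univ)
    (fun _ _ => Set.mem_univ _) ?_ Set.finite_univ
  rintro u ⟨-, hu⟩ v ⟨-, hv⟩ huv
  ext i
  by_cases hi : i < n + 1
  · exact congrFun huv ⟨i, hi⟩
  · rw [coeff_eq_zero_of_natDegree_lt (by omega), coeff_eq_zero_of_natDegree_lt (by omega)]

noncomputable def Mon (n : ℕ) : Finset (ZMod p)[X] := (mon_finite p n).toFinset

lemma mem_Mon {n : ℕ} {u : (ZMod p)[X]} : u ∈ Mon p n ↔ u.Monic ∧ u.natDegree = n := by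
  simp [Mon]

lemma fix_finite (j : ℕ) : {x : K | 0 < j ∧ x ^ p ^ j = x}.Finite := by
  rcases Nat.eq_zero_or_pos j with rfl | hj
  · simp
  have hne : (X ^ p ^ j - X : K[X]) ≠ 0 :=
    FiniteField.X_pow_card_pow_sub_X_ne_zero K hj.ne' hp.out.one_lt
  refine ((X ^ p ^ j - X : K[X]).rootSet_finite K).subset ?_
  rintro x ⟨-, hx⟩
  rw [mem_rootSet]
  exact ⟨hne, by simp [hx]⟩

variable (K) in
noncomputable def Fx (j : ℕ) : Finset K := (fix_finite p j).toFinset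

lemma mem_Fx {j : ℕ} {x : K} : x ∈ Fx p K j ↔ 0 < j ∧ x ^ p ^ j = x := by
  simp [Fx]

noncomputable def Lc (f : (ZMod p)[X]) (Ψ : AddChar K ℂ) (n : ℕ) : ℂ :=
  ∑ u ∈ Mon p n, Ψ (tK p K f u)

noncomputable def Sc (f : (ZMod p)[X]) (Ψ : AddChar K ℂ) (j : ℕ) : ℂ :=
  ∑ x ∈ Fx p K j, Ψ (∑ i ∈ Finset.range j, (aeval x f) ^ p ^ i)

lemma count_div (d mu n : ℕ) (hd : 0 < d) (hn : d * mu ≤ n) :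
    ((Finset.Icc 1 n).filter (fun j => d ∣ j ∧ j / d ≤ mu)).card = mu := by
  have : (Finset.Icc 1 n).filter (fun j => d ∣ j ∧ j / d ≤ mu) =
      (Finset.Icc 1 mu).image (fun e => d * e) := by
    ext j
    simp only [Finset.mem_filter, Finset.mem_Icc, Finset.mem_image]
    constructor
    · rintro ⟨⟨h1, h2⟩, ⟨e, rfl⟩, h4⟩
      rw [Nat.mul_div_cancel_left _ hd] at h4
      exact ⟨e, ⟨Nat.pos_of_ne_zero (by rintro rfl; simp at h1), h4⟩, rfl⟩
    · rintro ⟨e, ⟨h1, h2⟩, rfl⟩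
      rw [Nat.mul_div_cancel_left _ hd]
      exact ⟨⟨Nat.mul_pos hd h1, (Nat.mul_le_mul_left d h2).trans hn⟩, Dvd.intro _ rfl, h2⟩
  rw [this, Finset.card_image_of_injective _ (fun a b h => Nat.eq_of_mul_eq_mul_left hd h)]
  simp

open Classical in
lemma count_mon (n : ℕ) (u : (ZMod p)[X]) (hu : u ∈ Mon p n) :
    n = ∑ j ∈ Finset.Icc 1 n, ((Fx p K j).filter
      (fun x => minpoly (ZMod p) x ^ (j / (minpoly (ZMod p) x).natDegree) ∣ u)).card := by
  obtain ⟨hm, hdeg⟩ := (mem_Mon p).1 hu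
  have hu0 := hm.ne_zero
  have hinj := (algebraMap (ZMod p) K).injective
  have hdpos : ∀ x : K, 0 < (minpoly (ZMod p) x).natDegree := fun x =>
    minpoly.natDegree_pos (Algebra.IsIntegral.isIntegral x)
  set R := (u.aroots K).toFinset with hR
  have h1 : ∀ j ∈ Finset.Icc 1 n, ((Fx p K j).filter
      (fun x => minpoly (ZMod p) x ^ (j / (minpoly (ZMod p) x).natDegree) ∣ u)) =
      R.filter (fun x => (minpoly (ZMod p) x).natDegree ∣ j ∧ j / (minpoly (ZMod p) x).natDegree ≤
        (u.map (algebraMap (ZMod p) K)).rootMultiplicity x) := by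
    intro j hj
    rw [Finset.mem_Icc] at hj
    ext x
    rw [Finset.mem_filter, Finset.mem_filter, mem_Fx, mult_iff p u hu0, hR, Multiset.mem_toFinset,
      mem_aroots, deg_dvd_iff]
    constructor
    · rintro ⟨⟨-, h2⟩, h3⟩
      refine ⟨⟨hu0, ?_⟩, h2, h3⟩
      have hune : u.map (algebraMap (ZMod p) K) ≠ 0 := (Polynomial.map_ne_zero_iff hinj).2 hu0
      have h4 : 0 < j / (minpoly (ZMod p) x).natDegree :=
        Nat.div_pos (Nat.le_of_dvd (by omega) ((deg_dvd_iff p x j).2 h2)) (hdpos x)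
      rw [aeval_def, ← eval_map]
      exact (rootMultiplicity_pos hune).1 (by omega)
    · rintro ⟨-, h2, h3⟩
      exact ⟨⟨by omega, h2⟩, h3⟩
  rw [Finset.sum_congr rfl fun j hj => by rw [h1 j hj]]
  simp_rw [Finset.card_filter]
  rw [Finset.sum_comm]
  simp_rw [← Finset.card_filter]
  rw [Finset.sum_congr rfl fun x _ => count_div _ _ n (hdpos x) ?_]
  · have h2 := Multiset.toFinset_sum_count_eq (u.aroots K)
    rw [IsAlgClosed.card_aroots_eq_natDegree, hdeg] at h2
    rw [← h2]
    exact Finset.sum_congr rfl fun x _ => count_roots _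
  · have h3 := (mult_iff p u hu0 x _).2 le_rfl
    have h4 := natDegree_le_of_dvd h3 hu0
    rw [natDegree_pow, hdeg, mul_comm] at h4
    exact h4

lemma Lrec (f : (ZMod p)[X]) (Ψ : AddChar K ℂ) (n : ℕ) :
    (n : ℂ) * Lc p f Ψ n = ∑ j ∈ Finset.Icc 1 n, Sc p f Ψ j * Lc p f Ψ (n - j) := by
  classical
  unfold Lc
  rw [Finset.mul_sum]
  have h1 : ∀ u ∈ Mon p n, (n : ℂ) * Ψ (tK p K f u) = ∑ j ∈ Finset.Icc 1 n, ∑ x ∈ Fx p K j,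
      if minpoly (ZMod p) x ^ (j / (minpoly (ZMod p) x).natDegree) ∣ u then Ψ (tK p K f u) else 0 := by
    intro u hu
    nth_rw 1 [count_mon (K := K) p n u hu]
    push_cast
    rw [Finset.sum_mul]
    refine Finset.sum_congr rfl fun j _ => ?_
    rw [← Finset.sum_filter, Finset.sum_const, nsmul_eq_mul]
  rw [Finset.sum_congr rfl h1, Finset.sum_comm]
  refine Finset.sum_congr rfl fun j hj => ?_
  rw [Finset.mem_Icc] at hj
  rw [Finset.sum_comm]
  unfold Sc
  rw [Finset.sum_mul]
  refine Finset.sum_congr rfl fun x hx => ?_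
  obtain ⟨hj0, hxj⟩ := (mem_Fx p).1 hx
  obtain ⟨e, he⟩ := (deg_dvd_iff p x j).2 hxj
  have hint : IsIntegral (ZMod p) x := Algebra.IsIntegral.isIntegral x
  have hdpos : 0 < (minpoly (ZMod p) x).natDegree := minpoly.natDegree_pos hint
  have hje : j / (minpoly (ZMod p) x).natDegree = e := by
    rw [he, Nat.mul_div_cancel_left _ hdpos]
  rw [hje]
  set v := minpoly (ZMod p) x ^ e with hv
  have hvm : v.Monic := (minpoly.monic hint).pow e
  have hvd : v.natDegree = j := by rw [hv, natDegree_pow, he, mul_comm]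
  have hvt : tK p K f v = ∑ i ∈ Finset.range j, (aeval x f) ^ p ^ i := by
    rw [hv, tK_cyc, ← he]
  rw [← hvt, Finset.mul_sum, ← Finset.sum_filter]
  symm
  refine Finset.sum_bij (fun w _ => v * w) ?_ ?_ ?_ ?_
  · intro w hw
    obtain ⟨hw1, hw2⟩ := (mem_Mon p).1 hw
    rw [Finset.mem_filter, mem_Mon]
    refine ⟨⟨hvm.mul hw1, ?_⟩, Dvd.intro _ rfl⟩
    rw [hvm.natDegree_mul hw1, hvd, hw2]; omega
  · intro a _ b _ hab
    exact mul_left_cancel₀ hvm.ne_zero hab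
  · intro u hu
    rw [Finset.mem_filter, mem_Mon] at hu
    obtain ⟨⟨hu1, hu2⟩, w, rfl⟩ := hu
    have hw1 : w.Monic := hvm.of_mul_monic_left hu1
    refine ⟨w, ?_, rfl⟩
    rw [mem_Mon]
    refine ⟨hw1, ?_⟩
    rw [hvm.natDegree_mul hw1, hvd] at hu2
    omega
  · intro w hw
    obtain ⟨hw1, hw2⟩ := (mem_Mon p).1 hw
    rw [tK_mul p f hvm.ne_zero hw1.ne_zero, AddChar.map_add_eq_mul]

lemma L_zero (f : (ZMod p)[X]) (Ψ : AddChar K ℂ) : Lc p f Ψ 0 = 1 := by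
  have : Mon p 0 = {1} := by
    ext u
    rw [mem_Mon, Finset.mem_singleton]
    constructor
    · rintro ⟨h1, h2⟩; exact h1.natDegree_eq_zero.1 h2
    · rintro rfl; simp
  unfold Lc
  rw [this, Finset.sum_singleton]
  simp [tK]

lemma newton_diff {n : ℕ} (α β : Fin n → K) (k : ℕ) (hk : 0 < k)
    (hes : ∀ i, i < k → MvPolynomial.aeval α (MvPolynomial.esymm (Fin n) K i) =
      MvPolynomial.aeval β (MvPolynomial.esymm (Fin n) K i)) :
    (∀ i, 0 < i → i < k → ∑ a, α a ^ i = ∑ a, β a ^ i) ∧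
    ∑ a, α a ^ k - ∑ a, β a ^ k = (-1) ^ (k + 1) * k *
      (MvPolynomial.aeval α (MvPolynomial.esymm (Fin n) K k) -
      MvPolynomial.aeval β (MvPolynomial.esymm (Fin n) K k)) := by
  have hps : ∀ (γ : Fin n → K) (i : ℕ), ∑ a, γ a ^ i =
      MvPolynomial.aeval γ (MvPolynomial.psum (Fin n) K i) := by
    intro γ i
    simp [MvPolynomial.psum]
  have hstep : ∀ i, 0 < i → i ≤ k → (∀ j, 0 < j → j < i → ∑ a, α a ^ j = ∑ a, β a ^ j) →
      ∑ a, α a ^ i - ∑ a, β a ^ i = (-1) ^ (i + 1) * i *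
      (MvPolynomial.aeval α (MvPolynomial.esymm (Fin n) K i) -
      MvPolynomial.aeval β (MvPolynomial.esymm (Fin n) K i)) := by
    intro i hi hik ih
    rw [hps, hps, MvPolynomial.psum_eq_mul_esymm_sub_sum _ _ i hi]
    simp only [map_sub, map_sum, map_mul, map_pow, map_neg, map_one, map_natCast]
    have : ∑ a ∈ Finset.HasAntidiagonal.antidiagonal i with a.1 ∈ Set.Ioo 0 i,
        (-1) ^ a.1 * MvPolynomial.aeval α (MvPolynomial.esymm (Fin n) K a.1) *
          MvPolynomial.aeval α (MvPolynomial.psum (Fin n) K a.2) =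
        ∑ a ∈ Finset.HasAntidiagonal.antidiagonal i with a.1 ∈ Set.Ioo 0 i,
        (-1) ^ a.1 * MvPolynomial.aeval β (MvPolynomial.esymm (Fin n) K a.1) *
          MvPolynomial.aeval β (MvPolynomial.psum (Fin n) K a.2) := by
      refine Finset.sum_congr rfl ?_
      rintro ⟨a, b⟩ hab
      rw [Finset.mem_filter, Finset.HasAntidiagonal.mem_antidiagonal] at hab
      obtain ⟨h1, h2, h3⟩ := hab
      simp only at h1 h2 h3 ⊢
      rw [hes a (by omega), ← hps, ← hps, ih b (by omega) (by omega)]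
    rw [this]
    ring
  have hall : ∀ i, 0 < i → i < k → ∑ a, α a ^ i = ∑ a, β a ^ i := by
    intro i
    induction i using Nat.strong_induction_on with
    | _ i ih =>
      intro h0 hik
      have := hstep i h0 hik.le (fun j hj hji => ih j hji hj (by omega))
      rw [hes i hik, sub_self, mul_zero, sub_eq_zero] at this
      exact this
  exact ⟨hall, hstep k hk le_rfl (fun j hj hjk => hall j hj hjk)⟩

lemma multiset_fn {n : ℕ} (s : Multiset K) (hs : s.card = n) :
    ∃ α : Fin n → K, s = Finset.univ.val.map α := by
  induction s using Quotient.inductionOn with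
  | _ l =>
    have hl : l.length = n := hs
    subst hl
    refine ⟨l.get, ?_⟩
    rw [Fin.univ_val_map, List.ofFn_get]; rfl

lemma tK_shift (f : (ZMod p)[X]) (k : ℕ) (hk : 0 < k) (hf : f.natDegree = k) (n : ℕ) (hn : k ≤ n)
    (u : (ZMod p)[X]) (hu : u ∈ Mon p n) (s : ZMod p) (hu' : u + C s * X ^ (n - k) ∈ Mon p n) :
    tK p K f (u + C s * X ^ (n - k)) = tK p K f u +
      algebraMap (ZMod p) K (- (f.coeff k * k * s)) := by
  obtain ⟨um, ud⟩ := (mem_Mon p).1 hu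
  obtain ⟨um', ud'⟩ := (mem_Mon p).1 hu'
  set u' := u + C s * X ^ (n - k) with hu'def
  have hc : (u.aroots K).card = n := by rw [IsAlgClosed.card_aroots_eq_natDegree, ud]
  have hc' : (u'.aroots K).card = n := by rw [IsAlgClosed.card_aroots_eq_natDegree, ud']
  obtain ⟨β, hβ⟩ := multiset_fn _ hc
  obtain ⟨α, hα⟩ := multiset_fn _ hc'
  have hes : ∀ (w : (ZMod p)[X]) (γ : Fin n → K), w.Monic → w.natDegree = n →
      w.aroots K = Finset.univ.val.map γ → ∀ i ≤ n,
      algebraMap (ZMod p) K (w.coeff (n - i)) = (-1) ^ i *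
        MvPolynomial.aeval γ (MvPolynomial.esymm (Fin n) K i) := by
    intro w γ wm wd hγ i hi
    have wd' : (w.map (algebraMap (ZMod p) K)).natDegree = n := by rw [natDegree_map, wd]
    have h1 := coeff_eq_esymm_roots_of_card (p := w.map (algebraMap (ZMod p) K))
      (by rw [wd', ← wd]; exact IsAlgClosed.card_aroots_eq_natDegree) (k := n - i) (by omega)
    rw [coeff_map, (wm.map _).leadingCoeff, wd', one_mul, show n - (n - i) = i by omega] at h1
    rw [h1, MvPolynomial.aeval_esymm_eq_multiset_esymm, ← hγ]
  have hesα := hes u' α um' ud' hα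
  have hesβ := hes u β um ud hβ
  have hsign : ∀ i : ℕ, ((-1 : K) ^ i) * (-1) ^ i = 1 := fun i => by
    rw [← mul_pow]; simp
  have hlow : ∀ i, i < k → MvPolynomial.aeval α (MvPolynomial.esymm (Fin n) K i) =
      MvPolynomial.aeval β (MvPolynomial.esymm (Fin n) K i) := by
    intro i hi
    have h1 : u'.coeff (n - i) = u.coeff (n - i) := by
      rw [hu'def, coeff_add, coeff_C_mul, coeff_X_pow, if_neg (by omega), mul_zero, add_zero]
    have h2 := hesα i (by omega)
    rw [h1, hesβ i (by omega)] at h2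
    have h3 := congrArg (fun y => (-1 : K) ^ i * y) h2
    simpa only [← mul_assoc, hsign, one_mul] using h3.symm
  have htop : MvPolynomial.aeval α (MvPolynomial.esymm (Fin n) K k) -
      MvPolynomial.aeval β (MvPolynomial.esymm (Fin n) K k) = (-1) ^ k * algebraMap (ZMod p) K s := by
    have h1 : u'.coeff (n - k) = u.coeff (n - k) + s := by
      rw [hu'def, coeff_add, coeff_C_mul, coeff_X_pow, if_pos rfl, mul_one]
    have h2 := hesα k hn
    rw [h1, map_add, hesβ k hn] at h2
    have h3 := congrArg (fun y => (-1 : K) ^ k * y) h2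
    simp only [mul_add, ← mul_assoc, hsign, one_mul] at h3
    rw [← h3]; ring
  obtain ⟨hN1, hN2⟩ := newton_diff α β k hk hlow
  have hsum : ∀ (w : (ZMod p)[X]) (γ : Fin n → K), w.aroots K = Finset.univ.val.map γ →
      tK p K f w = ∑ i ∈ Finset.range (k + 1), algebraMap (ZMod p) K (f.coeff i) * ∑ a, γ a ^ i := by
    intro w γ hγ
    unfold tK
    rw [hγ, Multiset.map_map]
    change ∑ a, aeval (γ a) f = _
    simp_rw [aeval_eq_sum_range, hf, Algebra.smul_def, Finset.mul_sum]
    rw [Finset.sum_comm]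
  rw [hsum u' α hα, hsum u β hβ, Finset.sum_range_succ, Finset.sum_range_succ _ k]
  have hl : ∀ i ∈ Finset.range k, algebraMap (ZMod p) K (f.coeff i) * ∑ a, α a ^ i =
      algebraMap (ZMod p) K (f.coeff i) * ∑ a, β a ^ i := by
    intro i hi
    rcases Nat.eq_zero_or_pos i with rfl | h0
    · simp
    · rw [hN1 i h0 (Finset.mem_range.1 hi)]
  rw [Finset.sum_congr rfl hl]
  have h9 : ∑ a, α a ^ k = ∑ a, β a ^ k - k * algebraMap (ZMod p) K s := by
    have h8 : (-1 : K) ^ (k + 1) * k * ((-1) ^ k * algebraMap (ZMod p) K s) =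
        - (((-1) ^ k * (-1) ^ k) * k * algebraMap (ZMod p) K s) := by ring
    rw [htop, h8, hsign, one_mul] at hN2
    linear_combination hN2
  rw [h9]
  simp only [map_neg, map_mul, map_natCast]
  ring

lemma L_vanish (f : (ZMod p)[X]) (k : ℕ) (hk : 0 < k) (hf : f.natDegree = k) (hpk : ¬ p ∣ k)
    (Ψ : AddChar K ℂ) (c : ZMod p) (hc : Ψ (algebraMap (ZMod p) K c) ≠ 1) (n : ℕ) (hn : k ≤ n) :
    Lc p f Ψ n = 0 := by
  have hfk : f.coeff k ≠ 0 := by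
    rw [← hf]; exact leadingCoeff_ne_zero.2 (by rintro rfl; simp at hf; omega)
  have hk0 : (k : ZMod p) ≠ 0 := by rwa [Ne, ZMod.natCast_eq_zero_iff]
  set s : ZMod p := -(c / (f.coeff k * k)) with hs
  have hsc : - (f.coeff k * k * s) = c := by
    rw [hs]; field_simp
  have hmem : ∀ (t : ZMod p) (u : (ZMod p)[X]), u ∈ Mon p n → u + C t * X ^ (n - k) ∈ Mon p n := by
    intro t u hu
    obtain ⟨h1, h2⟩ := (mem_Mon p).1 hu
    have hlt : (C t * X ^ (n - k)).degree < u.degree := by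
      rw [degree_eq_natDegree h1.ne_zero, h2]
      refine (degree_C_mul_X_pow_le _ _).trans_lt ?_
      exact_mod_cast (by omega : n - k < n)
    rw [mem_Mon]
    exact ⟨h1.add_of_left hlt, by rw [natDegree_add_eq_left_of_degree_lt hlt, h2]⟩
  have h1 : Lc p f Ψ n = Lc p f Ψ n * Ψ (algebraMap (ZMod p) K c) := by
    conv_lhs => unfold Lc
    unfold Lc
    rw [Finset.sum_mul]
    symm
    refine Finset.sum_bij (fun u _ => u + C s * X ^ (n - k)) (fun u hu => hmem s u hu) ?_ ?_ ?_
    · intro a _ b _ hab; exact add_right_cancel hab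
    · intro u hu
      refine ⟨u + C (-s) * X ^ (n - k), hmem (-s) u hu, ?_⟩
      simp
    · intro u hu
      rw [tK_shift p f k hk hf n hn u hu s (hmem s u hu), hsc, AddChar.map_add_eq_mul]
  have h2 : Lc p f Ψ n * (Ψ (algebraMap (ZMod p) K c) - 1) = 0 := by
    rw [mul_sub, mul_one, ← h1, sub_self]
  exact (mul_eq_zero.1 h2).resolve_right (sub_ne_zero.2 hc)

end LF2
end Weil


set_option linter.unusedSectionVars false
set_option linter.unusedSimpArgs false

namespace Weil
open Polynomial

lemma ana_no_zero (L S : ℕ → ℂ) (k : ℕ) (C R : ℝ) (hR : 0 < R) (h0 : L 0 = 1)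
    (hrec : ∀ n : ℕ, (n : ℂ) * L n = ∑ j ∈ Finset.Icc 1 n, S j * L (n - j))
    (hv : ∀ n, k ≤ n → L n = 0) (hS : ∀ j, 1 ≤ j → ‖S j‖ ≤ C * R ^ j) :
    ‖S 1‖ ≤ k * R := by
  have hC : 0 ≤ C := by
    have := (norm_nonneg _).trans (hS 1 le_rfl)
    rw [pow_one] at this
    exact nonneg_of_mul_nonneg_left this hR
  have hk : 0 < k := by
    by_contra hk
    have := hv 0 (by omega)
    rw [h0] at this; exact one_ne_zero this
  set P : ℂ[X] := ∑ n ∈ Finset.range k, Polynomial.C (L n) * X ^ n with hP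
  have hcoef : ∀ n, P.coeff n = L n := by
    intro n
    rw [hP, finsetSum_coeff]
    simp only [coeff_C_mul_X_pow]
    rw [Finset.sum_ite_eq (Finset.range k) n]
    split_ifs with hn
    · rfl
    · rw [Finset.mem_range, not_lt] at hn; rw [hv n hn]
  have hPev : ∀ T, P.eval T = ∑ n ∈ Finset.range k, L n * T ^ n := by
    intro T; rw [hP, eval_finsetSum]; simp
  have hPdev : ∀ T, T * (derivative P).eval T = ∑ n ∈ Finset.range k, (n : ℂ) * L n * T ^ n := by
    intro T; rw [hP, derivative_sum, eval_finsetSum, Finset.mul_sum]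
    refine Finset.sum_congr rfl fun n _ => ?_
    rcases Nat.eq_zero_or_pos n with rfl | hn
    · simp
    · obtain ⟨m, rfl⟩ : ∃ m, n = m + 1 := ⟨n - 1, by omega⟩
      simp; ring
  have hPdeg : P.natDegree ≤ k := by
    rw [natDegree_le_iff_coeff_eq_zero]
    intro n hn; rw [hcoef, hv n hn.le]
  have hP0 : P.eval 0 = 1 := by rw [← coeff_zero_eq_eval_zero, hcoef, h0]
  have hPne : P ≠ 0 := by rintro h; rw [h] at hP0; simp at hP0
  set S' : ℕ → ℂ := fun j => if j = 0 then 0 else S j with hS'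
  have hS'b : ∀ j, ‖S' j‖ ≤ C * R ^ j := by
    intro j; simp only [hS']; split_ifs with h
    · simp; positivity
    · exact hS j (by omega)
  have key : ∀ ρ : ℝ, 0 ≤ ρ → R * ρ < 1 → ∃ B : ℝ, ∀ T : ℂ, ‖T‖ ≤ ρ →
      ‖T * (derivative P).eval T‖ ≤ ‖P.eval T‖ * B := by
    intro ρ hρ hRρ
    refine ⟨∑' j, C * (R * ρ) ^ j, fun T hT => ?_⟩
    have hgs : Summable (fun j : ℕ => C * (R * ρ) ^ j) :=
      (summable_geometric_of_lt_one (by positivity) hRρ).mul_left _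
    have hb : ∀ j, ‖S' j * T ^ j‖ ≤ C * (R * ρ) ^ j := by
      intro j
      rw [norm_mul, norm_pow, mul_pow, ← mul_assoc]
      exact mul_le_mul (hS'b j) (pow_le_pow_left₀ (norm_nonneg _) hT j) (by positivity) (by positivity)
    have hs1 : Summable (fun j => ‖S' j * T ^ j‖) := Summable.of_nonneg_of_le (fun _ => norm_nonneg _) hb hgs
    have hLz : ∀ n ∉ Finset.range k, L n * T ^ n = 0 := by
      intro n hn; rw [Finset.mem_range, not_lt] at hn; rw [hv n hn, zero_mul]
    have hs2 : Summable (fun j => ‖L j * T ^ j‖) :=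
      summable_of_ne_finset_zero (s := Finset.range k) (fun n hn => by rw [hLz n hn, norm_zero])
    have h1 := tsum_mul_tsum_eq_tsum_sum_antidiagonal_of_summable_norm hs1 hs2
    have h2 : ∀ n, ∑ kl ∈ Finset.HasAntidiagonal.antidiagonal n, S' kl.1 * T ^ kl.1 * (L kl.2 * T ^ kl.2)
        = (n : ℂ) * L n * T ^ n := by
      intro n
      rw [hrec n, Finset.Nat.sum_antidiagonal_eq_sum_range_succ (fun a b => S' a * T ^ a * (L b * T ^ b)),
        Finset.sum_mul, Finset.sum_range_succ', Finset.range_eq_Ico]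
      have : S' 0 = 0 := by simp [hS']
      rw [this, zero_mul, zero_mul, add_zero]
      have h3 : ∑ i ∈ Finset.Icc 1 n, S i * L (n - i) * T ^ n =
          ∑ i ∈ Finset.Ico 0 n, S (i + 1) * L (n - (i + 1)) * T ^ n := by
        rw [Finset.sum_Ico_add' (fun i => S i * L (n - i) * T ^ n) 0 n 1]
        refine Finset.sum_congr ?_ fun _ _ => rfl
        ext i; simp only [Finset.mem_Icc, Finset.mem_Ico]; omega
      rw [h3]
      refine Finset.sum_congr rfl fun i hi => ?_
      rw [Finset.mem_Ico] at hi
      have : S' (i + 1) = S (i + 1) := by simp [hS']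
      rw [this]
      have e1 : T ^ n = T ^ (i + 1) * T ^ (n - (i + 1)) := by rw [← pow_add]; congr 1; omega
      rw [e1]; ring
    rw [tsum_congr h2, tsum_eq_sum (f := fun n : ℕ => (n : ℂ) * L n * T ^ n) (s := Finset.range k)
      (fun n hn => by rw [mul_assoc, hLz n hn, mul_zero]), ← hPdev,
      tsum_eq_sum (f := fun n : ℕ => L n * T ^ n) hLz, ← hPev] at h1
    rw [← h1, norm_mul, mul_comm]
    refine mul_le_mul_of_nonneg_left ?_ (norm_nonneg _)
    exact tsum_of_norm_bounded hgs.hasSum hb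
  have hnz : ∀ T0 : ℂ, P.eval T0 = 0 → 1 ≤ ‖T0‖ * R := by
    intro T0 hT0
    by_contra hlt
    push Not at hlt
    have hT0ne : T0 ≠ 0 := by rintro rfl; rw [hP0] at hT0; exact one_ne_zero hT0
    obtain ⟨G, hG1, hG2⟩ := exists_eq_pow_rootMultiplicity_mul_and_not_dvd P hPne T0
    set m := rootMultiplicity T0 P with hm
    have hmpos : 0 < m := (rootMultiplicity_pos hPne).2 hT0
    obtain ⟨m', hm'⟩ : ∃ m', m = m' + 1 := ⟨m - 1, by omega⟩
    have hG0 : G.eval T0 ≠ 0 := fun h => hG2 (dvd_iff_isRoot.2 h)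
    obtain ⟨ρ, hρ1, hρ2⟩ : ∃ ρ, ‖T0‖ < ρ ∧ ρ < 1 / R := exists_between (by rw [lt_div_iff₀ hR]; exact hlt)
    have hRρ : R * ρ < 1 := by rw [lt_div_iff₀ hR] at hρ2; linarith
    obtain ⟨B, hB⟩ := key ρ ((norm_nonneg _).trans hρ1.le) hRρ
    have hev : ∀ᶠ T in nhdsWithin T0 {T0}ᶜ,
        ‖T * (m * G.eval T + (T - T0) * (derivative G).eval T)‖ ≤ ‖(T - T0) * G.eval T‖ * B := by
      have h1 : ∀ᶠ T in nhds T0, ‖T‖ < ρ := (continuous_norm.tendsto T0).eventually (gt_mem_nhds hρ1)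
      filter_upwards [nhdsWithin_le_nhds h1, self_mem_nhdsWithin] with T hT1 hT2
      have hne : T - T0 ≠ 0 := sub_ne_zero.2 hT2
      have := hB T hT1.le
      have e1 : T * (derivative P).eval T = (T - T0) ^ m' *
          (T * (m * G.eval T + (T - T0) * (derivative G).eval T)) := by
        rw [hG1, hm']
        simp [derivative_mul, derivative_pow]
        ring
      have e2 : P.eval T = (T - T0) ^ m' * ((T - T0) * G.eval T) := by
        rw [hG1, hm']; simp; ring
      rw [e1, e2, norm_mul, norm_mul (_ ^ _), mul_assoc] at this
      exact le_of_mul_le_mul_left this (norm_pos_iff.2 (pow_ne_zero _ hne))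
    have t1 : Filter.Tendsto (fun T : ℂ => ‖T * (m * G.eval T + (T - T0) * (derivative G).eval T)‖)
        (nhdsWithin T0 {T0}ᶜ) (nhds ‖T0 * (m * G.eval T0 + (T0 - T0) * (derivative G).eval T0)‖) := by
      refine Filter.Tendsto.mono_left (Continuous.tendsto ?_ T0) nhdsWithin_le_nhds
      fun_prop
    have t2 : Filter.Tendsto (fun T : ℂ => ‖(T - T0) * G.eval T‖ * B)
        (nhdsWithin T0 {T0}ᶜ) (nhds (‖(T0 - T0) * G.eval T0‖ * B)) := by
      refine Filter.Tendsto.mono_left (Continuous.tendsto ?_ T0) nhdsWithin_le_nhds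
      fun_prop
    have := le_of_tendsto_of_tendsto t1 t2 hev
    rw [sub_self, zero_mul, zero_mul, norm_zero, zero_mul, add_zero, norm_le_zero_iff] at this
    refine (mul_ne_zero hT0ne (mul_ne_zero ?_ hG0)) this
    exact_mod_cast hmpos.ne'
  have hS1 : S 1 = (derivative P).eval 0 := by
    have := hrec 1
    simp [h0] at this
    rw [← this, ← coeff_zero_eq_eval_zero, coeff_derivative, hcoef]; simp
  have hdl := (IsAlgClosed.splits P).eval_derivative_div_eval_of_ne_zero (x := 0) (by rw [hP0]; exact one_ne_zero)
  rw [hP0, div_one, ← hS1] at hdl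
  rw [hdl]
  refine (norm_multiset_sum_le _).trans ?_
  rw [Multiset.map_map]
  refine (Multiset.sum_le_card_nsmul _ R ?_).trans ?_
  · intro x hx
    rw [Multiset.mem_map] at hx
    obtain ⟨a, ha, rfl⟩ := hx
    have := hnz a (isRoot_of_mem_roots ha)
    have hapos : 0 < ‖a‖ := by
      by_contra h
      have h' : ‖a‖ = 0 := le_antisymm (not_lt.1 h) (norm_nonneg _)
      rw [h'] at this; linarith
    simp only [Function.comp, zero_sub, norm_div, norm_neg, norm_one]
    rw [div_le_iff₀ hapos]; linarith
  · rw [nsmul_eq_mul, Multiset.card_map]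
    refine mul_le_mul_of_nonneg_right ?_ hR.le
    exact_mod_cast (card_roots' P).trans hPdeg
end Weil


set_option linter.unusedSectionVars false
set_option linter.unusedSimpArgs false

namespace Weil
open Polynomial

section WB
variable (p : ℕ) [hp : Fact p.Prime] {K : Type*} [Field K] [Algebra (ZMod p) K] [IsAlgClosed K]
  [Algebra.IsAlgebraic (ZMod p) K] [CharP K p]

lemma card_Fx (j : ℕ) (hj : 0 < j) : (Fx p K j).card = p ^ j := by
  classical
  have hne : (X ^ p ^ j - X : K[X]) ≠ 0 :=
    FiniteField.X_pow_card_pow_sub_X_ne_zero K hj.ne' hp.out.one_lt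
  have hsep : (X ^ p ^ j - X : K[X]).Separable := galois_poly_separable p (p ^ j) (dvd_pow_self p hj.ne')
  have h1 : Fx p K j = (X ^ p ^ j - X : K[X]).roots.toFinset := by
    ext x
    rw [mem_Fx, Multiset.mem_toFinset, mem_roots hne]
    simp [IsRoot, hj, sub_eq_zero]
  rw [h1, Multiset.toFinset_card_of_nodup (nodup_roots hsep),
    ← (IsAlgClosed.splits _).natDegree_eq_card_roots]
  exact FiniteField.X_pow_card_pow_sub_X_natDegree_eq K hj.ne' hp.out.one_lt

lemma tr_fixed (f : (ZMod p)[X]) (j : ℕ) (x : K) (hx : x ^ p ^ j = x) :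
    (∑ i ∈ Finset.range j, (aeval x f) ^ p ^ i) ^ p = ∑ i ∈ Finset.range j, (aeval x f) ^ p ^ i := by
  rw [sum_pow_char p]
  have h1 := Finset.sum_range_succ' (fun i => (aeval x f) ^ p ^ i) j
  rw [Finset.sum_range_succ] at h1
  have h2 : (aeval x f) ^ p ^ j = aeval x f := by rw [← aeval_frob_pow, hx]
  rw [h2, pow_zero, pow_one] at h1
  rw [add_right_cancel h1]
  exact Finset.sum_congr rfl fun i _ => by rw [← pow_mul, pow_succ]

lemma Sc_bound (f : (ZMod p)[X]) (hk : 0 < f.natDegree) (hpk : ¬ p ∣ f.natDegree)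
    (ψ : AddChar (ZMod p) ℂ) (hψ : ψ ≠ 1) (Ψ : AddChar K ℂ)
    (hΨ : ∀ c, Ψ (algebraMap (ZMod p) K c) = ψ c) :
    ∃ C : ℝ, ∀ j, 1 ≤ j → ‖Sc p f Ψ j‖ ≤ C * (√p) ^ j := by
  classical
  obtain ⟨D, hD, hst⟩ := stepanov_bound (K := K) p f.natDegree
  refine ⟨p * (p * D), fun j hj => ?_⟩
  obtain ⟨n, rfl⟩ : ∃ n, j = n + 1 := ⟨j - 1, by omega⟩
  set E : ℝ := D * √p ^ (n + 1) with hE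
  have hE0 : 0 ≤ E := by positivity
  set g : K → K := fun x => ∑ i ∈ Finset.range (n + 1), (aeval x f) ^ p ^ i with hg
  have hex : ∀ x : K, ∃ c : ZMod p, x ∈ Fx p K (n + 1) → algebraMap (ZMod p) K c = g x := by
    intro x
    by_cases hx : x ∈ Fx p K (n + 1)
    · obtain ⟨c, hc⟩ := fixed_range p (g x) (tr_fixed p f (n + 1) x ((mem_Fx p).1 hx).2)
      exact ⟨c, fun _ => hc⟩
    · exact ⟨0, fun h => absurd h hx⟩
  choose cc hcc using hex
  set Nn : ZMod p → ℝ := fun c => (((Fx p K (n + 1)).filter (fun x => cc x = c)).card : ℝ) with hNn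
  have hup : ∀ c, Nn c ≤ (p : ℝ) ^ n + E := by
    intro c
    refine hst (f.map (algebraMap (ZMod p) K)) (natDegree_map _) hk hpk n (algebraMap (ZMod p) K c) _ ?_
    intro x hx
    rw [Finset.mem_filter] at hx
    refine ⟨((mem_Fx p).1 hx.1).2, ?_⟩
    rw [← hx.2, hcc x hx.1, hg, gtr, eval_finsetSum]
    refine Finset.sum_congr rfl fun i _ => ?_
    rw [eval_pow, eval_map_algebraMap]
  have hsum : ∑ c, Nn c = (p : ℝ) ^ (n + 1) := by
    have := Finset.card_eq_sum_card_fiberwise (f := cc) (s := Fx p K (n + 1)) (t := Finset.univ)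
      (fun _ _ => Finset.mem_coe.2 (Finset.mem_univ _))
    rw [card_Fx p (n + 1) hj] at this
    simp only [hNn]
    exact_mod_cast this.symm
  have hp1 : (1 : ℝ) ≤ p := by exact_mod_cast hp.out.one_le
  have habs : ∀ c, |Nn c - (p : ℝ) ^ n| ≤ p * E := by
    intro c
    rw [abs_le]
    constructor
    · have h1 : ∑ c' ∈ Finset.univ.erase c, Nn c' ≤ ∑ c' ∈ Finset.univ.erase c, ((p : ℝ) ^ n + E) :=
        Finset.sum_le_sum fun c' _ => hup c'
      rw [Finset.sum_const, Finset.card_erase_of_mem (Finset.mem_univ _), Finset.card_univ, ZMod.card,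
        nsmul_eq_mul, Nat.cast_sub hp.out.one_le, Nat.cast_one] at h1
      have h2 := Finset.add_sum_erase Finset.univ Nn (Finset.mem_univ c)
      rw [hsum, pow_succ] at h2
      nlinarith
    · have := hup c
      nlinarith
  have hS : Sc p f Ψ (n + 1) = ∑ c, ((Nn c - (p : ℝ) ^ n : ℝ) : ℂ) * ψ c := by
    have h0 : ∑ c, ψ c = 0 := by
      have := AddChar.sum_eq_zero_of_ne_one hψ
      exact this
    have h1 : ∑ c, ((Nn c - (p : ℝ) ^ n : ℝ) : ℂ) * ψ c = ∑ c, ((Nn c : ℝ) : ℂ) * ψ c := by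
      simp only [Complex.ofReal_sub, sub_mul, Finset.sum_sub_distrib]
      rw [← Finset.mul_sum, h0, mul_zero, sub_zero]
    rw [h1, Sc]
    have h2 := Finset.sum_fiberwise_of_maps_to (s := Fx p K (n + 1)) (t := Finset.univ) (g := cc)
      (fun _ _ => Finset.mem_univ _) (fun x => ψ (cc x))
    have h3 : ∀ x ∈ Fx p K (n + 1), Ψ (∑ i ∈ Finset.range (n + 1), (aeval x f) ^ p ^ i) = ψ (cc x) := by
      intro x hx
      rw [← hΨ, hcc x hx]
    rw [Finset.sum_congr rfl h3, ← h2]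
    refine Finset.sum_congr rfl fun c _ => ?_
    rw [Finset.sum_congr rfl (g := fun _ => ψ c) (fun x hx => by rw [(Finset.mem_filter.1 hx).2])]
    rw [Finset.sum_const, nsmul_eq_mul]
    simp [hNn]
  rw [hS]
  refine (norm_sum_le _ _).trans ?_
  refine (Finset.sum_le_card_nsmul _ _ (p * E) ?_).trans ?_
  · intro c _
    rw [norm_mul, AddChar.norm_apply, mul_one, Complex.norm_real]
    exact habs c
  · rw [Finset.card_univ, ZMod.card, nsmul_eq_mul, hE]
    apply le_of_eq; ring
end WB

theorem weil (p : ℕ) [hp : Fact p.Prime] (f : (ZMod p)[X]) (hk : 0 < f.natDegree)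
    (hpk : ¬ p ∣ f.natDegree) (ψ : AddChar (ZMod p) ℂ) (hψ : ψ ≠ 1) :
    ‖∑ x : ZMod p, ψ (f.eval x)‖ ≤ f.natDegree * √p := by
  classical
  let K := AlgebraicClosure (ZMod p)
  have : CharP K p := charP_of_injective_algebraMap (algebraMap (ZMod p) K).injective p
  obtain ⟨π, hπ⟩ := LinearMap.exists_leftInverse_of_injective (Algebra.linearMap (ZMod p) K)
    (LinearMap.ker_eq_bot.2 (algebraMap (ZMod p) K).injective)
  have hπ' : ∀ c : ZMod p, π (algebraMap (ZMod p) K c) = c := fun c => LinearMap.congr_fun hπ c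
  let Ψ : AddChar K ℂ := ψ.compAddMonoidHom π.toAddMonoidHom
  have hΨ : ∀ c, Ψ (algebraMap (ZMod p) K c) = ψ c := by
    intro c
    change ψ (π (algebraMap (ZMod p) K c)) = ψ c
    rw [hπ']
  obtain ⟨C, hC⟩ := Sc_bound p f hk hpk ψ hψ Ψ hΨ
  obtain ⟨c, hc⟩ := AddChar.ne_one_iff.1 hψ
  have hpp : (0 : ℝ) < p := by exact_mod_cast hp.out.pos
  have := ana_no_zero (Lc p f Ψ) (Sc p f Ψ) f.natDegree C (√p) (Real.sqrt_pos.2 hpp) (L_zero p f Ψ)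
    (Lrec p f Ψ) (fun n hn => L_vanish p f _ hk rfl hpk Ψ c (by rw [hΨ]; exact hc) n hn) hC
  have h1 : Sc p f Ψ 1 = ∑ x : ZMod p, ψ (f.eval x) := by
    rw [Sc]
    symm
    refine Finset.sum_bij (fun x _ => algebraMap (ZMod p) K x) ?_ ?_ ?_ ?_
    · intro a _
      rw [mem_Fx]
      refine ⟨one_pos, ?_⟩
      rw [pow_one, ← map_pow, ZMod.pow_card]
    · intro a _ b _ hab; exact (algebraMap (ZMod p) K).injective hab
    · intro b hb
      rw [mem_Fx, pow_one] at hb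
      obtain ⟨c, hc⟩ := fixed_range p b hb.2
      exact ⟨c, Finset.mem_univ _, hc⟩
    · intro a _
      rw [Finset.sum_range_one, pow_zero, pow_one, aeval_algebraMap_apply, hΨ]
      simp
  rw [← h1]; exact this
end Weil


set_option linter.unusedSectionVars false
set_option linter.unusedSimpArgs false

namespace Cont
open Polynomial

/-- finite difference / Vandermonde lemma -/
lemma vander (n : ℕ) : ∃ Δ : ℤ, Δ ≠ 0 ∧ ∀ (F : ℤ[X]) (m : ℤ), F.natDegree ≤ n → (∀ x : ℤ, m ∣ F.eval x) →
    C m ∣ C Δ * F := by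
  let V : Matrix (Fin (n + 1)) (Fin (n + 1)) ℤ := Matrix.vandermonde (fun i => ((i : ℕ) : ℤ))
  refine ⟨V.det, ?_, ?_⟩
  · rw [Matrix.det_vandermonde_ne_zero_iff]
    intro a b hab
    have hab' : ((a : ℕ) : ℤ) = ((b : ℕ) : ℤ) := hab
    exact Fin.ext (by exact_mod_cast hab')
  · intro F m hF hm
    rw [C_dvd_iff_dvd_coeff]
    intro i
    rw [coeff_C_mul]
    by_cases hi : i < n + 1
    · let c : Fin (n + 1) → ℤ := fun i => F.coeff i
      have hVc : V.mulVec c = fun i : Fin (n + 1) => F.eval ((i : ℕ) : ℤ) := by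
        ext a
        rw [eval_eq_sum_range' (n := n + 1) (by omega), Finset.sum_range]
        simp only [V, c, Matrix.mulVec, dotProduct, Matrix.vandermonde_apply]
        exact Finset.sum_congr rfl fun _ _ => mul_comm _ _
      have h1 : V.adjugate.mulVec (V.mulVec c) = V.det • c := by
        rw [Matrix.mulVec_mulVec, Matrix.adjugate_mul, Matrix.smul_mulVec, Matrix.one_mulVec]
      have h2 := congrFun h1 ⟨i, hi⟩
      simp only [Pi.smul_apply, smul_eq_mul, c] at h2
      rw [← h2, hVc, Matrix.mulVec, dotProduct]
      exact Finset.dvd_sum fun a _ => Dvd.dvd.mul_left (hm _) _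
    · rw [coeff_eq_zero_of_natDegree_lt (by omega), mul_zero]; exact dvd_zero _

lemma bez_int (P : ℚ[X]) (g : ℤ[X]) (hc : IsCoprime P (g.map (algebraMap ℤ ℚ))) :
    ∃ D : ℤ, D ≠ 0 ∧ ∀ (p : ℕ) [Fact p.Prime] (z : ℤ_[p]), aeval (z : ℚ_[p]) P = 0 →
      aeval z g ∣ (D : ℤ_[p]) := by
  obtain ⟨a, b, hab⟩ := hc
  obtain ⟨D, hDm, hD⟩ := IsLocalization.integerNormalization_spec (nonZeroDivisors ℤ) b
  refine ⟨D, nonZeroDivisors.ne_zero hDm, ?_⟩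
  intro p _ z hz
  set B := IsLocalization.integerNormalization (nonZeroDivisors ℤ) b with hB
  refine ⟨aeval z B, ?_⟩
  have h1 := congrArg (fun u => aeval (z : ℚ_[p]) u) hab
  simp only [map_add, map_mul, hz, mul_zero, zero_add, map_one, aeval_map_algebraMap] at h1
  have h2 := congrArg (fun u => aeval (z : ℚ_[p]) u) hD
  simp only [aeval_map_algebraMap] at h2
  have key : ∀ u : ℤ[X], ((aeval z u : ℤ_[p]) : ℚ_[p]) = aeval (z : ℚ_[p]) u := by
    intro u
    have := aeval_algebraMap_apply ℚ_[p] z u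
    exact this.symm
  apply Subtype.coe_injective
  have h3 : aeval (z : ℚ_[p]) (D • b) = (D : ℚ_[p]) * aeval (z : ℚ_[p]) b := by
    rw [map_zsmul, zsmul_eq_mul]
  have h4 : (((D : ℤ_[p])) : ℚ_[p]) = ((aeval z g * aeval z B : ℤ_[p]) : ℚ_[p]) := by
    rw [PadicInt.coe_mul, key, key, h2, h3, PadicInt.coe_intCast]
    linear_combination (-(D : ℚ_[p])) * h1
  exact h4

lemma disc_bound (g : ℤ[X]) (f : ℚ[X]) (hf : f ≠ 0) :
    ∃ D : ℤ, D ≠ 0 ∧ ∀ (p : ℕ) [Fact p.Prime] (z : ℤ_[p]), aeval (z : ℚ_[p]) f = 0 →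
      aeval z g ≠ 0 → aeval z g ∣ (D : ℤ_[p]) := by
  induction f using UniqueFactorizationMonoid.induction_on_prime with
  | h₁ => exact absurd rfl hf
  | h₂ f hu =>
    refine ⟨1, one_ne_zero, ?_⟩
    intro p _ z hz
    exfalso
    have := hu.map (aeval (z : ℚ_[p]))
    rw [hz] at this
    exact not_isUnit_zero this
  | h₃ a P ha hP ih =>
    obtain ⟨D1, hD1, h1⟩ := ih ha
    have key : ∀ (p : ℕ) [Fact p.Prime] (z : ℤ_[p]), ((aeval z g : ℤ_[p]) : ℚ_[p]) = aeval (z : ℚ_[p]) g := by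
      intro p _ z
      exact (aeval_algebraMap_apply ℚ_[p] z g).symm
    by_cases hPg : P ∣ g.map (algebraMap ℤ ℚ)
    · refine ⟨D1, hD1, ?_⟩
      intro p _ z hz hg
      refine h1 p z ?_ hg
      rw [map_mul] at hz
      rcases mul_eq_zero.1 hz with h | h
      · exfalso
        apply hg
        apply Subtype.coe_injective
        change ((aeval z g : ℤ_[p]) : ℚ_[p]) = 0
        rw [key, ← aeval_map_algebraMap ℚ]
        obtain ⟨w, hw⟩ := hPg
        rw [hw, map_mul, h, zero_mul]
      · exact h
    · obtain ⟨D2, hD2, h2⟩ := bez_int P g ((Irreducible.coprime_iff_not_dvd hP.irreducible).2 hPg)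
      refine ⟨D1 * D2, mul_ne_zero hD1 hD2, ?_⟩
      intro p _ z hz hg
      rw [map_mul] at hz
      push_cast
      rcases mul_eq_zero.1 hz with h | h
      · exact Dvd.dvd.mul_left (h2 p z h) _
      · exact Dvd.dvd.mul_right (h1 p z h hg) _

lemma iter_der_comp (f : ℤ[X]) (r d : ℤ) (n : ℕ) :
    derivative^[n] (f.comp (C r + C d * X)) = C (d ^ n) * (derivative^[n] f).comp (C r + C d * X) := by
  induction n with
  | zero => simp
  | succ n ih =>
    rw [Function.iterate_succ_apply', ih, Function.iterate_succ_apply', derivative_C_mul, derivative_comp]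
    simp only [derivative_add, derivative_C, zero_add, derivative_mul, zero_mul, derivative_X, mul_one]
    rw [pow_succ, C_mul]; ring

theorem content
    (h : ℤ[X]) (hne : h ≠ 0)
    (z : ∀ (p : ℕ) [Fact p.Prime], ℤ_[p])
    (hz : ∀ (p : ℕ) [Fact p.Prime], aeval (z p) h = 0)
    (lam : ℕ → ℕ) (hlam1 : lam 1 = 1)
    (hlamMul : ∀ a b : ℕ, lam (a * b) = lam a * lam b)
    (hlamP : ∀ (p : ℕ) [Fact p.Prime],
      lam p = p ^ rootMultiplicity (z p) (h.map (algebraMap ℤ ℤ_[p])))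
    (r : ℕ → ℤ)
    (hrz : ∀ d : ℕ, 0 < d → ∀ (p : ℕ) [Fact p.Prime], ∀ α : ℕ, p ^ α ∣ d →
      (p : ℤ_[p]) ^ α ∣ (z p - (r d : ℤ_[p])))
    (H : ℕ → ℤ[X])
    (hH : ∀ d : ℕ, 0 < d → C (lam d : ℤ) * H d = h.comp (C (r d) + C (d : ℤ) * X))
    (hHdeg : ∀ d, 0 < d → (H d).natDegree ≤ h.natDegree) :
    ∃ D : ℕ, 0 < D ∧ ∀ d, 0 < d → ∀ p : ℕ, p.Prime → ∀ c : ℕ,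
      (∀ n : ℤ, ((p : ℤ) ^ c) ∣ (derivative (H d)).eval n) → p ^ c ≤ D := by
  obtain ⟨Δ, hΔ, hV⟩ := vander h.natDegree
  have hneQ : h.map (algebraMap ℤ ℚ) ≠ 0 := (Polynomial.map_ne_zero_iff (algebraMap ℤ ℚ).injective_int).2 hne
  choose Di hDi hDi2 using fun i : ℕ => disc_bound (derivative^[i] h) (h.map (algebraMap ℤ ℚ)) hneQ
  set E : ℤ := Δ * ∏ i ∈ Finset.range (h.natDegree + 1), Di i with hE
  have hEne : E ≠ 0 := mul_ne_zero hΔ (Finset.prod_ne_zero_iff.2 fun i _ => hDi i)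
  refine ⟨E.natAbs, Int.natAbs_pos.2 hEne, ?_⟩
  intro d hd p hp c hc
  have : Fact p.Prime := ⟨hp⟩
  suffices hdv : (p : ℤ) ^ c ∣ E by
    apply Nat.le_of_dvd (Int.natAbs_pos.2 hEne)
    have := Int.natAbs_dvd_natAbs.2 hdv
    rwa [Int.natAbs_pow, Int.natAbs_natCast] at this
  have hinj : Function.Injective (algebraMap ℤ ℤ_[p]) := (algebraMap ℤ ℤ_[p]).injective_int
  have hneP : h.map (algebraMap ℤ ℤ_[p]) ≠ 0 := (Polynomial.map_ne_zero_iff hinj).2 hne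
  set m := rootMultiplicity (z p) (h.map (algebraMap ℤ ℤ_[p])) with hm
  have hmpos : 0 < m := by
    rw [hm, rootMultiplicity_pos hneP, IsRoot, eval_map_algebraMap]; exact hz p
  have hmk : m ≤ h.natDegree := by
    classical
    rw [hm, ← count_roots]
    exact (Multiset.count_le_card _ _).trans ((card_roots' _).trans natDegree_map_le)
  -- h^{(m)}(z) ≠ 0
  have hnz : aeval (z p) (derivative^[m] h) ≠ 0 := by
    have h1 := eval_iterate_derivative_rootMultiplicity (p := h.map (algebraMap ℤ ℤ_[p])) (t := z p)
    have h2 := eval_divByMonic_pow_rootMultiplicity_ne_zero (p := h.map (algebraMap ℤ ℤ_[p])) (z p) hneP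
    rw [← hm] at h1 h2
    rw [← eval_map_algebraMap, ← iterate_derivative_map, h1, nsmul_eq_mul]
    exact mul_ne_zero (by exact_mod_cast Nat.factorial_ne_zero m) h2
  have hzQ : aeval ((z p : ℤ_[p]) : ℚ_[p]) (h.map (algebraMap ℤ ℚ)) = 0 := by
    rw [aeval_map_algebraMap]
    have := aeval_algebraMap_apply ℚ_[p] (z p) h
    rw [hz p, map_zero] at this
    exact this
  have hdiv1 : aeval (z p) (derivative^[m] h) ∣ ((∏ i ∈ Finset.range (h.natDegree + 1), Di i : ℤ) : ℤ_[p]) := by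
    refine (hDi2 m p (z p) hzQ hnz).trans ?_
    have := Finset.dvd_prod_of_mem Di (Finset.mem_range.2 (Nat.lt_succ_of_le hmk))
    exact_mod_cast (Int.castRingHom ℤ_[p]).map_dvd this
  -- decomposition of d
  obtain ⟨v, d', hpd', hdd⟩ := Nat.exists_eq_pow_mul_and_not_dvd hd.ne' p hp.ne_one
  have hlampow : ∀ n, lam (p ^ n) = p ^ (m * n) := by
    intro n
    induction n with
    | zero => simp [hlam1]
    | succ n ih => rw [pow_succ, hlamMul, ih, hlamP p, ← hm, ← pow_add, mul_add, mul_one]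
  have hlamd : lam d = p ^ (m * v) * lam d' := by rw [hdd, hlamMul, hlampow]
  have hu : IsUnit ((d' : ℤ_[p])) := by
    rw [PadicInt.isUnit_iff]
    have := (PadicInt.norm_int_lt_one_iff_dvd (p := p) (d' : ℤ)).not.2 (by exact_mod_cast hpd')
    have h2 := PadicInt.norm_le_one ((d' : ℤ_[p]))
    push_cast at this
    exact le_antisymm h2 (not_lt.1 this)
  obtain ⟨t, ht⟩ := hrz d hd p v (by rw [hdd]; exact dvd_mul_right _ _)
  obtain ⟨ui, hui⟩ := hu.exists_right_inv
  set x0 := t * ui with hx0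
  have hx0z : (r d : ℤ_[p]) + (d : ℤ_[p]) * x0 = z p := by
    have : (d : ℤ_[p]) = (p : ℤ_[p]) ^ v * d' := by rw [hdd]; push_cast; ring
    rw [this, hx0]
    linear_combination (p : ℤ_[p]) ^ v * t * hui - ht
  -- main identity
  obtain ⟨G, hG⟩ := hV (derivative (H d)) ((p : ℤ) ^ c)
    ((natDegree_derivative_le _).trans ((Nat.sub_le _ _).trans (hHdeg d hd))) hc
  have hid : C ((lam d : ℤ) * (p : ℤ) ^ c) * G = C Δ * derivative^[1] (h.comp (C (r d) + C (d : ℤ) * X)) := by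
    rw [← hH d hd, Function.iterate_one, derivative_C_mul, C_mul, mul_assoc, ← hG]; ring
  have hid2 := congrArg (fun u => derivative^[m - 1] u) hid
  simp only [iterate_derivative_C_mul] at hid2
  rw [← Function.iterate_add_apply, Nat.sub_add_cancel hmpos, iter_der_comp] at hid2
  have hid3 := congrArg (fun u => aeval x0 u) hid2
  simp only [map_mul, aeval_C, aeval_comp, map_add, aeval_X] at hid3
  simp only [eq_intCast, Int.cast_mul, Int.cast_pow, Int.cast_natCast, hx0z] at hid3
  have hd2 : (p : ℤ_[p]) ^ c ∣ (Δ : ℤ_[p]) * aeval (z p) (derivative^[m] h) := by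
    have e1 : (lam d : ℤ_[p]) = (p : ℤ_[p]) ^ (m * v) * lam d' := by rw [hlamd]; push_cast; ring
    have e2 : (d : ℤ_[p]) = (p : ℤ_[p]) ^ v * d' := by rw [hdd]; push_cast; ring
    have hp0 : (p : ℤ_[p]) ^ (m * v) ≠ 0 := pow_ne_zero _ (by exact_mod_cast hp.ne_zero)
    have e3 : (p : ℤ_[p]) ^ c * (lam d' * aeval x0 (derivative^[m - 1] G)) =
        (d' : ℤ_[p]) ^ m * ((Δ : ℤ_[p]) * aeval (z p) (derivative^[m] h)) := by
      apply mul_left_cancel₀ hp0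
      rw [e1, e2, mul_pow, ← pow_mul, mul_comm v m] at hid3
      linear_combination hid3
    exact (hu.pow m).dvd_mul_left.1 ⟨_, e3.symm⟩
  have hd3 : (p : ℤ_[p]) ^ c ∣ (E : ℤ_[p]) := by
    rw [hE]; push_cast [-Int.cast_prod]
    exact hd2.trans (mul_dvd_mul_left _ hdiv1)
  refine PadicInt.norm_int_le_pow_iff_dvd.1 (by
    obtain ⟨w, hw⟩ := hd3
    rw [hw, norm_mul, norm_pow, PadicInt.norm_p, zpow_neg, zpow_natCast, inv_pow]
    exact mul_le_of_le_one_right (by positivity) (PadicInt.norm_le_one _))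

/-- uniform properties of the auxiliary polynomials -/
structure Good (k D A : ℕ) (g : ℤ[X]) : Prop where
  deg : g.natDegree = k
  lead : 0 < g.leadingCoeff
  coef : ∀ i, |g.coeff i| ≤ A * g.leadingCoeff
  cont : ∀ p : ℕ, p.Prime → ∀ c : ℕ, (∀ n : ℤ, ((p : ℤ) ^ c) ∣ (derivative g).eval n) → p ^ c ≤ D

lemma lin_pow_coeff (r d : ℤ) (hr : |r| ≤ d) (j i : ℕ) :
    |((C r + C d * X : ℤ[X]) ^ j).coeff i| ≤ (2 * d) ^ j := by
  have hd : 0 ≤ d := (abs_nonneg r).trans hr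
  induction j generalizing i with
  | zero =>
    rw [pow_zero, pow_zero, coeff_one]; split_ifs <;> simp
  | succ j ih =>
    rw [pow_succ', pow_succ', add_mul, mul_assoc, coeff_add, coeff_C_mul, coeff_C_mul]
    have h1 : |(X * (C r + C d * X : ℤ[X]) ^ j).coeff i| ≤ (2 * d) ^ j := by
      cases i with
      | zero => rw [coeff_X_mul_zero, abs_zero]; positivity
      | succ i => rw [coeff_X_mul]; exact ih i
    calc _ ≤ |r * ((C r + C d * X : ℤ[X]) ^ j).coeff i| + |d * (X * (C r + C d * X : ℤ[X]) ^ j).coeff i| :=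
          abs_add_le _ _
      _ ≤ d * (2 * d) ^ j + d * (2 * d) ^ j := by
          rw [abs_mul, abs_mul, abs_of_nonneg hd]
          have := ih i
          gcongr
      _ = _ := by ring

theorem family
    (k : ℕ) (hk : 0 < k) (h : ℤ[X]) (hdeg : h.natDegree = k) (hlead : 0 < h.leadingCoeff)
    (z : ∀ (p : ℕ) [Fact p.Prime], ℤ_[p])
    (hz : ∀ (p : ℕ) [Fact p.Prime], aeval (z p) h = 0)
    (lam : ℕ → ℕ) (hlam1 : lam 1 = 1)
    (hlamMul : ∀ a b : ℕ, lam (a * b) = lam a * lam b)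
    (hlamP : ∀ (p : ℕ) [Fact p.Prime],
      lam p = p ^ rootMultiplicity (z p) (h.map (algebraMap ℤ ℤ_[p])))
    (r : ℕ → ℤ)
    (hr : ∀ d : ℕ, 0 < d → -(d : ℤ) < r d ∧ r d ≤ 0)
    (hrz : ∀ d : ℕ, 0 < d → ∀ (p : ℕ) [Fact p.Prime], ∀ α : ℕ, p ^ α ∣ d →
      (p : ℤ_[p]) ^ α ∣ (z p - (r d : ℤ_[p])))
    (H : ℕ → ℤ[X])
    (hH : ∀ d : ℕ, 0 < d → C (lam d : ℤ) * H d = h.comp (C (r d) + C (d : ℤ) * X)) :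
    ∃ D A B : ℕ, 0 < D ∧ ∀ d, 0 < d → Good k D A (H d) ∧ (H d).leadingCoeff ≤ B * (d : ℤ) ^ k := by
  have hne : h ≠ 0 := by rintro rfl; simp at hlead
  have hlampos : ∀ d, 0 < d → 0 < lam d := by
    intro d
    induction d using Nat.recOnMul with
    | zero => intro h; omega
    | one => intro _; rw [hlam1]; exact one_pos
    | prime p hp =>
      intro _
      have : Fact p.Prime := ⟨hp⟩
      rw [hlamP p]; exact pow_pos hp.pos _
    | mul a b iha ihb =>
      intro hab
      rw [hlamMul]
      exact Nat.mul_pos (iha (Nat.pos_of_mul_pos_right hab)) (ihb (Nat.pos_of_mul_pos_left hab))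
  have hlin : ∀ d : ℕ, 0 < d → (C (r d) + C (d : ℤ) * X : ℤ[X]).natDegree = 1 := by
    intro d hd
    rw [add_comm]; exact natDegree_linear (by exact_mod_cast hd.ne')
  have hHdeg : ∀ d, 0 < d → (H d).natDegree = k := by
    intro d hd
    have h1 := congrArg natDegree (hH d hd)
    rw [natDegree_C_mul (by exact_mod_cast (hlampos d hd).ne'), natDegree_comp, hlin d hd, mul_one, hdeg] at h1
    exact h1
  have hHlead : ∀ d, 0 < d → (lam d : ℤ) * (H d).leadingCoeff = h.leadingCoeff * (d : ℤ) ^ k := by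
    intro d hd
    have h1 := congrArg leadingCoeff (hH d hd)
    rw [leadingCoeff_mul, leadingCoeff_C, leadingCoeff_comp (by rw [hlin d hd]; exact one_ne_zero), hdeg] at h1
    rw [h1]
    congr 2
    rw [add_comm]; exact leadingCoeff_linear (by exact_mod_cast hd.ne')
  obtain ⟨D, hD, hcont⟩ := content h hne z hz lam hlam1 hlamMul hlamP r hrz H hH
    (fun d hd => by rw [hHdeg d hd, hdeg])
  set A : ℤ := (∑ j ∈ Finset.range (k + 1), |h.coeff j|) * 2 ^ k with hA
  have hA0 : 0 ≤ A := by positivity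
  refine ⟨D, A.natAbs, h.leadingCoeff.natAbs, hD, fun d hd => ?_⟩
  have hd1 : (1 : ℤ) ≤ d := by exact_mod_cast hd
  have hl1 : (1 : ℤ) ≤ lam d := by exact_mod_cast hlampos d hd
  have hposl : 0 < (H d).leadingCoeff := by
    have : 0 < (lam d : ℤ) * (H d).leadingCoeff := by rw [hHlead d hd]; positivity
    exact pos_of_mul_pos_right this (by omega)
  refine ⟨⟨hHdeg d hd, hposl, ?_, hcont d hd⟩, ?_⟩
  · intro i
    rw [Int.natCast_natAbs, abs_of_nonneg hA0]
    have h1 : |(h.comp (C (r d) + C (d : ℤ) * X)).coeff i| ≤ A * (d : ℤ) ^ k := by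
      rw [comp_eq_sum_left, sum_over_range' _ (by simp) (k + 1) (by omega), finsetSum_coeff, hA, Finset.sum_mul,
        Finset.sum_mul]
      refine (Finset.abs_sum_le_sum_abs _ _).trans (Finset.sum_le_sum fun j hj => ?_)
      rw [coeff_C_mul, abs_mul, mul_assoc, ← mul_pow]
      refine mul_le_mul_of_nonneg_left ?_ (abs_nonneg _)
      have := hr d hd
      refine (lin_pow_coeff (r d) d (by rw [abs_le]; omega) j i).trans ?_
      exact pow_le_pow_right₀ (by omega) (by rw [Finset.mem_range] at hj; omega)
    rw [← hH d hd, coeff_C_mul, abs_mul, abs_of_nonneg (by omega : (0 : ℤ) ≤ lam d)] at h1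
    have h2 : (d : ℤ) ^ k ≤ lam d * (H d).leadingCoeff := by
      rw [hHlead d hd]; exact le_mul_of_one_le_left (by positivity) hlead
    have h3 := h1.trans (mul_le_mul_of_nonneg_left h2 hA0)
    rw [mul_left_comm] at h3
    exact le_of_mul_le_mul_left h3 (by omega)
  · rw [Int.natCast_natAbs, abs_of_pos hlead, ← hHlead d hd]
    exact le_mul_of_one_le_left hposl.le hl1

section gam
variable {k D A : ℕ} {g : ℤ[X]}

lemma Good.gamma_spec (hg : Good k D A g) {p : ℕ} (hp : p.Prime) :
    0 < gammaExp g p ∧ (¬ ∀ n : ℤ, ((p : ℤ) ^ gammaExp g p) ∣ (derivative g).eval n) ∧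
      p ^ (gammaExp g p - 1) ≤ max D 1 := by
  have hne : {c : ℕ | 0 < c ∧ ¬ ∀ n : ℤ, ((p : ℤ) ^ c) ∣ (derivative g).eval n}.Nonempty := by
    refine ⟨D + 1, Nat.succ_pos _, fun h => ?_⟩
    have h1 := hg.cont p hp _ h
    have h2 := Nat.lt_pow_self hp.one_lt (n := D + 1)
    omega
  have hm := Nat.sInf_mem hne
  refine ⟨hm.1, hm.2, ?_⟩
  by_cases h1 : gammaExp g p = 1
  · rw [h1]; simp
  · have h2 : gammaExp g p - 1 ∉ {c : ℕ | 0 < c ∧ ¬ ∀ n : ℤ, ((p : ℤ) ^ c) ∣ (derivative g).eval n} := by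
      apply Nat.notMem_of_lt_sInf
      change gammaExp g p - 1 < gammaExp g p
      have : 0 < gammaExp g p := hm.1
      omega
    have hpos : 0 < gammaExp g p := hm.1
    simp only [Set.mem_setOf_eq, not_and, not_not] at h2
    exact (hg.cont p hp _ (h2 (by omega))).trans (le_max_left _ _)

lemma Good.gamma_le (hg : Good k D A g) (hD : 0 < D) {p : ℕ} (hp : p.Prime) :
    gammaExp g p = 1 ∨ p ^ gammaExp g p ≤ D ^ 2 := by
  obtain ⟨h1, h2, h3⟩ := hg.gamma_spec hp
  rw [max_eq_left (by omega)] at h3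
  by_cases h : gammaExp g p = 1
  · exact Or.inl h
  · right
    have h4 : p ^ gammaExp g p ≤ (p ^ (gammaExp g p - 1)) ^ 2 := by
      rw [← pow_mul]; exact Nat.pow_le_pow_right hp.pos (by omega)
    exact h4.trans (Nat.pow_le_pow_left h3 2)
end gam
end Cont


set_option linter.unusedSectionVars false
set_option linter.unusedSimpArgs false

namespace Avg

lemma e_add (x y : ℝ) : e (x + y) = e x * e y := by
  unfold e; rw [← Complex.exp_add]; congr 1; push_cast; ring

lemma e_norm (x : ℝ) : ‖e x‖ = 1 := by
  unfold e
  rw [show (2 * (Real.pi : ℂ) * Complex.I * x) = ((2 * Real.pi * x : ℝ) : ℂ) * Complex.I by push_cast; ring]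
  exact Complex.norm_exp_ofReal_mul_I _

lemma e_int (n : ℤ) : e n = 1 := by
  unfold e
  rw [Complex.exp_eq_one_iff]
  exact ⟨n, by push_cast; ring⟩

lemma e_eq_one_iff (x : ℝ) : e x = 1 ↔ ∃ n : ℤ, x = n := by
  constructor
  · intro h
    unfold e at h
    rw [Complex.exp_eq_one_iff] at h
    obtain ⟨n, hn⟩ := h
    refine ⟨n, ?_⟩
    have h2 : (2 * (Real.pi : ℂ) * Complex.I) ≠ 0 := Complex.two_pi_I_ne_zero
    have h3 : (x : ℂ) = n := by
      apply mul_left_cancel₀ h2; rw [hn]; ring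
    exact_mod_cast h3
  · rintro ⟨n, rfl⟩; exact e_int n

/-- `e(c/n)` only depends on `c` modulo `n` -/
lemma e_congr (n : ℕ) (hn : 0 < n) (a b : ℤ) (h : (n : ℤ) ∣ a - b) : e ((a : ℝ) / n) = e ((b : ℝ) / n) := by
  obtain ⟨t, ht⟩ := h
  have hn' : (n : ℝ) ≠ 0 := by exact_mod_cast hn.ne'
  have h2 : (a : ℝ) = b + n * t := by
    have : a = b + n * t := by linarith
    rw [this]; push_cast; ring
  rw [h2, add_div, mul_div_cancel_left₀ _ hn', e_add, e_int, mul_one]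

lemma e_geom (n : ℕ) (hn : 0 < n) (c : ℤ) (h : ¬ (n : ℤ) ∣ c) :
    ∑ t ∈ Finset.range n, e ((c * (t : ℤ) : ℤ) / (n : ℝ)) = 0 := by
  have hn' : (n : ℝ) ≠ 0 := by exact_mod_cast hn.ne'
  have hne : e ((c : ℝ) / n) ≠ 1 := by
    intro h1
    obtain ⟨m, hm⟩ := (e_eq_one_iff _).1 h1
    rw [div_eq_iff hn'] at hm
    apply h
    exact ⟨m, by have : (c : ℝ) = ((n * m : ℤ) : ℝ) := by rw [hm]; push_cast; ring
                 exact_mod_cast this⟩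
  have hpow : ∀ t : ℕ, e ((c * (t : ℤ) : ℤ) / (n : ℝ)) = e ((c : ℝ) / n) ^ t := by
    intro t
    induction t with
    | zero => simp [e]
    | succ t ih =>
      rw [pow_succ, ← ih, ← e_add]; congr 1; push_cast; ring
  simp only [hpow]
  have h2 : (∑ t ∈ Finset.range n, e ((c : ℝ) / n) ^ t) * (e ((c : ℝ) / n) - 1) = 0 := by
    rw [geom_sum_mul, ← hpow]
    have : ((c * (n : ℤ) : ℤ) : ℝ) / n = (c : ℝ) := by push_cast; field_simp
    rw [this, e_int, sub_self]
  exact (mul_eq_zero.1 h2).resolve_right (sub_ne_zero.2 hne)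

noncomputable def avg (Q : ℕ) (F : ℕ → ℂ) : ℂ := (∑ x ∈ Finset.range Q, F x) / Q

lemma per_mod {F : ℕ → ℂ} {Q : ℕ} (hF : Function.Periodic F Q) (x : ℕ) : F (x % Q) = F x :=
  hF.map_mod_nat x

lemma sum_range_mul {F : ℕ → ℂ} {Q : ℕ} (hF : Function.Periodic F Q) (t : ℕ) :
    ∑ x ∈ Finset.range (Q * t), F x = t * ∑ x ∈ Finset.range Q, F x := by
  induction t with
  | zero => simp
  | succ t ih =>
    rw [mul_add, mul_one, Finset.sum_range_add, ih]
    have : ∀ x, F (Q * t + x) = F x := by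
      intro x; rw [← per_mod hF (Q * t + x), Nat.mul_add_mod, per_mod hF]
    simp only [this]; push_cast; ring

lemma avg_mul {F : ℕ → ℂ} {Q : ℕ} (hF : Function.Periodic F Q) (t : ℕ) (ht : 0 < t) :
    avg (Q * t) F = avg Q F := by
  unfold avg
  rw [sum_range_mul hF]
  have : (t : ℂ) ≠ 0 := by exact_mod_cast ht.ne'
  push_cast
  rw [mul_comm (Q : ℂ), mul_div_mul_left _ _ this]

lemma avg_dvd {F : ℕ → ℂ} {Q Q' : ℕ} (hF : Function.Periodic F Q) (h : Q ∣ Q') (hQ' : 0 < Q') :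
    avg Q' F = avg Q F := by
  obtain ⟨t, rfl⟩ := h
  exact avg_mul hF t (Nat.pos_of_mul_pos_left hQ')

lemma avg_coprime {F G : ℕ → ℂ} {Q R : ℕ} (hF : Function.Periodic F Q) (hG : Function.Periodic G R)
    (hQ : 0 < Q) (hR : 0 < R) (hc : Nat.Coprime Q R) :
    avg (Q * R) (fun x => F x * G x) = avg Q F * avg R G := by
  unfold avg
  rw [div_mul_div_comm, Finset.sum_mul_sum, ← Finset.sum_product', Nat.cast_mul]
  congr 1
  refine Finset.sum_bij (fun x _ => (x % Q, x % R)) ?_ ?_ ?_ ?_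
  · intro x _
    rw [Finset.mem_product, Finset.mem_range, Finset.mem_range]
    exact ⟨Nat.mod_lt _ hQ, Nat.mod_lt _ hR⟩
  · intro x hx y hy hxy
    rw [Finset.mem_range] at hx hy
    obtain ⟨h1, h2⟩ := Prod.mk.inj hxy
    have := (Nat.modEq_and_modEq_iff_modEq_mul hc).1 ⟨h1, h2⟩
    exact Nat.ModEq.eq_of_lt_of_lt this hx hy
  · rintro ⟨b1, b2⟩ hb
    rw [Finset.mem_product, Finset.mem_range, Finset.mem_range] at hb
    obtain ⟨x, hx1, hx2⟩ := Nat.chineseRemainder hc b1 b2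
    refine ⟨x % (Q * R), Finset.mem_range.2 (Nat.mod_lt _ (Nat.mul_pos hQ hR)), ?_⟩
    ext
    · simp only [Nat.mod_mul_right_mod]; rw [hx1, Nat.mod_eq_of_lt hb.1]
    · simp only [Nat.mod_mul_left_mod]; rw [hx2, Nat.mod_eq_of_lt hb.2]
  · intro x _
    rw [per_mod hF, per_mod hG]

lemma norm_avg_le {F : ℕ → ℂ} {Q : ℕ} {B : ℝ} (hQ : 0 < Q) (hb : ∀ x, ‖F x‖ ≤ B) : ‖avg Q F‖ ≤ B := by
  unfold avg
  have hQ' : (0 : ℝ) < Q := by exact_mod_cast hQ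
  rw [norm_div, Complex.norm_natCast, div_le_iff₀ hQ']
  refine (norm_sum_le _ _).trans ((Finset.sum_le_card_nsmul _ _ B fun x _ => hb x).trans ?_)
  rw [Finset.card_range, nsmul_eq_mul, mul_comm]

lemma sum_range_approx {F : ℕ → ℂ} {Q : ℕ} (hF : Function.Periodic F Q) (hQ : 0 < Q)
    (hb : ∀ x, ‖F x‖ ≤ 1) (n : ℕ) :
    ‖∑ x ∈ Finset.range n, F x - n * avg Q F‖ ≤ 2 * Q := by
  have hn := Nat.div_add_mod n Q
  set t := n / Q
  set s := n % Q with hs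
  have hsQ : s < Q := Nat.mod_lt _ hQ
  have hQ0 : (Q : ℂ) ≠ 0 := by exact_mod_cast hQ.ne'
  have h1 : ∑ x ∈ Finset.range n, F x = t * ∑ x ∈ Finset.range Q, F x + ∑ x ∈ Finset.range s, F x := by
    conv_lhs => rw [← hn]
    rw [Finset.sum_range_add, sum_range_mul hF]
    have : ∀ x, F (Q * t + x) = F x := by
      intro x; rw [← per_mod hF (Q * t + x), Nat.mul_add_mod, per_mod hF]
    simp only [this]
  have h2 : (n : ℂ) = Q * t + s := by exact_mod_cast hn.symm
  have h3 : ∑ x ∈ Finset.range n, F x - n * avg Q F = ∑ x ∈ Finset.range s, F x - s * avg Q F := by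
    rw [h1, h2]; unfold avg; field_simp; ring
  rw [h3]
  have h4 : ‖∑ x ∈ Finset.range s, F x‖ ≤ s := by
    refine (norm_sum_le _ _).trans ((Finset.sum_le_card_nsmul _ _ 1 fun x _ => hb x).trans ?_)
    simp
  have h5 : ‖(s : ℂ) * avg Q F‖ ≤ s := by
    rw [norm_mul, Complex.norm_natCast]
    exact mul_le_of_le_one_right (Nat.cast_nonneg _) (norm_avg_le hQ hb)
  have h6 : (s : ℝ) ≤ Q := by exact_mod_cast hsQ.le
  linarith [norm_sub_le (∑ x ∈ Finset.range s, F x) ((s : ℂ) * avg Q F)]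

lemma norm_avg_le_avg {F : ℕ → ℂ} {G : ℕ → ℝ} {Q : ℕ} (hb : ∀ x, ‖F x‖ ≤ G x) :
    ‖avg Q F‖ ≤ (∑ x ∈ Finset.range Q, G x) / Q := by
  unfold avg
  rw [norm_div, Complex.norm_natCast]
  exact div_le_div_of_nonneg_right ((norm_sum_le _ _).trans (Finset.sum_le_sum fun x _ => hb x)) (Nat.cast_nonneg _)

lemma avg_congr {F G : ℕ → ℂ} {Q : ℕ} (h : ∀ x, F x = G x) : avg Q F = avg Q G := by
  rw [show F = G from funext h]

lemma avg_sum {ι : Type*} (s : Finset ι) (F : ι → ℕ → ℂ) (Q : ℕ) :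
    avg Q (fun x => ∑ i ∈ s, F i x) = ∑ i ∈ s, avg Q (F i) := by
  unfold avg; rw [Finset.sum_comm, Finset.sum_div]

lemma per_dvd {F : ℕ → ℂ} {Q R : ℕ} (hF : Function.Periodic F Q) (h : Q ∣ R) : Function.Periodic F R := by
  obtain ⟨t, rfl⟩ := h
  have := hF.nat_mul t
  rwa [mul_comm] 

end Avg


set_option linter.unusedSectionVars false
set_option linter.unusedSimpArgs false

namespace Loc
open Polynomial Avg Cont

def bad (g : ℤ[X]) (p : ℕ) (n : ℤ) : Prop := (p : ℤ) ^ gammaExp g p ∣ (derivative g).eval n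

open scoped Classical in
noncomputable def bd (g : ℤ[X]) (p : ℕ) (x : ℕ) : ℂ := if bad g p x then 1 else 0

open scoped Classical in
noncomputable def gd (g : ℤ[X]) (p : ℕ) (x : ℕ) : ℂ := if bad g p x then 0 else 1

noncomputable def ph (g : ℤ[X]) (a : ℤ) (q : ℕ) (x : ℕ) : ℂ := e ((a * g.eval (x : ℤ) : ℤ) / (q : ℝ))

noncomputable def jr (g : ℤ[X]) (p : ℕ) : ℝ := (jCount g p : ℝ) / (p : ℝ) ^ gammaExp g p

lemma gd_eq (g : ℤ[X]) (p x : ℕ) : gd g p x = 1 - bd g p x := by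
  unfold gd bd; split_ifs <;> simp

lemma bad_congr (g : ℤ[X]) (p : ℕ) (x y : ℤ) (h : (p : ℤ) ^ gammaExp g p ∣ x - y) : bad g p x ↔ bad g p y := by
  have := h.trans (sub_dvd_eval_sub x y (derivative g))
  unfold bad
  exact (dvd_iff_dvd_of_dvd_sub this)

lemma bd_per (g : ℤ[X]) (p : ℕ) : Function.Periodic (bd g p) (p ^ gammaExp g p) := by
  intro x
  have := bad_congr g p ((x + p ^ gammaExp g p : ℕ) : ℤ) x (by push_cast; simp)
  unfold bd
  by_cases h : bad g p x
  · rw [if_pos (this.2 h), if_pos h]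
  · rw [if_neg (fun h' => h (this.1 h')), if_neg h]

lemma gd_per (g : ℤ[X]) (p : ℕ) : Function.Periodic (gd g p) (p ^ gammaExp g p) := by
  intro x
  rw [gd_eq, gd_eq, bd_per]

lemma ph_per (g : ℤ[X]) (a : ℤ) (q : ℕ) (hq : 0 < q) : Function.Periodic (ph g a q) q := by
  intro x
  unfold ph
  apply e_congr q hq
  rw [← mul_sub]
  refine Dvd.dvd.mul_left ?_ _
  refine Dvd.dvd.trans ?_ (sub_dvd_eval_sub _ _ _)
  push_cast; simp

lemma ph_norm (g : ℤ[X]) (a : ℤ) (q x : ℕ) : ‖ph g a q x‖ = 1 := e_norm _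

lemma bd_norm_le (g : ℤ[X]) (p x : ℕ) : ‖bd g p x‖ ≤ 1 := by unfold bd; split_ifs <;> simp
lemma gd_norm_le (g : ℤ[X]) (p x : ℕ) : ‖gd g p x‖ ≤ 1 := by unfold gd; split_ifs <;> simp

open scoped Classical in
lemma jCount_eq (g : ℤ[X]) (p : ℕ) : jCount g p =
    ((Finset.range (p ^ gammaExp g p)).filter (fun s : ℕ => bad g p s)).card := by
  unfold jCount
  symm
  refine Finset.card_bij (fun x _ => (x : ℤ)) ?_ ?_ ?_
  · intro x hx
    rw [Finset.mem_filter] at hx ⊢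
    refine ⟨?_, hx.2⟩
    simp only [Finset.bind_def, Finset.pure_def, Finset.mem_sup, Finset.mem_singleton]
    exact ⟨x, hx.1, rfl⟩
  · intro x _ y _ h; exact_mod_cast h
  · intro y hy
    rw [Finset.mem_filter] at hy
    simp only [Finset.bind_def, Finset.pure_def, Finset.mem_sup, Finset.mem_singleton] at hy
    obtain ⟨⟨x, hx, rfl⟩, h2⟩ := hy
    exact ⟨x, Finset.mem_filter.2 ⟨hx, h2⟩, rfl⟩

lemma avg_bd (g : ℤ[X]) (p : ℕ) : avg (p ^ gammaExp g p) (bd g p) = (jr g p : ℂ) := by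
  classical
  unfold avg bd jr
  rw [Finset.sum_boole, jCount_eq]
  push_cast
  congr

lemma avg_gd (g : ℤ[X]) (p : ℕ) (hp : 0 < p) : avg (p ^ gammaExp g p) (gd g p) = ((1 - jr g p : ℝ) : ℂ) := by
  rw [Complex.ofReal_sub, ← avg_bd, Complex.ofReal_one]
  unfold avg
  have : ((p ^ gammaExp g p : ℕ) : ℂ) ≠ 0 := by exact_mod_cast (pow_pos hp _).ne'
  rw [eq_sub_iff_add_eq, ← add_div, ← Finset.sum_add_distrib, div_eq_one_iff_eq this]
  simp [gd_eq]

variable {k D A : ℕ} {g : ℤ[X]}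

lemma jr_nonneg (g : ℤ[X]) (p : ℕ) : 0 ≤ jr g p := by unfold jr; positivity

lemma jCount_lt (hg : Good k D A g) {p : ℕ} (hp : p.Prime) : jCount g p + 1 ≤ p ^ gammaExp g p := by
  classical
  obtain ⟨h1, h2, h3⟩ := hg.gamma_spec hp
  push Not at h2
  obtain ⟨n, hn⟩ := h2
  have hQ : 0 < p ^ gammaExp g p := pow_pos hp.pos _
  have hQ' : (0 : ℤ) < (p : ℤ) ^ gammaExp g p := by exact_mod_cast hQ
  obtain ⟨x, hx⟩ : ∃ x : ℕ, (x : ℤ) = n % (p : ℤ) ^ gammaExp g p :=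
    ⟨(n % (p : ℤ) ^ gammaExp g p).toNat, Int.toNat_of_nonneg (Int.emod_nonneg _ hQ'.ne')⟩
  have hxlt : x < p ^ gammaExp g p := by
    have := Int.emod_lt_of_pos n hQ'
    rw [← hx] at this; exact_mod_cast this
  have hxb : ¬ bad g p x := by
    rw [bad_congr g p x n (by rw [hx]; exact (Int.ModEq.dvd (Int.mod_modEq _ _).symm))]
    exact hn
  rw [jCount_eq]
  have : ((Finset.range (p ^ gammaExp g p)).filter
    (fun s : ℕ => bad g p s)) ⊂ Finset.range (p ^ gammaExp g p) := by
    rw [Finset.filter_ssubset]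
    exact ⟨x, Finset.mem_range.2 hxlt, hxb⟩
  have := Finset.card_lt_card this
  rw [Finset.card_range] at this
  omega

lemma one_sub_jr_ge (hg : Good k D A g) {p : ℕ} (hp : p.Prime) :
    1 / (p : ℝ) ^ gammaExp g p ≤ 1 - jr g p := by
  have h := jCount_lt hg hp
  have hQ : (0 : ℝ) < (p : ℝ) ^ gammaExp g p := by exact_mod_cast pow_pos hp.pos _
  have h' : (jCount g p : ℝ) + 1 ≤ (p : ℝ) ^ gammaExp g p := by exact_mod_cast h
  unfold jr
  rw [div_le_iff₀ hQ, sub_mul, div_mul_cancel₀ _ hQ.ne']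
  linarith

lemma one_sub_jr_pos (hg : Good k D A g) {p : ℕ} (hp : p.Prime) : 0 < 1 - jr g p :=
  lt_of_lt_of_le (by have := hp.pos; positivity) (one_sub_jr_ge hg hp)

lemma der_map_ne (hg : Good k D A g) {p : ℕ} (hp : p.Prime) (h1 : gammaExp g p = 1) :
    (derivative g).map (Int.castRingHom (ZMod p)) ≠ 0 := by
  intro h0
  obtain ⟨-, h2, -⟩ := hg.gamma_spec hp
  apply h2
  intro n
  have : NeZero p := ⟨hp.ne_zero⟩
  rw [h1, pow_one, ← ZMod.intCast_zmod_eq_zero_iff_dvd _ p]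
  have := congrArg (eval (n : ZMod p)) h0
  rw [eval_zero] at this
  rw [← this, ← eq_intCast (Int.castRingHom (ZMod p)) n, eval_map_apply]
  simp

lemma jCount_le (hg : Good k D A g) {p : ℕ} (hp : p.Prime) (h1 : gammaExp g p = 1) : jCount g p ≤ k := by
  classical
  have : Fact p.Prime := ⟨hp⟩
  have hne := der_map_ne hg hp h1
  set F := (derivative g).map (Int.castRingHom (ZMod p)) with hF
  have hdeg : F.natDegree ≤ k := by
    refine natDegree_map_le.trans ((natDegree_derivative_le _).trans ?_)
    rw [hg.deg]; omega
  refine le_trans ?_ ((card_roots' F).trans hdeg)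
  refine le_trans ?_ (Multiset.toFinset_card_le _)
  rw [jCount_eq]
  refine Finset.card_le_card_of_injOn (fun x : ℕ => (x : ZMod p)) ?_ ?_
  · intro x hx
    rw [Finset.mem_coe, Finset.mem_filter, bad, h1, pow_one, pow_one] at hx
    rw [Finset.mem_coe, Multiset.mem_toFinset, mem_roots hne, IsRoot, hF]
    have h3 := (ZMod.intCast_zmod_eq_zero_iff_dvd _ p).2 hx.2
    rw [← h3]
    have := eval_map_apply (p := derivative g) (Int.castRingHom (ZMod p)) (x : ℤ)
    simp
  · intro x hx y hy hxy
    rw [Finset.mem_coe, Finset.mem_filter, h1, pow_one, Finset.mem_range] at hx hy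
    have := (ZMod.natCast_eq_natCast_iff x y p).1 hxy
    exact Nat.ModEq.eq_of_lt_of_lt this hx.1 hy.1

end Loc


set_option linter.unusedSectionVars false
set_option linter.unusedSimpArgs false

namespace Loc
open Polynomial Avg Cont
variable {k D A : ℕ} {g : ℤ[X]}

lemma eval_shift (g : ℤ[X]) (x y : ℤ) : y ^ 2 ∣ g.eval (x + y) - g.eval x - y * (derivative g).eval x := by
  obtain ⟨c, hc⟩ := binomExpansion g x y
  exact ⟨c, by linear_combination hc⟩

/-- the case `v ≥ 2γ`: the sum vanishes -/
lemma local_zero {p : ℕ} (hp : p.Prime) (v : ℕ) (hv : 2 * gammaExp g p ≤ v)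
    (a : ℤ) (ha : ¬ (p : ℤ) ∣ a) :
    avg (p ^ v) (fun x => gd g p x * ph g a (p ^ v) x) = 0 := by
  set γ := gammaExp g p with hγ
  set F : ℕ → ℂ := fun x => gd g p x * ph g a (p ^ v) x with hF
  have hpv : 0 < p ^ v := pow_pos hp.pos _
  have hpg : 0 < p ^ γ := pow_pos hp.pos _
  have hFper : Function.Periodic F (p ^ v) := by
    have h1 : Function.Periodic (gd g p) (p ^ v) := per_dvd (gd_per g p) (pow_dvd_pow _ (by omega))
    exact h1.mul (ph_per g a _ hpv)
  have hshift : ∀ t : ℕ, ∑ x ∈ Finset.range (p ^ v), F (x + t) = ∑ x ∈ Finset.range (p ^ v), F x := by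
    intro t
    induction t with
    | zero => simp
    | succ t ih =>
      have h1 := Finset.sum_range_succ' (fun x => F (x + t)) (p ^ v)
      rw [Finset.sum_range_succ] at h1
      have h2 : F (p ^ v + t) = F (0 + t) := by rw [add_comm, hFper, zero_add]
      rw [h2] at h1
      rw [← ih, add_right_cancel h1]
      exact Finset.sum_congr rfl fun x _ => by congr 1; ring
  have hFt : ∀ x t : ℕ, F (x + p ^ (v - γ) * t) =
      F x * e ((a * (derivative g).eval (x : ℤ) * (t : ℤ) : ℤ) / ((p ^ γ : ℕ) : ℝ)) := by
    intro x t
    have h1 : gd g p (x + p ^ (v - γ) * t) = gd g p x := by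
      have := per_dvd (gd_per g p) (R := p ^ (v - γ) * t) ((pow_dvd_pow p (by omega)).mul_right t)
      exact this x
    simp only [hF, h1, mul_assoc]
    congr 1
    unfold ph
    have h2 : ((p ^ v : ℕ) : ℤ) ∣ a * g.eval ((x + p ^ (v - γ) * t : ℕ) : ℤ) -
        (a * g.eval (x : ℤ) + p ^ (v - γ) * (a * ((derivative g).eval (x : ℤ) * t))) := by
      have h3 := eval_shift g x (((p ^ (v - γ) * t : ℕ)) : ℤ)
      have h4 : ((p ^ v : ℕ) : ℤ) ∣ (((p ^ (v - γ) * t : ℕ)) : ℤ) ^ 2 := by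
        push_cast
        rw [mul_pow, ← pow_mul]
        exact Dvd.dvd.mul_right (pow_dvd_pow _ (by omega)) _
      obtain ⟨c, hc⟩ := (h4.trans h3).mul_left a
      refine ⟨c, ?_⟩
      push_cast at hc ⊢
      linear_combination hc
    rw [e_congr (p ^ v) hpv _ _ h2, Int.cast_add, add_div, e_add]
    congr 2
    have hp0 : (p : ℝ) ≠ 0 := by exact_mod_cast hp.ne_zero
    have : (p : ℝ) ^ v = p ^ (v - γ) * p ^ γ := by rw [← pow_add]; congr 1; omega
    push_cast
    rw [this]
    field_simp
  have h1 : ((p ^ γ : ℕ) : ℂ) * ∑ x ∈ Finset.range (p ^ v), F x = 0 := by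
    have : ((p ^ γ : ℕ) : ℂ) * ∑ x ∈ Finset.range (p ^ v), F x =
        ∑ t ∈ Finset.range (p ^ γ), ∑ x ∈ Finset.range (p ^ v), F (x + p ^ (v - γ) * t) := by
      simp only [hshift]; simp
    rw [this, Finset.sum_comm]
    refine Finset.sum_eq_zero fun x _ => ?_
    simp only [hFt]
    rw [← Finset.mul_sum]
    by_cases hb : bad g p x
    · simp [hF, gd, hb]
    · rw [e_geom (p ^ γ) hpg _ ?_, mul_zero]
      intro h
      apply hb
      have hc : IsCoprime ((p ^ γ : ℕ) : ℤ) a := by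
        push_cast
        exact IsCoprime.pow_left ((Nat.prime_iff_prime_int.1 hp).coprime_iff_not_dvd.2 ha)
      have := hc.dvd_of_dvd_mul_left h
      unfold bad
      push_cast at this
      exact this
  unfold avg
  have h2 : ((p ^ γ : ℕ) : ℂ) ≠ 0 := by exact_mod_cast hpg.ne'
  rw [(mul_eq_zero.1 h1).resolve_left h2, zero_div]

lemma local_triv {p : ℕ} (hp : p.Prime) (Q q : ℕ) (hQ : p ^ gammaExp g p ∣ Q) (hQ0 : 0 < Q) (a : ℤ) :
    ‖avg Q (fun x => gd g p x * ph g a q x)‖ ≤ 1 - jr g p := by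
  classical
  have h1 := norm_avg_le_avg (F := fun x => gd g p x * ph g a q x)
    (G := fun x => if bad g p x then (0 : ℝ) else 1) (Q := Q) (by
      intro x
      rw [norm_mul, ph_norm, mul_one]
      unfold gd; split_ifs <;> simp)
  refine h1.trans (le_of_eq ?_)
  have h2 := avg_gd g p hp.pos
  rw [← avg_dvd (gd_per g p) hQ hQ0] at h2
  unfold avg gd at h2
  apply Complex.ofReal_injective
  rw [← h2]
  rw [Complex.ofReal_div, Complex.ofReal_natCast, Complex.ofReal_sum]
  refine congrArg (fun t : ℂ => t / (Q : ℂ)) (Finset.sum_congr rfl fun x _ => ?_)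
  split_ifs <;> simp

lemma local_weil (hg : Good k D A g) {p : ℕ} (hp : p.Prime) (h1 : gammaExp g p = 1)
    (hpk : 2 * k ≤ p) (hk : 0 < k) (a : ℤ) (ha : ¬ (p : ℤ) ∣ a) :
    ‖avg p (fun x => gd g p x * ph g a p x)‖ ≤ (1 - jr g p) * (4 * k / √p) := by
  classical
  have : Fact p.Prime := ⟨hp⟩
  have hppos : (0 : ℝ) < p := by exact_mod_cast hp.pos
  set f : (ZMod p)[X] := (C a * g).map (Int.castRingHom (ZMod p)) with hf
  have hfd : f.natDegree ≤ k := by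
    refine natDegree_map_le.trans ((natDegree_C_mul_le _ _).trans hg.deg.le)
  have ha0 : ((a : ℤ) : ZMod p) ≠ 0 := by
    rw [Ne, ZMod.intCast_zmod_eq_zero_iff_dvd]; exact ha
  have hfpos : 0 < f.natDegree := by
    by_contra h0
    have h2 : f.natDegree = 0 := by omega
    have h3 : derivative f = 0 := derivative_of_natDegree_zero h2
    rw [hf, derivative_map, derivative_C_mul, Polynomial.map_mul, map_C] at h3
    rcases mul_eq_zero.1 h3 with h4 | h4
    · rw [C_eq_zero] at h4; exact ha0 h4
    · exact der_map_ne hg hp h1 h4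
  have hnd : ¬ p ∣ f.natDegree := fun h => by
    have := Nat.le_of_dvd hfpos h; omega
  have hψ : (ZMod.stdAddChar (N := p)) ≠ 1 := by
    intro h
    have h2 := ZMod.isPrimitive_stdAddChar p
    have h3 := h2 one_ne_zero
    apply h3
    rw [h]; ext; simp [AddChar.mulShift_apply]
  have hw := Weil.weil p f hfpos hnd ZMod.stdAddChar hψ
  have hsum : ∑ x : ZMod p, ZMod.stdAddChar (f.eval x) = ∑ x ∈ Finset.range p, ph g a p x := by
    symm
    refine Finset.sum_bij (fun x _ => (x : ZMod p)) (fun _ _ => Finset.mem_univ _) ?_ ?_ ?_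
    · intro x hx y hy hxy
      rw [Finset.mem_range] at hx hy
      have := (ZMod.natCast_eq_natCast_iff x y p).1 hxy
      exact Nat.ModEq.eq_of_lt_of_lt this hx hy
    · intro y _
      exact ⟨y.val, Finset.mem_range.2 (ZMod.val_lt y), ZMod.natCast_zmod_val y⟩
    · intro x _
      have h2 : f.eval (x : ZMod p) = ((a * g.eval (x : ℤ) : ℤ) : ZMod p) := by
        have := eval_map_apply (p := C a * g) (Int.castRingHom (ZMod p)) (x : ℤ)
        rw [← hf] at this
        simpa using this
      rw [h2, ZMod.stdAddChar_coe]
      unfold ph e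
      congr 1
      push_cast
      ring
  have hj := jCount_le hg hp h1
  have hjs : ‖∑ x ∈ Finset.range p, bd g p x * ph g a p x‖ ≤ jCount g p := by
    refine (norm_sum_le _ _).trans ?_
    have : ∀ x ∈ Finset.range p, ‖bd g p x * ph g a p x‖ = if bad g p x then (1 : ℝ) else 0 := by
      intro x _
      rw [norm_mul, ph_norm, mul_one]; unfold bd; split_ifs <;> simp
    rw [Finset.sum_congr rfl this, Finset.sum_boole, jCount_eq, h1, pow_one]
  have hk' : (jCount g p : ℝ) ≤ k := by exact_mod_cast hj
  have hsq : √(p : ℝ) * √(p : ℝ) = p := Real.mul_self_sqrt hppos.le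
  have hsq1 : 1 ≤ √(p : ℝ) := by
    rw [Real.one_le_sqrt]; exact_mod_cast hp.one_le
  have htot : ‖∑ x ∈ Finset.range p, gd g p x * ph g a p x‖ ≤ 2 * k * √p := by
    have : ∑ x ∈ Finset.range p, gd g p x * ph g a p x =
        ∑ x ∈ Finset.range p, ph g a p x - ∑ x ∈ Finset.range p, bd g p x * ph g a p x := by
      rw [← Finset.sum_sub_distrib]
      exact Finset.sum_congr rfl fun x _ => by rw [gd_eq]; ring
    rw [this]
    refine (norm_sub_le _ _).trans ?_
    rw [← hsum]
    have h3 : (f.natDegree : ℝ) * √p ≤ k * √p := by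
      have : (f.natDegree : ℝ) ≤ k := by exact_mod_cast hfd
      gcongr
    have h4 : (k : ℝ) ≤ k * √p := le_mul_of_one_le_right (Nat.cast_nonneg _) hsq1
    linarith
  have hhalf : 1 / 2 ≤ 1 - jr g p := by
    unfold jr
    rw [h1, pow_one]
    have : (jCount g p : ℝ) / p ≤ 1 / 2 := by
      rw [div_le_iff₀ hppos]
      have : (2 : ℝ) * k ≤ p := by exact_mod_cast hpk
      linarith
    linarith
  unfold avg
  rw [norm_div, Complex.norm_natCast]
  calc _ ≤ 2 * k * √p / p := by gcongr
    _ = 1 / 2 * (4 * k / √p) := by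
        have : √(p : ℝ) ≠ 0 := by positivity
        rw [div_eq_iff hppos.ne']
        field_simp
        nlinarith
    _ ≤ _ := by gcongr

/-- the uniform local constant -/
def C1 (k D : ℕ) : ℕ := D ^ 2 + 4 * k

lemma local_bound (hg : Good k D A g) (hD : 0 < D) (hk : 0 < k) {p : ℕ} (hp : p.Prime) (v : ℕ)
    (hv : 0 < v) (a : ℤ) (ha : ¬ (p : ℤ) ∣ a) :
    ‖avg (p ^ (gammaExp g p + v)) (fun x => gd g p x * ph g a (p ^ v) x)‖ ≤
      (1 - jr g p) * (C1 k D / √((p ^ v : ℕ) : ℝ)) := by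
  set γ := gammaExp g p with hγ
  have hpos := one_sub_jr_pos hg hp
  have hγpos := (hg.gamma_spec hp).1
  have hpr : (0 : ℝ) < p := by exact_mod_cast hp.pos
  have hp1 : (1 : ℝ) ≤ p := by exact_mod_cast hp.one_le
  have hpv : 0 < p ^ v := pow_pos hp.pos _
  have hpvr : (0 : ℝ) < ((p ^ v : ℕ) : ℝ) := by exact_mod_cast hpv
  by_cases h1 : 2 * γ ≤ v
  · have hper : Function.Periodic (fun x => gd g p x * ph g a (p ^ v) x) (p ^ v) :=
      (per_dvd (gd_per g p) (pow_dvd_pow _ (by omega))).mul (ph_per g a _ hpv)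
    rw [avg_dvd hper (pow_dvd_pow p (by omega)) (pow_pos hp.pos _), local_zero hp v h1 a ha, norm_zero]
    positivity
  push Not at h1
  by_cases h2 : γ = 1 ∧ 2 * k ≤ p
  · obtain ⟨h3, h4⟩ := h2
    have hv1 : v = 1 := by omega
    subst hv1
    rw [pow_one]
    have hper : Function.Periodic (fun x => gd g p x * ph g a p x) p := by
      have := gd_per g p
      rw [← hγ, h3, pow_one] at this
      exact this.mul (ph_per g a _ hp.pos)
    rw [avg_dvd hper (dvd_pow_self p (by omega)) (pow_pos hp.pos _)]
    refine (local_weil hg hp h3 h4 hk a ha).trans ?_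
    refine mul_le_mul_of_nonneg_left ?_ hpos.le
    refine div_le_div_of_nonneg_right ?_ (Real.sqrt_nonneg _)
    unfold C1
    push_cast
    have : (0 : ℝ) ≤ (D : ℝ) ^ 2 := by positivity
    linarith
  · refine (local_triv hp _ _ (pow_dvd_pow p (by omega)) (pow_pos hp.pos _) a).trans ?_
    refine le_mul_of_one_le_right hpos.le ?_
    rw [one_le_div (Real.sqrt_pos.2 hpvr)]
    have h3 : √((p ^ v : ℕ) : ℝ) ≤ (p : ℝ) ^ γ := by
      rw [Real.sqrt_le_left (by positivity), ← pow_mul]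
      push_cast
      exact pow_le_pow_right₀ hp1 (by omega)
    refine h3.trans ?_
    have h4 : p ^ γ ≤ C1 k D := by
      unfold C1
      rcases hg.gamma_le hD hp with h5 | h5
      · rw [← hγ] at h5
        have : ¬ 2 * k ≤ p := fun h => h2 ⟨h5, h⟩
        rw [h5, pow_one]; omega
      · rw [← hγ] at h5; omega
    exact_mod_cast h4

end Loc


set_option linter.unusedSectionVars false
set_option linter.unusedSimpArgs false

namespace Loc
open Polynomial Avg Cont
variable {k D A : ℕ} {g : ℤ[X]}

lemma local_bound' (hg : Good k D A g) (hD : 0 < D) (hk : 0 < k) {p : ℕ} (hp : p.Prime) (v : ℕ)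
    (a : ℤ) (ha : 0 < v → ¬ (p : ℤ) ∣ a) :
    ‖avg (p ^ (gammaExp g p + v)) (fun x => gd g p x * ph g a (p ^ v) x)‖ ≤
      (1 - jr g p) * ((C1 k D : ℝ) ^ (p ^ v).primeFactors.card / √((p ^ v : ℕ) : ℝ)) := by
  rcases Nat.eq_zero_or_pos v with rfl | hv
  · have h1 : ∀ x, gd g p x * ph g a (p ^ 0) x = gd g p x := by
      intro x
      have : ph g a (p ^ 0) x = 1 := by
        unfold ph; rw [pow_zero, Nat.cast_one, div_one, e_int]
      rw [this, mul_one]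
    rw [avg_congr h1, add_zero, avg_gd g p hp.pos, Complex.norm_real, Real.norm_of_nonneg (one_sub_jr_pos hg hp).le]
    simp
  · have := local_bound hg hD hk hp v hv a (ha hv)
    rwa [Nat.primeFactors_prime_pow hv.ne' hp, Finset.card_singleton, pow_one]

/-- product modulus -/
noncomputable def QP (g : ℤ[X]) (P : Finset ℕ) : ℕ := ∏ p ∈ P, p ^ gammaExp g p

lemma QP_pos (P : Finset ℕ) (hP : ∀ p ∈ P, p.Prime) : 0 < QP g P :=
  Finset.prod_pos fun p hp => pow_pos (hP p hp).pos _

lemma QP_coprime {p : ℕ} (hp : p.Prime) (P : Finset ℕ) (hP : ∀ p ∈ P, p.Prime) (hpP : p ∉ P) :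
    Nat.Coprime p (QP g P) := by
  refine Nat.Coprime.prod_right fun l hl => Nat.Coprime.pow_right _ ?_
  exact (Nat.coprime_primes hp (hP l hl)).2 fun h => hpP (h ▸ hl)

lemma per_prod (f : ℕ → ℕ → ℂ) (hf : ∀ p, Function.Periodic (f p) (p ^ gammaExp g p)) (P : Finset ℕ) :
    Function.Periodic (fun x => ∏ p ∈ P, f p x) (QP g P) := by
  intro x
  exact Finset.prod_congr rfl fun p hp => per_dvd (hf p) (Finset.dvd_prod_of_mem (fun p => p ^ gammaExp g p) hp) x

lemma ph_split (g : ℤ[X]) (a1 a2 : ℤ) (q1 q2 : ℕ) (h1 : 0 < q1) (h2 : 0 < q2) (x : ℕ) :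
    ph g (a1 * q2 + a2 * q1) (q1 * q2) x = ph g a1 q1 x * ph g a2 q2 x := by
  unfold ph
  rw [← e_add]
  congr 1
  have : (q1 : ℝ) ≠ 0 := by positivity
  have : (q2 : ℝ) ≠ 0 := by positivity
  push_cast
  field_simp
  try ring

lemma crt_bound (hg : Good k D A g) (hD : 0 < D) (hk : 0 < k) (P : Finset ℕ) :
    (∀ p ∈ P, p.Prime) → ∀ q : ℕ, 0 < q → (∀ p : ℕ, p.Prime → p ∣ q → p ∈ P) →
    ∀ a : ℤ, IsCoprime a (q : ℤ) →
    ‖avg (q * QP g P) (fun x => (∏ p ∈ P, gd g p x) * ph g a q x)‖ ≤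
      (∏ p ∈ P, (1 - jr g p)) * ((C1 k D : ℝ) ^ q.primeFactors.card / √(q : ℝ)) := by
  classical
  induction P using Finset.induction_on with
  | empty =>
    intro _ q hq hqP a _
    have : q = 1 := by
      by_contra h
      obtain ⟨p, hp, hpq⟩ := Nat.exists_prime_and_dvd h
      exact absurd (hqP p hp hpq) (Finset.notMem_empty _)
    subst this
    refine (norm_avg_le (B := 1) (by simp [QP]) ?_).trans (by simp)
    intro x; simp [ph_norm]
  | insert p P hpP ih =>
    intro hP q hq hqP a ha
    have hp := hP p (Finset.mem_insert_self _ _)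
    have hP' : ∀ l ∈ P, l.Prime := fun l hl => hP l (Finset.mem_insert_of_mem hl)
    obtain ⟨v, q', hpq', hqq⟩ := Nat.exists_eq_pow_mul_and_not_dvd hq.ne' p hp.ne_one
    have hpv : 0 < p ^ v := pow_pos hp.pos _
    have hq' : 0 < q' := Nat.pos_of_ne_zero (by rintro rfl; simp at hpq')
    have hcop : Nat.Coprime (p ^ v) q' := Nat.Coprime.pow_left _ ((Nat.Prime.coprime_iff_not_dvd hp).2 hpq')
    have hcopZ : IsCoprime ((p ^ v : ℕ) : ℤ) (q' : ℤ) := Nat.isCoprime_iff_coprime.2 hcop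
    obtain ⟨u, w, huw⟩ := hcopZ
    have haq : a = (a * w) * (q' : ℤ) + (a * u) * ((p ^ v : ℕ) : ℤ) := by linear_combination -a * huw
    set a1 := a * w with ha1
    set a2 := a * u with ha2
    have hap : IsCoprime a ((p ^ v : ℕ) : ℤ) := by
      rw [hqq] at ha; push_cast at ha ⊢; exact ha.of_mul_right_left
    have haq' : IsCoprime a (q' : ℤ) := by
      rw [hqq] at ha; push_cast at ha; exact ha.of_mul_right_right
    have hc1 : 0 < v → ¬ (p : ℤ) ∣ a1 := by
      intro hv hd
      have h1 : (p : ℤ) ∣ ((p ^ v : ℕ) : ℤ) := by push_cast; exact dvd_pow_self _ hv.ne'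
      have h2 : (p : ℤ) ∣ a := by
        rw [haq]; exact dvd_add (hd.mul_right _) (h1.mul_left _)
      have := hap.isUnit_of_dvd' h2 h1
      exact (Nat.prime_iff_prime_int.1 hp).not_isUnit this
    have hc2 : IsCoprime a2 (q' : ℤ) := by
      rw [haq] at haq'
      have h1 : IsCoprime (a2 * ((p ^ v : ℕ) : ℤ)) (q' : ℤ) := by
        rw [add_comm] at haq'
        exact IsCoprime.of_add_mul_right_left haq'
      exact h1.of_mul_left_left
    have hQp := QP_pos (g := g) P hP'
    have hper1 : Function.Periodic (fun x => gd g p x * ph g a1 (p ^ v) x) (p ^ (gammaExp g p + v)) :=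
      (per_dvd (gd_per g p) (pow_dvd_pow _ (by omega))).mul (per_dvd (ph_per g a1 _ hpv) (pow_dvd_pow _ (by omega)))
    have hper2 : Function.Periodic (fun x => (∏ l ∈ P, gd g l x) * ph g a2 q' x) (q' * QP g P) :=
      (per_dvd (per_prod _ (gd_per g) P) (dvd_mul_left _ _)).mul (per_dvd (ph_per g a2 _ hq') (dvd_mul_right _ _))
    have hcc : Nat.Coprime (p ^ (gammaExp g p + v)) (q' * QP g P) :=
      Nat.Coprime.pow_left _ (Nat.Coprime.mul_right ((Nat.Prime.coprime_iff_not_dvd hp).2 hpq') (QP_coprime hp P hP' hpP))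
    have hmain := avg_coprime hper1 hper2 (pow_pos hp.pos _) (Nat.mul_pos hq' hQp) hcc
    have hmod : q * QP g (insert p P) = p ^ (gammaExp g p + v) * (q' * QP g P) := by
      unfold QP; rw [Finset.prod_insert hpP, pow_add, hqq]; ring
    have hfun : ∀ x, (∏ l ∈ insert p P, gd g l x) * ph g a q x =
        (gd g p x * ph g a1 (p ^ v) x) * ((∏ l ∈ P, gd g l x) * ph g a2 q' x) := by
      intro x
      rw [Finset.prod_insert hpP]
      have : ph g a q x = ph g a1 (p ^ v) x * ph g a2 q' x := by
        rw [← ph_split g a1 a2 _ _ hpv hq', ← haq, ← hqq]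
      rw [this]; ring
    rw [avg_congr hfun, hmod, hmain, norm_mul]
    have hb1 := local_bound' hg hD hk hp v a1 hc1
    have hb2 := ih hP' q' hq' (by
      intro l hl hlq
      have := hqP l hl (hqq ▸ hlq.mul_left _)
      rcases Finset.mem_insert.1 this with rfl | h
      · exact absurd hlq hpq'
      · exact h) a2 hc2
    refine (mul_le_mul hb1 hb2 (norm_nonneg _) ((norm_nonneg _).trans hb1)).trans (le_of_eq ?_)
    have hcard : q.primeFactors.card = (p ^ v).primeFactors.card + q'.primeFactors.card := by
      rw [hqq, hcop.primeFactors_mul, Finset.card_union_of_disjoint hcop.disjoint_primeFactors]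
    rw [Finset.prod_insert hpP, hcard, hqq, Nat.cast_mul, Real.sqrt_mul (Nat.cast_nonneg _), pow_add]
    ring

lemma avg_bd_prod (P : Finset ℕ) (hP : ∀ p ∈ P, p.Prime) :
    avg (QP g P) (fun x => ∏ p ∈ P, bd g p x) = ∏ p ∈ P, (jr g p : ℂ) := by
  classical
  induction P using Finset.induction_on with
  | empty => simp [QP, avg]
  | insert p P hpP ih =>
    have hp := hP p (Finset.mem_insert_self _ _)
    have hP' : ∀ l ∈ P, l.Prime := fun l hl => hP l (Finset.mem_insert_of_mem hl)
    have h1 := avg_coprime (bd_per g p) (per_prod _ (bd_per g) P) (pow_pos hp.pos _) (QP_pos P hP')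
      (Nat.Coprime.pow_left _ (QP_coprime hp P hP' hpP))
    simp only [Finset.prod_insert hpP]
    rw [show QP g (insert p P) = p ^ gammaExp g p * QP g P by unfold QP; rw [Finset.prod_insert hpP],
      h1, avg_bd, ih hP']

/-! elementary symmetric sums -/

noncomputable def es {R : Type*} [CommSemiring R] (b : ℕ → R) (j : ℕ) (P : Finset ℕ) : R :=
  ∑ S ∈ P.powersetCard j, ∏ p ∈ S, b p

lemma es_zero {R : Type*} [CommSemiring R] (b : ℕ → R) (P : Finset ℕ) : es b 0 P = 1 := by
  simp [es]

lemma es_insert {R : Type*} [CommSemiring R] (b : ℕ → R) (j : ℕ) (P : Finset ℕ) (p : ℕ) (hp : p ∉ P) :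
    es b (j + 1) (insert p P) = es b (j + 1) P + b p * es b j P := by
  classical
  unfold es
  rw [Finset.powersetCard_succ_insert hp, Finset.sum_union, Finset.sum_image, Finset.mul_sum]
  · congr 1
    refine Finset.sum_congr rfl fun S hS => ?_
    rw [Finset.prod_insert fun h => hp ((Finset.mem_powersetCard.1 hS).1 h)]
  · intro S hS T hT h
    have h1 : p ∉ S := fun h => hp ((Finset.mem_powersetCard.1 hS).1 h)
    have h2 : p ∉ T := fun h => hp ((Finset.mem_powersetCard.1 hT).1 h)
    rw [← Finset.erase_insert h1, ← Finset.erase_insert h2]; exact congrArg (fun S => S.erase p) h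
  · rw [Finset.disjoint_left]
    intro S hS hS'
    obtain ⟨T, hT, rfl⟩ := Finset.mem_image.1 hS'
    exact hp ((Finset.mem_powersetCard.1 hS).1 (Finset.mem_insert_self _ _))

lemma brun (b : ℕ → ℂ) (hb : ∀ p, ‖1 - b p‖ ≤ 1) (P : Finset ℕ) : ∀ r : ℕ,
    ‖∏ p ∈ P, (1 - b p) - ∑ j ∈ Finset.range (r + 1), (-1) ^ j * es b j P‖ ≤ es (fun p => ‖b p‖) (r + 1) P := by
  classical
  induction P using Finset.induction_on with
  | empty =>
    intro r
    rw [Finset.sum_eq_single 0]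
    · have : 0 ≤ es (fun p => ‖b p‖) (r + 1) ∅ :=
        Finset.sum_nonneg fun S _ => Finset.prod_nonneg fun p _ => norm_nonneg _
      simpa [es_zero] using this
    · intro j _ hj
      have : (∅ : Finset ℕ).powersetCard j = ∅ := by
        rw [Finset.powersetCard_eq_empty]; simp; omega
      simp [es, this]
    · simp
  | insert p P hp ih =>
    intro r
    have hprod : ‖∏ l ∈ P, (1 - b l)‖ ≤ 1 := by
      rw [norm_prod]; exact Finset.prod_le_one (fun _ _ => norm_nonneg _) fun l _ => hb l
    rw [Finset.prod_insert hp, es_insert _ _ _ _ hp]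
    cases r with
    | zero =>
      have h0 := ih 0
      simp only [zero_add, Finset.sum_range_one, pow_zero, es_zero, one_mul, mul_one] at h0 ⊢
      have : (1 - b p) * ∏ x ∈ P, (1 - b x) - 1 = (∏ x ∈ P, (1 - b x) - 1) - b p * ∏ x ∈ P, (1 - b x) := by ring
      rw [this]
      refine (norm_sub_le _ _).trans (add_le_add h0 ?_)
      rw [norm_mul]
      exact mul_le_of_le_one_right (norm_nonneg _) hprod
    | succ r =>
      have h1 := ih (r + 1)
      have h2 := ih r
      have h3 : ∑ j ∈ Finset.range (r + 1 + 1), (-1) ^ j * es b j (insert p P) =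
          ∑ j ∈ Finset.range (r + 1 + 1), (-1) ^ j * es b j P - b p * ∑ j ∈ Finset.range (r + 1), (-1) ^ j * es b j P := by
        rw [Finset.sum_range_succ', Finset.sum_range_succ' _ (r + 1), es_zero, es_zero, Finset.mul_sum, add_sub_right_comm,
          ← Finset.sum_sub_distrib]
        congr 1
        refine Finset.sum_congr rfl fun j _ => ?_
        rw [es_insert _ _ _ _ hp]; ring
      rw [h3]
      have : (1 - b p) * ∏ x ∈ P, (1 - b x) - (∑ j ∈ Finset.range (r + 1 + 1), (-1) ^ j * es b j P - b p * ∑ j ∈ Finset.range (r + 1), (-1) ^ j * es b j P) =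
        (∏ x ∈ P, (1 - b x) - ∑ j ∈ Finset.range (r + 1 + 1), (-1) ^ j * es b j P) - b p * (∏ x ∈ P, (1 - b x) - ∑ j ∈ Finset.range (r + 1), (-1) ^ j * es b j P) := by ring
      rw [this]
      refine (norm_sub_le _ _).trans (add_le_add h1 ?_)
      rw [norm_mul]
      exact mul_le_mul_of_nonneg_left h2 (norm_nonneg _)

lemma es_le (x : ℕ → ℝ) (hx : ∀ p, 0 ≤ x p) (u : ℝ) (hu : 0 ≤ u) (j : ℕ) (P : Finset ℕ) :
    u ^ j * es x j P ≤ Real.exp (u * ∑ p ∈ P, x p) := by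
  classical
  have h1 : ∏ p ∈ P, (1 + u * x p) = ∑ S ∈ P.powerset, ∏ p ∈ S, (u * x p) := Finset.prod_one_add P
  have h2 : u ^ j * es x j P = ∑ S ∈ P.powersetCard j, ∏ p ∈ S, (u * x p) := by
    unfold es
    rw [Finset.mul_sum]
    refine Finset.sum_congr rfl fun S hS => ?_
    rw [Finset.prod_mul_distrib, Finset.prod_const, (Finset.mem_powersetCard.1 hS).2]
  rw [h2]
  calc _ ≤ ∑ S ∈ P.powerset, ∏ p ∈ S, (u * x p) :=
        Finset.sum_le_sum_of_subset_of_nonneg (fun S hS => Finset.mem_powerset.2 (Finset.mem_powersetCard.1 hS).1)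
          fun S _ _ => Finset.prod_nonneg fun p _ => mul_nonneg hu (hx p)
    _ = ∏ p ∈ P, (1 + u * x p) := h1.symm
    _ ≤ ∏ p ∈ P, Real.exp (u * x p) := by
        refine Finset.prod_le_prod (fun p _ => by have := mul_nonneg hu (hx p); linarith) fun p _ => ?_
        have := Real.add_one_le_exp (u * x p); linarith
    _ = _ := by rw [← Real.exp_sum, Finset.mul_sum]

end Loc


set_option linter.unusedSectionVars false
set_option linter.unusedSimpArgs false

namespace Loc
open Polynomial Avg Cont
variable {k D A : ℕ} {g : ℤ[X]}

lemma bd_real (p x : ℕ) : bd g p x = ((‖bd g p x‖ : ℝ) : ℂ) := by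
  unfold bd; split_ifs <;> simp

lemma bd_sum_le (S : Finset ℕ) (hS : ∀ p ∈ S, p.Prime) (n : ℕ) :
    ∑ x ∈ Finset.range n, ∏ p ∈ S, ‖bd g p x‖ ≤ n * ∏ p ∈ S, jr g p + 2 * QP g S := by
  have h1 := sum_range_approx (per_prod _ (bd_per g) S) (QP_pos S hS) (fun x => by
    rw [norm_prod]; exact Finset.prod_le_one (fun _ _ => norm_nonneg _) fun l _ => bd_norm_le g l x) n
  rw [avg_bd_prod S hS] at h1
  have h2 : ∑ x ∈ Finset.range n, ∏ p ∈ S, bd g p x - n * ∏ p ∈ S, (jr g p : ℂ) =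
      ((∑ x ∈ Finset.range n, ∏ p ∈ S, ‖bd g p x‖ - n * ∏ p ∈ S, jr g p : ℝ) : ℂ) := by
    push_cast
    congr 1
    exact Finset.sum_congr rfl fun x _ => Finset.prod_congr rfl fun p _ => bd_real p x
  rw [h2, Complex.norm_real] at h1
  have := (le_abs_self _).trans h1
  linarith

lemma bd_sum_eq (S P : Finset ℕ) (hP : ∀ p ∈ P, p.Prime) (hSP : S ⊆ P) (q : ℕ) (hq : 0 < q) :
    ∑ x ∈ Finset.range (q * QP g P), ∏ p ∈ S, ‖bd g p x‖ = (q * QP g P : ℕ) * ∏ p ∈ S, jr g p := by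
  have hS : ∀ p ∈ S, p.Prime := fun p hp => hP p (hSP hp)
  have hpos := Nat.mul_pos hq (QP_pos (g := g) P hP)
  have h1 : avg (q * QP g P) (fun x => ∏ p ∈ S, bd g p x) = ∏ p ∈ S, (jr g p : ℂ) := by
    rw [← avg_bd_prod S hS]
    exact avg_dvd (per_prod _ (bd_per g) S) ((Finset.prod_dvd_prod_of_subset _ _ _ hSP).mul_left _) hpos
  have h0 : ((q * QP g P : ℕ) : ℂ) ≠ 0 := by exact_mod_cast hpos.ne'
  unfold avg at h1
  rw [div_eq_iff h0] at h1
  apply Complex.ofReal_injective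
  push_cast
  push_cast at h1
  rw [mul_comm ((q : ℂ) * _) _, ← h1]
  exact Finset.sum_congr rfl fun x _ => Finset.prod_congr rfl fun p _ => (bd_real p x).symm

lemma sieve (P : Finset ℕ) (hP : ∀ p ∈ P, p.Prime) (q : ℕ) (hq : 0 < q) (a : ℤ) (n r : ℕ) :
    ‖∑ x ∈ Finset.range n, (∏ p ∈ P, gd g p x) * ph g a q x -
      n * avg (q * QP g P) (fun x => (∏ p ∈ P, gd g p x) * ph g a q x)‖ ≤
    ∑ j ∈ Finset.range (r + 2), 2 * q * es (fun p => (p : ℝ) ^ gammaExp g p) j P +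
      2 * n * es (jr g) (r + 1) P := by
  classical
  have hpos := Nat.mul_pos hq (QP_pos (g := g) P hP)
  set Q := q * QP g P with hQ
  have hQr : (0 : ℝ) < Q := by exact_mod_cast hpos
  set F : ℕ → ℂ := fun x => (∏ p ∈ P, gd g p x) * ph g a q x with hF
  set G : Finset ℕ → ℕ → ℂ := fun S x => (∏ p ∈ S, bd g p x) * ph g a q x with hG
  set M : ℕ → ℂ := fun x => ∑ j ∈ Finset.range (r + 1), (-1) ^ j * ∑ S ∈ P.powersetCard j, G S x with hM
  set T : ℕ → ℝ := fun x => ∑ S ∈ P.powersetCard (r + 1), ∏ p ∈ S, ‖bd g p x‖ with hT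
  have hbr : ∀ x, ‖F x - M x‖ ≤ T x := by
    intro x
    have h1 := brun (fun p => bd g p x) (fun p => by rw [← gd_eq]; exact gd_norm_le g p x) P r
    have h2 : F x - M x = (∏ p ∈ P, (1 - bd g p x) - ∑ j ∈ Finset.range (r + 1), (-1) ^ j * es (fun p => bd g p x) j P) * ph g a q x := by
      simp only [hF, hM, hG, es]
      rw [sub_mul, Finset.sum_mul]
      congr 1
      · congr 1; exact Finset.prod_congr rfl fun p _ => gd_eq g p x
      · refine Finset.sum_congr rfl fun j _ => ?_
        rw [← Finset.sum_mul, mul_assoc]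
    rw [h2, norm_mul, ph_norm, mul_one]
    exact h1
  have hsub : ∀ j, ∀ S ∈ P.powersetCard j, S ⊆ P := fun j S hS => (Finset.mem_powersetCard.1 hS).1
  -- main terms
  have hGS : ∀ S, S ⊆ P → ‖∑ x ∈ Finset.range n, G S x - n * avg Q (G S)‖ ≤ 2 * q * ∏ p ∈ S, (p : ℝ) ^ gammaExp g p := by
    intro S hS
    have hS' : ∀ p ∈ S, p.Prime := fun p hp => hP p (hS hp)
    have hper : Function.Periodic (G S) (q * QP g S) :=
      (per_dvd (per_prod _ (bd_per g) S) (dvd_mul_left _ _)).mul (per_dvd (ph_per g a q hq) (dvd_mul_right _ _))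
    have h1 := sum_range_approx hper (Nat.mul_pos hq (QP_pos S hS')) (fun x => by
      rw [hG, norm_mul, ph_norm, mul_one, norm_prod]
      exact Finset.prod_le_one (fun _ _ => norm_nonneg _) fun l _ => bd_norm_le g l x) n
    have hdv : q * QP g S ∣ Q := mul_dvd_mul_left _ (Finset.prod_dvd_prod_of_subset _ _ _ hS)
    rw [avg_dvd hper hdv hpos]
    refine h1.trans (le_of_eq ?_)
    unfold QP; push_cast; ring
  have hMb : ‖∑ x ∈ Finset.range n, M x - n * avg Q M‖ ≤
      ∑ j ∈ Finset.range (r + 1), 2 * q * es (fun p => (p : ℝ) ^ gammaExp g p) j P := by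
    have h1 : ∑ x ∈ Finset.range n, M x - n * avg Q M = ∑ j ∈ Finset.range (r + 1), (-1) ^ j *
        ∑ S ∈ P.powersetCard j, (∑ x ∈ Finset.range n, G S x - n * avg Q (G S)) := by
      have h2 : ∀ m, ∑ x ∈ Finset.range m, M x = ∑ j ∈ Finset.range (r + 1), (-1) ^ j *
        ∑ S ∈ P.powersetCard j, ∑ x ∈ Finset.range m, G S x := by
        intro m
        simp only [hM]
        rw [Finset.sum_comm]
        refine Finset.sum_congr rfl fun j _ => ?_
        rw [← Finset.mul_sum, Finset.sum_comm]
      unfold avg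
      rw [h2, h2, Finset.sum_div, Finset.mul_sum, ← Finset.sum_sub_distrib]
      refine Finset.sum_congr rfl fun j _ => ?_
      rw [Finset.sum_sub_distrib, ← Finset.mul_sum, ← Finset.sum_div]
      ring
    rw [h1]
    refine (norm_sum_le _ _).trans (Finset.sum_le_sum fun j _ => ?_)
    rw [norm_mul, norm_pow, norm_neg, norm_one, one_pow, one_mul]
    refine (norm_sum_le _ _).trans ?_
    unfold es
    rw [Finset.mul_sum]
    exact Finset.sum_le_sum fun S hS => hGS S (hsub j S hS)
  have hT1 : ∑ x ∈ Finset.range n, T x ≤ n * es (jr g) (r + 1) P + 2 * es (fun p => (p : ℝ) ^ gammaExp g p) (r + 1) P := by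
    simp only [hT]
    rw [Finset.sum_comm]
    unfold es
    rw [Finset.mul_sum, Finset.mul_sum, ← Finset.sum_add_distrib]
    refine Finset.sum_le_sum fun S hS => ?_
    refine (bd_sum_le S (fun p hp => hP p (hsub _ S hS hp)) n).trans (le_of_eq ?_)
    unfold QP; push_cast; ring
  have hT2 : ∑ x ∈ Finset.range Q, T x = Q * es (jr g) (r + 1) P := by
    simp only [hT]
    rw [Finset.sum_comm]
    unfold es
    rw [Finset.mul_sum]
    exact Finset.sum_congr rfl fun S hS => bd_sum_eq S P hP (hsub _ S hS) q hq
  have hes0 : 0 ≤ es (fun p => (p : ℝ) ^ gammaExp g p) (r + 1) P :=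
    Finset.sum_nonneg fun S _ => Finset.prod_nonneg fun p _ => by positivity
  have hR1 : ‖∑ x ∈ Finset.range n, (F x - M x)‖ ≤ ∑ x ∈ Finset.range n, T x :=
    (norm_sum_le _ _).trans (Finset.sum_le_sum fun x _ => hbr x)
  have hR2 : ‖(n : ℂ) * avg Q (fun x => F x - M x)‖ ≤ n * es (jr g) (r + 1) P := by
    rw [norm_mul, Complex.norm_natCast]
    refine mul_le_mul_of_nonneg_left ?_ (Nat.cast_nonneg _)
    refine (norm_avg_le_avg hbr).trans (le_of_eq ?_)
    rw [hT2]; field_simp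
  have hdec : ∑ x ∈ Finset.range n, F x - n * avg Q F =
      (∑ x ∈ Finset.range n, M x - n * avg Q M) + (∑ x ∈ Finset.range n, (F x - M x) - n * avg Q (fun x => F x - M x)) := by
    unfold avg
    rw [Finset.sum_sub_distrib, Finset.sum_sub_distrib]
    ring
  rw [hdec]
  have hq1 : (1 : ℝ) ≤ q := by exact_mod_cast hq
  rw [Finset.sum_range_succ]
  have := norm_add_le (∑ x ∈ Finset.range n, M x - n * avg Q M) (∑ x ∈ Finset.range n, (F x - M x) - n * avg Q (fun x => F x - M x))
  have h4 := norm_sub_le (∑ x ∈ Finset.range n, (F x - M x)) (n * avg Q (fun x => F x - M x))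
  have h5 : 2 * es (fun p => (p : ℝ) ^ gammaExp g p) (r + 1) P ≤ 2 * q * es (fun p => (p : ℝ) ^ gammaExp g p) (r + 1) P := by
    nlinarith
  linarith

end Loc


set_option linter.unusedSectionVars false
set_option linter.unusedSimpArgs false

namespace Loc
open Polynomial Avg Cont
variable {k D A : ℕ} {g : ℤ[X]}

noncomputable def PY (Y : ℝ) : Finset ℕ := (Finset.range (⌊Y⌋₊ + 1)).filter Nat.Prime

lemma PY_prime {Y : ℝ} : ∀ p ∈ PY Y, p.Prime := fun _ hp => (Finset.mem_filter.1 hp).2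

lemma PY_mem {Y : ℝ} (hY : 0 ≤ Y) {p : ℕ} : p ∈ PY Y ↔ p.Prime ∧ (p : ℝ) ≤ Y := by
  unfold PY
  rw [Finset.mem_filter, Finset.mem_range, Nat.lt_succ_iff, Nat.le_floor_iff hY]
  tauto

lemma jr_le (hg : Good k D A g) (hD : 0 < D) {p : ℕ} (hp : p.Prime) : jr g p ≤ (D ^ 2 + k : ℕ) / (p : ℝ) := by
  have hpr : (0 : ℝ) < p := by exact_mod_cast hp.pos
  rcases hg.gamma_le hD hp with h | h
  · have := jCount_le hg hp h
    unfold jr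
    rw [h, pow_one]
    refine div_le_div_of_nonneg_right ?_ hpr.le
    exact_mod_cast this.trans (Nat.le_add_left _ _)
  · have h1 : jr g p ≤ 1 := by have := one_sub_jr_pos hg hp; linarith
    refine h1.trans ((one_le_div hpr).2 ?_)
    have h2 : p ≤ p ^ gammaExp g p := Nat.le_self_pow (hg.gamma_spec hp).1.ne' _
    exact_mod_cast (h2.trans h).trans (Nat.le_add_right _ _)

lemma sum_inv_le {Y : ℝ} (hY : 1 ≤ Y) : ∑ p ∈ PY Y, 1 / (p : ℝ) ≤ 1 + Real.log Y := by
  have h1 : ∑ p ∈ PY Y, 1 / (p : ℝ) ≤ ∑ i ∈ Finset.Icc 1 ⌊Y⌋₊, (i : ℝ)⁻¹ := by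
    simp only [one_div]
    refine Finset.sum_le_sum_of_subset_of_nonneg ?_ fun i _ _ => by positivity
    intro p hp
    have h2 := (PY_mem (by linarith)).1 hp
    rw [Finset.mem_Icc]
    exact ⟨h2.1.one_le, Nat.le_floor h2.2⟩
  refine h1.trans ?_
  have h3 := harmonic_floor_le_one_add_log Y hY
  rw [harmonic_eq_sum_Icc] at h3
  push_cast at h3
  exact h3

lemma pg_le (hg : Good k D A g) (hD : 0 < D) {Y : ℝ} (hY : 1 ≤ Y) {p : ℕ} (hp : p ∈ PY Y) :
    (p : ℝ) ^ gammaExp g p ≤ D ^ 2 * Y := by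
  obtain ⟨h1, h2⟩ := (PY_mem (by linarith)).1 hp
  have hD1 : (1 : ℝ) ≤ D ^ 2 := by exact_mod_cast Nat.one_le_pow _ _ hD
  rcases hg.gamma_le hD h1 with h | h
  · rw [h, pow_one]; nlinarith
  · have : (p : ℝ) ^ gammaExp g p ≤ D ^ 2 := by exact_mod_cast h
    nlinarith

lemma es_jr_le (hg : Good k D A g) (hD : 0 < D) {Y : ℝ} (hY : 1 ≤ Y) (j : ℕ) :
    es (jr g) j (PY Y) ≤ Real.exp (3 * (D ^ 2 + k : ℕ) * (1 + Real.log Y) - j) := by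
  have h1 := es_le (jr g) (jr_nonneg g) (Real.exp 1) (Real.exp_pos _).le j (PY Y)
  have h2 : ∑ p ∈ PY Y, jr g p ≤ (D ^ 2 + k : ℕ) * (1 + Real.log Y) := by
    calc _ ≤ ∑ p ∈ PY Y, (D ^ 2 + k : ℕ) * (1 / (p : ℝ)) := Finset.sum_le_sum fun p hp => by
            rw [mul_one_div]; exact jr_le hg hD (PY_prime p hp)
      _ ≤ _ := by rw [← Finset.mul_sum]; exact mul_le_mul_of_nonneg_left (sum_inv_le hY) (Nat.cast_nonneg _)
  have h0 : 0 ≤ ∑ p ∈ PY Y, jr g p := Finset.sum_nonneg fun p _ => jr_nonneg g p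
  have h3 : Real.exp 1 * ∑ p ∈ PY Y, jr g p ≤ 3 * (D ^ 2 + k : ℕ) * (1 + Real.log Y) := by
    have : Real.exp 1 ≤ 3 := Real.exp_one_lt_three.le
    nlinarith
  have h4 := h1.trans (Real.exp_le_exp.2 h3)
  rw [← Real.exp_nat_mul, mul_one] at h4
  rw [sub_eq_add_neg, Real.exp_add, Real.exp_neg, ← div_eq_mul_inv, le_div_iff₀ (Real.exp_pos _), mul_comm]
  exact h4

lemma es_pg_le (hg : Good k D A g) (hD : 0 < D) {Y : ℝ} (hY : 1 ≤ Y) (j : ℕ) :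
    es (fun p => (p : ℝ) ^ gammaExp g p) j (PY Y) ≤ 3 * (2 * D ^ 2 * Y ^ 2) ^ j := by
  have hD1 : (1 : ℝ) ≤ D ^ 2 := by exact_mod_cast Nat.one_le_pow _ _ hD
  set U : ℝ := 2 * D ^ 2 * Y ^ 2 with hU
  have hUpos : 0 < U := by positivity
  have h1 := es_le (fun p => (p : ℝ) ^ gammaExp g p) (fun p => by positivity) U⁻¹ (by positivity) j (PY Y)
  have hcard : ((PY Y).card : ℝ) ≤ 2 * Y := by
    have h2 : (PY Y).card ≤ ⌊Y⌋₊ + 1 := by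
      unfold PY; exact (Finset.card_filter_le _ _).trans (by simp)
    have h3 : (⌊Y⌋₊ : ℝ) ≤ Y := Nat.floor_le (by linarith)
    have h4 : ((PY Y).card : ℝ) ≤ ⌊Y⌋₊ + 1 := by exact_mod_cast h2
    linarith
  have h2 : ∑ p ∈ PY Y, (p : ℝ) ^ gammaExp g p ≤ U := by
    calc _ ≤ (PY Y).card • ((D : ℝ) ^ 2 * Y) := Finset.sum_le_card_nsmul _ _ _ fun p hp => pg_le hg hD hY hp
      _ ≤ (2 * Y) * (D ^ 2 * Y) := by rw [nsmul_eq_mul]; gcongr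
      _ = U := by rw [hU]; ring
  have h3 : U⁻¹ * ∑ p ∈ PY Y, (p : ℝ) ^ gammaExp g p ≤ 1 := by
    rw [inv_mul_le_iff₀ hUpos]; linarith
  have h4 : (U⁻¹) ^ j * es (fun p => (p : ℝ) ^ gammaExp g p) j (PY Y) ≤ 3 :=
    h1.trans ((Real.exp_le_exp.2 h3).trans Real.exp_one_lt_three.le)
  rw [inv_pow, inv_mul_le_iff₀ (by positivity)] at h4
  linarith

lemma sieve_bound (hg : Good k D A g) (hD : 0 < D) {Y : ℝ} (hY : 1 ≤ Y) (q : ℕ) (hq : 0 < q) (a : ℤ) (n r : ℕ) :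
    ‖∑ x ∈ Finset.range n, (∏ p ∈ PY Y, gd g p x) * ph g a q x -
      n * avg (q * QP g (PY Y)) (fun x => (∏ p ∈ PY Y, gd g p x) * ph g a q x)‖ ≤
    6 * q * (r + 2) * (2 * D ^ 2 * Y ^ 2) ^ (r + 1) +
      2 * n * Real.exp (3 * (D ^ 2 + k : ℕ) * (1 + Real.log Y) - (r + 1 : ℕ)) := by
  have hD1 : (1 : ℝ) ≤ D ^ 2 := by exact_mod_cast Nat.one_le_pow _ _ hD
  refine (sieve (PY Y) PY_prime q hq a n r).trans (add_le_add ?_ ?_)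
  · set U : ℝ := 2 * D ^ 2 * Y ^ 2 with hU
    have hU1 : 1 ≤ U := by
      have : 1 ≤ Y ^ 2 := one_le_pow₀ hY
      rw [hU]; nlinarith
    calc _ ≤ ∑ j ∈ Finset.range (r + 2), 2 * (q : ℝ) * (3 * U ^ (r + 1)) := by
          refine Finset.sum_le_sum fun j hj => ?_
          refine mul_le_mul_of_nonneg_left ((es_pg_le hg hD hY j).trans ?_) (by positivity)
          have : U ^ j ≤ U ^ (r + 1) := pow_le_pow_right₀ hU1 (by have := Finset.mem_range.1 hj; omega)
          rw [← hU]; linarith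
      _ = _ := by rw [Finset.sum_const, Finset.card_range, nsmul_eq_mul]; push_cast; ring
  · exact mul_le_mul_of_nonneg_left (es_jr_le hg hD hY _) (by positivity)

noncomputable def C3 (k D : ℕ) : ℝ := 2 * (D ^ 2 + k : ℕ) * (1 + Real.log (2 * (D ^ 2 + k : ℕ)))

lemma wprod_ge (hg : Good k D A g) (hD : 0 < D) {Y : ℝ} (hY : 1 ≤ Y) :
    Real.exp (-(C3 k D * (1 + Real.log Y))) ≤ ∏ p ∈ PY Y, (1 - jr g p) := by
  set C2 : ℝ := ((D ^ 2 + k : ℕ) : ℝ) with hC2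
  have hC21 : 1 ≤ C2 := by
    rw [hC2]; exact_mod_cast (Nat.one_le_pow _ _ hD).trans (Nat.le_add_right _ _)
  have hlog : 0 ≤ Real.log (2 * C2) := Real.log_nonneg (by linarith)
  have hC3 : C3 k D = 2 * C2 * (1 + Real.log (2 * C2)) := rfl
  have hC30 : 0 ≤ C3 k D := by rw [hC3]; positivity
  have key : ∀ p ∈ PY Y, Real.exp (-(C3 k D * (1 / p))) ≤ 1 - jr g p := by
    intro p hp
    have hpp := PY_prime p hp
    have hpr : (0 : ℝ) < p := by exact_mod_cast hpp.pos
    by_cases h : 2 * C2 ≤ p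
    · have h1 := jr_le hg hD hpp
      rw [← hC2] at h1
      set x := C2 / (p : ℝ) with hx
      have hx0 : 0 ≤ x := by positivity
      have hx1 : x ≤ 1 / 2 := by rw [hx, div_le_iff₀ hpr]; linarith
      have h2 : Real.exp (-(C3 k D * (1 / p))) ≤ Real.exp (-(2 * x)) := by
        apply Real.exp_le_exp.2
        have : 2 * x ≤ C3 k D * (1 / p) := by
          rw [hx, hC3, mul_one_div, ← mul_div_assoc]
          refine div_le_div_of_nonneg_right ?_ hpr.le
          nlinarith
        linarith
      refine h2.trans (le_trans ?_ (sub_le_sub_left h1 1))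
      rw [Real.exp_neg, inv_le_comm₀ (Real.exp_pos _) (by linarith)]
      have h3 := Real.add_one_le_exp (2 * x)
      refine le_trans ?_ h3
      rw [inv_le_iff_one_le_mul₀ (by linarith)]
      nlinarith
    · push Not at h
      refine le_trans ?_ (one_sub_jr_ge hg hpp)
      have h1 : (p : ℝ) ^ gammaExp g p ≤ 2 * C2 := by
        rcases hg.gamma_le hD hpp with h2 | h2
        · rw [h2, pow_one]; exact h.le
        · have h3 : (p : ℝ) ^ gammaExp g p ≤ C2 := by
            rw [hC2]; exact_mod_cast h2.trans (Nat.le_add_right _ _)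
          linarith
      refine le_trans ?_ (one_div_le_one_div_of_le (by positivity) h1)
      have he : 1 / (2 * C2) = Real.exp (-Real.log (2 * C2)) := by
        rw [Real.exp_neg, Real.exp_log (by linarith), one_div]
      rw [he]
      apply Real.exp_le_exp.2
      apply neg_le_neg
      rw [hC3, mul_one_div, le_div_iff₀ hpr]
      nlinarith
  calc Real.exp (-(C3 k D * (1 + Real.log Y))) ≤ Real.exp (∑ p ∈ PY Y, -(C3 k D * (1 / p))) := by
        apply Real.exp_le_exp.2
        rw [Finset.sum_neg_distrib, ← Finset.mul_sum]
        exact neg_le_neg (mul_le_mul_of_nonneg_left (sum_inv_le hY) hC30)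
    _ = ∏ p ∈ PY Y, Real.exp (-(C3 k D * (1 / p))) := Real.exp_sum _ _
    _ ≤ _ := Finset.prod_le_prod (fun _ _ => (Real.exp_pos _).le) key

end Loc


set_option linter.unusedSectionVars false
set_option linter.unusedSimpArgs false

namespace Ana
open Polynomial Avg Cont
variable {k D A : ℕ} {g : ℤ[X]}

lemma pow_diff (x y : ℝ) (hy : 0 ≤ y) (hxy : x = y + 1) (j : ℕ) :
    0 ≤ x ^ j - y ^ j ∧ x ^ j - y ^ j ≤ j * x ^ (j - 1) ∧ (j : ℝ) * y ^ (j - 1) ≤ x ^ j - y ^ j := by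
  have hx : 0 ≤ x := by linarith
  have hyx : y ≤ x := by linarith
  have h1 : x ^ j - y ^ j = ∑ i ∈ Finset.range j, x ^ i * y ^ (j - 1 - i) := by
    have := (Commute.all x y).geom_sum₂_mul j
    rw [← this]; rw [hxy]; ring
  rw [h1]
  refine ⟨Finset.sum_nonneg fun i _ => by positivity, ?_, ?_⟩
  · calc _ ≤ ∑ i ∈ Finset.range j, x ^ (j - 1) := Finset.sum_le_sum fun i hi => by
            have := Finset.mem_range.1 hi
            calc x ^ i * y ^ (j - 1 - i) ≤ x ^ i * x ^ (j - 1 - i) := by gcongr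
              _ = x ^ (j - 1) := by rw [← pow_add]; congr 1; omega
      _ = _ := by simp
  · calc (j : ℝ) * y ^ (j - 1) = ∑ i ∈ Finset.range j, y ^ (j - 1) := by simp
      _ ≤ _ := Finset.sum_le_sum fun i hi => by
            have := Finset.mem_range.1 hi
            calc y ^ (j - 1) = y ^ i * y ^ (j - 1 - i) := by rw [← pow_add]; congr 1; omega
              _ ≤ x ^ i * y ^ (j - 1 - i) := by gcongr

/-- real evaluation of `g` and `g'` -/
noncomputable def gv (g : ℤ[X]) (m : ℕ) : ℝ := ((g.eval (m : ℤ) : ℤ) : ℝ)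
noncomputable def dv (g : ℤ[X]) (m : ℕ) : ℝ := (((derivative g).eval (m : ℤ) : ℤ) : ℝ)

lemma gv_eq (hg : Good k D A g) (m : ℕ) :
    gv g m = ∑ i ∈ Finset.range (k + 1), (g.coeff i : ℝ) * (m : ℝ) ^ i := by
  unfold gv; rw [eval_eq_sum_range, hg.deg]; push_cast; rfl

lemma dv_eq (hg : Good k D A g) (m : ℕ) :
    dv g m = ∑ i ∈ Finset.range (k + 1), (g.coeff i : ℝ) * (i * (m : ℝ) ^ (i - 1)) := by
  unfold dv
  rw [derivative_eval, sum_over_range _ (by simp), hg.deg]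
  push_cast
  exact Finset.sum_congr rfl fun i _ => by ring

lemma coef_sum (hg : Good k D A g) (M N K : ℝ) (s : ℕ) (hM : 0 ≤ M) (hK : 0 ≤ K)
    (hN : (g.leadingCoeff : ℝ) * M ^ k ≤ N) (t : ℕ → ℝ)
    (ht : ∀ i ≤ k, |t i| * M ^ s ≤ K * M ^ k) :
    |∑ i ∈ Finset.range (k + 1), (g.coeff i : ℝ) * t i| * M ^ s ≤ (k + 1) * A * K * N := by
  have hb : (0 : ℝ) ≤ g.leadingCoeff := by exact_mod_cast hg.lead.le
  have hc : ∀ i, |(g.coeff i : ℝ)| ≤ A * g.leadingCoeff := fun i => by exact_mod_cast hg.coef i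
  calc _ ≤ (∑ i ∈ Finset.range (k + 1), |(g.coeff i : ℝ) * t i|) * M ^ s := by
        gcongr; exact Finset.abs_sum_le_sum_abs _ _
    _ = ∑ i ∈ Finset.range (k + 1), |(g.coeff i : ℝ)| * (|t i| * M ^ s) := by
        rw [Finset.sum_mul]; exact Finset.sum_congr rfl fun i _ => by rw [abs_mul]; ring
    _ ≤ ∑ i ∈ Finset.range (k + 1), (A * K * N) := by
        refine Finset.sum_le_sum fun i hi => ?_
        have hi' : i ≤ k := Nat.lt_succ_iff.1 (Finset.mem_range.1 hi)
        calc _ ≤ (A * g.leadingCoeff) * (K * M ^ k) :=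
              mul_le_mul (hc i) (ht i hi') (by positivity) (by positivity)
          _ = A * K * (g.leadingCoeff * M ^ k) := by ring
          _ ≤ _ := by gcongr
    _ = _ := by rw [Finset.sum_const, Finset.card_range, nsmul_eq_mul]; push_cast; ring

lemma pow_M {M : ℝ} (hM : 1 ≤ M) {i k s : ℕ} (hik : i ≤ k) (j : ℕ) (hj : j + s ≤ i) : M ^ j * M ^ s ≤ M ^ k := by
  rw [← pow_add]; exact pow_le_pow_right₀ hM (by omega)

noncomputable def K0 (k A : ℕ) : ℝ := (k + 1) * A * (k ^ 2 + 1)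

lemma dv_bound (hg : Good k D A g) (hk : 0 < k) (M N : ℝ) (hM : 1 ≤ M)
    (hN : (g.leadingCoeff : ℝ) * M ^ k ≤ N) (m : ℕ) (hm : (m : ℝ) ≤ M) : |dv g m| * M ≤ K0 k A * N := by
  rw [dv_eq hg]
  have := coef_sum hg M N (k ^ 2 + 1) 1 (by linarith) (by positivity) hN (fun i => i * (m : ℝ) ^ (i - 1)) (by
    intro i hi
    rcases Nat.eq_zero_or_pos i with rfl | hi0
    · simp; positivity
    rw [abs_of_nonneg (by positivity)]
    have hik : (i : ℝ) ≤ k ^ 2 + 1 := by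
      have h1 : (i : ℝ) ≤ k := by exact_mod_cast hi
      nlinarith [sq_nonneg ((k : ℝ) - 1)]
    calc (i : ℝ) * (m : ℝ) ^ (i - 1) * M ^ 1 ≤ i * M ^ (i - 1) * M ^ 1 := by gcongr
      _ = i * (M ^ (i - 1) * M ^ 1) := by ring
      _ ≤ (k ^ 2 + 1) * M ^ k := mul_le_mul hik (pow_M hM hi _ (by omega)) (by positivity) (by positivity))
  rw [pow_one] at this
  exact this

lemma ddv_aux {k : ℕ} (M : ℝ) (hM : 1 ≤ M) (m : ℕ) (hm : (m : ℝ) + 1 ≤ M) (i : ℕ) (hi : i ≤ k) :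
    (i : ℝ) * (((m : ℝ) + 1) ^ (i - 1) - (m : ℝ) ^ (i - 1)) * M ^ 2 ≤ (k ^ 2 + 1) * M ^ k := by
  have hi' : (i : ℝ) ≤ k := by exact_mod_cast hi
  by_cases h2 : i < 2
  · have : (((m : ℝ) + 1) ^ (i - 1) - (m : ℝ) ^ (i - 1)) = 0 := by
      rw [show i - 1 = 0 by omega]; simp
    rw [this]; simp; positivity
  obtain ⟨h3, h4, h5⟩ := pow_diff ((m : ℝ) + 1) m (by positivity) rfl (i - 1)
  have h6 : ((i - 1 : ℕ) : ℝ) ≤ k := by exact_mod_cast (Nat.sub_le _ _).trans hi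
  calc _ ≤ (i : ℝ) * ((i - 1 : ℕ) * M ^ (i - 1 - 1)) * M ^ 2 := by
        have : ((m : ℝ) + 1) ^ (i - 1 - 1) ≤ M ^ (i - 1 - 1) := by gcongr
        have h7 : (((m : ℝ) + 1) ^ (i - 1) - (m : ℝ) ^ (i - 1)) ≤ (i - 1 : ℕ) * M ^ (i - 1 - 1) :=
          h4.trans (by gcongr)
        gcongr
    _ = (i * (i - 1 : ℕ)) * (M ^ (i - 1 - 1) * M ^ 2) := by ring
    _ ≤ (k * k) * M ^ k := by
        gcongr
        exact pow_M hM hi _ (by omega)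
    _ ≤ _ := by gcongr; nlinarith

lemma ddv_bound (hg : Good k D A g) (M N : ℝ) (hM : 1 ≤ M)
    (hN : (g.leadingCoeff : ℝ) * M ^ k ≤ N) (m : ℕ) (hm : (m : ℝ) + 1 ≤ M) :
    |dv g (m + 1) - dv g m| * M ^ 2 ≤ K0 k A * N := by
  rw [dv_eq hg, dv_eq hg, ← Finset.sum_sub_distrib]
  have := coef_sum hg M N (k ^ 2 + 1) 2 (by linarith) (by positivity) hN
    (fun i => (i : ℝ) * (((m : ℝ) + 1) ^ (i - 1) - (m : ℝ) ^ (i - 1))) (by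
    intro i hi
    have h3 := (pow_diff ((m : ℝ) + 1) m (by positivity) rfl (i - 1)).1
    rw [abs_of_nonneg (by positivity)]
    exact ddv_aux M hM m hm i hi)
  refine le_trans (le_of_eq ?_) this
  congr 2
  exact Finset.sum_congr rfl fun i _ => by push_cast; ring

lemma gv_bound (hg : Good k D A g) (M N : ℝ) (hM : 1 ≤ M)
    (hN : (g.leadingCoeff : ℝ) * M ^ k ≤ N) (m : ℕ) (hm : (m : ℝ) + 1 ≤ M) :
    |gv g (m + 1) - gv g m - dv g (m + 1)| * M ^ 2 ≤ K0 k A * N := by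
  rw [dv_eq hg, gv_eq hg, gv_eq hg, ← Finset.sum_sub_distrib, ← Finset.sum_sub_distrib]
  have := coef_sum hg M N (k ^ 2 + 1) 2 (by linarith) (by positivity) hN
    (fun i => ((m : ℝ) + 1) ^ i - (m : ℝ) ^ i - i * ((m : ℝ) + 1) ^ (i - 1)) (by
    intro i hi
    obtain ⟨h3, h4, h5⟩ := pow_diff ((m : ℝ) + 1) m (by positivity) rfl i
    have h6 : |((m : ℝ) + 1) ^ i - (m : ℝ) ^ i - i * ((m : ℝ) + 1) ^ (i - 1)| ≤
        (i : ℝ) * (((m : ℝ) + 1) ^ (i - 1) - (m : ℝ) ^ (i - 1)) := by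
      rw [abs_le]; constructor <;> nlinarith
    refine le_trans ?_ (ddv_aux M hM m hm i hi)
    gcongr)
  refine le_trans (le_of_eq ?_) this
  congr 2
  exact Finset.sum_congr rfl fun i _ => by push_cast; ring

lemma exp_bound1 (x : ℝ) : ‖Complex.exp (Complex.I * x) - 1‖ ≤ |x| := Real.norm_exp_I_mul_ofReal_sub_one_le

lemma exp_bound2 (x : ℝ) : ‖Complex.exp (Complex.I * x) - 1 - Complex.I * x‖ ≤ 2 * x ^ 2 := by
  have hn : ‖Complex.I * x‖ = |x| := by rw [norm_mul, Complex.norm_I, one_mul, Complex.norm_real, Real.norm_eq_abs]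
  by_cases h : |x| ≤ 1
  · have := Complex.norm_exp_sub_one_sub_id_le (x := Complex.I * x) (by rw [hn]; exact h)
    rw [hn, sq_abs] at this
    nlinarith [sq_nonneg x]
  · push Not at h
    have h1 := norm_sub_le (Complex.exp (Complex.I * x) - 1) (Complex.I * x)
    have h2 := exp_bound1 x
    rw [hn] at h1
    have : |x| ≤ x ^ 2 := by rw [← sq_abs]; nlinarith
    linarith

lemma e_eq (x : ℝ) : e x = Complex.exp (Complex.I * (2 * Real.pi * x : ℝ)) := by
  unfold e; congr 1; push_cast; ring

lemma e_diff1 (x y : ℝ) : ‖e x - e y‖ ≤ 2 * Real.pi * |x - y| := by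
  have h : e x - e y = e y * (e (x - y) - 1) := by
    rw [mul_sub, ← e_add]; simp
  rw [h, norm_mul, e_norm, one_mul, e_eq]
  refine (exp_bound1 _).trans (le_of_eq ?_)
  rw [abs_mul, abs_of_pos (by positivity)]

lemma e_diff2 (x y : ℝ) : ‖e x - e y - 2 * Real.pi * Complex.I * (x - y) * e x‖ ≤ 8 * Real.pi ^ 2 * (x - y) ^ 2 := by
  have h : e x - e y - 2 * Real.pi * Complex.I * (x - y) * e x =
      - (e x * (e (y - x) - 1 - Complex.I * (2 * Real.pi * (y - x) : ℝ))) := by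
    have h1 : e y = e x * e (y - x) := by rw [← e_add]; simp
    rw [h1]; push_cast; ring
  rw [h, norm_neg, norm_mul, e_norm, one_mul, e_eq]
  refine (exp_bound2 _).trans (le_of_eq ?_)
  ring

end Ana


set_option linter.unusedSectionVars false
set_option linter.unusedSimpArgs false

namespace Ana
open Polynomial Avg Cont
variable {k D A : ℕ} {g : ℤ[X]}

noncomputable def fi (g : ℤ[X]) (β : ℝ) (m : ℕ) : ℂ := (dv g m : ℂ) * e (gv g m * β)

lemma fi_norm (β : ℝ) (m : ℕ) : ‖fi g β m‖ = |dv g m| := by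
  unfold fi; rw [norm_mul, e_norm, mul_one, Complex.norm_real, Real.norm_eq_abs]

lemma K0_nonneg : 0 ≤ K0 k A := by unfold K0; positivity

section
variable (hg : Good k D A g) (hk : 0 < k) (M : ℕ) (N : ℝ) (hM : 1 ≤ M)
    (hN : (g.leadingCoeff : ℝ) * (M : ℝ) ^ k ≤ N) (hN0 : 0 ≤ N) (β : ℝ)
include hg hk hM hN hN0

lemma step_bounds (m : ℕ) (hm : m < M) :
    |dv g m| ≤ K0 k A * N / M ∧ |dv g (m + 1)| ≤ K0 k A * N / M ∧
    |dv g (m + 1) - dv g m| ≤ K0 k A * N / M ^ 2 ∧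
    |gv g (m + 1) - gv g m - dv g (m + 1)| ≤ K0 k A * N / M ^ 2 ∧
    |gv g (m + 1) - gv g m| ≤ 2 * (K0 k A * N / M) := by
  have hM1 : (1 : ℝ) ≤ M := by exact_mod_cast hM
  have hM0 : (0 : ℝ) < M := by linarith
  have hm1 : (m : ℝ) + 1 ≤ M := by exact_mod_cast hm
  have h1 := dv_bound hg hk M N hM1 hN m (by linarith)
  have h2 := dv_bound hg hk M N hM1 hN (m + 1) (by push_cast; exact hm1)
  have h3 := ddv_bound hg M N hM1 hN m hm1
  have h4 := gv_bound hg M N hM1 hN m hm1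
  rw [← le_div_iff₀ hM0] at h1 h2
  rw [← le_div_iff₀ (by positivity)] at h3 h4
  refine ⟨h1, h2, h3, h4, ?_⟩
  have h5 : K0 k A * N / M ^ 2 ≤ K0 k A * N / M := by
    have := K0_nonneg (k := k) (A := A)
    apply div_le_div_of_nonneg_left (by positivity) hM0
    nlinarith
  have h6 := abs_add_le (gv g (m + 1) - gv g m - dv g (m + 1)) (dv g (m + 1))
  rw [sub_add_cancel] at h6
  linarith

lemma fi_diff (m : ℕ) (hm : m < M) :
    ‖fi g β (m + 1) - fi g β m‖ ≤ K0 k A * N / M ^ 2 * (1 + 4 * Real.pi * K0 k A * (N * |β|)) := by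
  have hM0 : (0 : ℝ) < M := by exact_mod_cast hM
  obtain ⟨h1, h2, h3, h4, h5⟩ := step_bounds hg hk M N hM hN hN0 m hm
  have hK := K0_nonneg (k := k) (A := A)
  have h : fi g β (m + 1) - fi g β m = ((dv g (m + 1) - dv g m : ℝ) : ℂ) * e (gv g (m + 1) * β) +
      (dv g m : ℂ) * (e (gv g (m + 1) * β) - e (gv g m * β)) := by
    unfold fi; push_cast; ring
  rw [h]
  refine (norm_add_le _ _).trans ?_
  rw [norm_mul, norm_mul, e_norm, mul_one, Complex.norm_real, Complex.norm_real, Real.norm_eq_abs, Real.norm_eq_abs]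
  have h6 := e_diff1 (gv g (m + 1) * β) (gv g m * β)
  rw [← sub_mul, abs_mul] at h6
  have h7 : ‖e (gv g (m + 1) * β) - e (gv g m * β)‖ ≤ 2 * Real.pi * (2 * (K0 k A * N / M) * |β|) :=
    h6.trans (by gcongr)
  have h8 := mul_le_mul h1 h7 (norm_nonneg _) (by positivity)
  refine (add_le_add h3 h8).trans (le_of_eq ?_)
  field_simp
  ring

lemma fi_sum_triv : ‖∑ x ∈ Finset.range M, fi g β (x + 1)‖ ≤ K0 k A * N := by
  have hM0 : (0 : ℝ) < M := by exact_mod_cast hM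
  refine (norm_sum_le _ _).trans ?_
  refine (Finset.sum_le_card_nsmul _ _ (K0 k A * N / M) fun x hx => ?_).trans (le_of_eq ?_)
  · rw [fi_norm]; exact (step_bounds hg hk M N hM hN hN0 x (Finset.mem_range.1 hx)).2.1
  · rw [Finset.card_range, nsmul_eq_mul]; field_simp

lemma fi_sum_beta : 2 * Real.pi * |β| * ‖∑ x ∈ Finset.range M, fi g β (x + 1)‖ ≤
    2 + 32 * Real.pi ^ 2 * K0 k A ^ 2 * ((N * |β|) ^ 2 / M) + 2 * Real.pi * K0 k A * (N * |β| / M) := by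
  have hM0 : (0 : ℝ) < M := by exact_mod_cast hM
  have hK := K0_nonneg (k := k) (A := A)
  have hstep : ∀ x ∈ Finset.range M, ‖(e (gv g (x + 1) * β) - e (gv g x * β)) - 2 * Real.pi * Complex.I * β * fi g β (x + 1)‖ ≤
      8 * Real.pi ^ 2 * (2 * (K0 k A * N / M) * |β|) ^ 2 + 2 * Real.pi * |β| * (K0 k A * N / M ^ 2) := by
    intro m hm
    obtain ⟨h1, h2, h3, h4, h5⟩ := step_bounds hg hk M N hM hN hN0 m (Finset.mem_range.1 hm)
    have h6 := e_diff2 (gv g (m + 1) * β) (gv g m * β)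
    have h : (e (gv g (m + 1) * β) - e (gv g m * β)) - 2 * Real.pi * Complex.I * β * fi g β (m + 1) =
      (e (gv g (m + 1) * β) - e (gv g m * β) - 2 * Real.pi * Complex.I * (((gv g (m + 1) * β : ℝ) : ℂ) - ((gv g m * β : ℝ) : ℂ)) * e (gv g (m + 1) * β)) +
      ((2 * Real.pi * β * (gv g (m + 1) - gv g m - dv g (m + 1)) : ℝ) : ℂ) * (Complex.I * e (gv g (m + 1) * β)) := by
      unfold fi; push_cast; ring
    rw [h]
    refine (norm_add_le _ _).trans (add_le_add (h6.trans ?_) ?_)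
    · have : (gv g (m + 1) * β - gv g m * β) ^ 2 ≤ (2 * (K0 k A * N / M) * |β|) ^ 2 := by
        rw [← sub_mul, ← sq_abs, abs_mul]; gcongr
      gcongr
    · rw [norm_mul, norm_mul, e_norm, Complex.norm_I, Complex.norm_real, Real.norm_eq_abs, abs_mul, abs_mul,
        abs_of_pos (by positivity : 0 < 2 * Real.pi), mul_one, mul_one]
      gcongr
  have htel : ∑ x ∈ Finset.range M, (e (gv g (x + 1) * β) - e (gv g x * β)) = e (gv g M * β) - e (gv g 0 * β) :=
    Finset.sum_range_sub (fun x => e (gv g x * β)) M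
  have hsum := (norm_sum_le _ _).trans (Finset.sum_le_card_nsmul _ _ _ hstep)
  rw [Finset.sum_sub_distrib, htel, ← Finset.mul_sum, Finset.card_range, nsmul_eq_mul] at hsum
  have h1 : ‖2 * Real.pi * Complex.I * β * ∑ x ∈ Finset.range M, fi g β (x + 1)‖ =
      2 * Real.pi * |β| * ‖∑ x ∈ Finset.range M, fi g β (x + 1)‖ := by
    rw [norm_mul, norm_mul, norm_mul, norm_mul, Complex.norm_I, Complex.norm_real, Complex.norm_real, Real.norm_eq_abs,
      Real.norm_eq_abs, abs_of_pos Real.pi_pos]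
    simp
  have h2 : ‖e (gv g M * β) - e (gv g 0 * β)‖ ≤ 2 := by
    refine (norm_sub_le _ _).trans ?_
    rw [e_norm, e_norm]; norm_num
  have h3 := norm_sub_norm_le (2 * Real.pi * Complex.I * β * ∑ x ∈ Finset.range M, fi g β (x + 1)) (e (gv g M * β) - e (gv g 0 * β))
  rw [h1] at h3
  rw [norm_sub_rev] at hsum
  have h4 : (M : ℝ) * (8 * Real.pi ^ 2 * (2 * (K0 k A * N / M) * |β|) ^ 2 + 2 * Real.pi * |β| * (K0 k A * N / M ^ 2)) =
     32 * Real.pi ^ 2 * K0 k A ^ 2 * ((N * |β|) ^ 2 / M) + 2 * Real.pi * K0 k A * (N * |β| / M) := by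
    field_simp
    ring
  linarith

/-- the constant in the smooth sum -/
noncomputable def K1 (k A : ℕ) : ℝ := 2 + 32 * Real.pi ^ 2 * K0 k A ^ 2 + 2 * Real.pi * K0 k A + K0 k A

lemma fi_sum (h1 : (N * |β|) ^ 2 ≤ M) (h2 : N * |β| ≤ M) :
    ‖∑ x ∈ Finset.range M, fi g β (x + 1)‖ ≤ K1 k A * N * (max 1 (N * |β|))⁻¹ := by
  have hM0 : (0 : ℝ) < M := by exact_mod_cast hM
  have hK := K0_nonneg (k := k) (A := A)
  have hpos : 0 < max 1 (N * |β|) := lt_of_lt_of_le one_pos (le_max_left _ _)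
  rw [← div_eq_mul_inv, le_div_iff₀ hpos]
  have ht := fi_sum_triv hg hk M N hM hN hN0 β
  have hb := fi_sum_beta hg hk M N hM hN hN0 β
  set S := ‖∑ x ∈ Finset.range M, fi g β (x + 1)‖
  have hS : 0 ≤ S := norm_nonneg _
  rcases le_total 1 (N * |β|) with h | h
  · rw [max_eq_right h]
    have h3 : (N * |β|) ^ 2 / M ≤ 1 := (div_le_one hM0).2 h1
    have h4 : N * |β| / M ≤ 1 := (div_le_one hM0).2 h2
    have h5 : |β| * S ≤ K1 k A := by
      have h6 : 2 * Real.pi * |β| * S ≤ K1 k A := by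
        refine hb.trans ?_
        unfold K1
        have := mul_le_mul_of_nonneg_left h3 (by positivity : 0 ≤ 32 * Real.pi ^ 2 * K0 k A ^ 2)
        have := mul_le_mul_of_nonneg_left h4 (by positivity : 0 ≤ 2 * Real.pi * K0 k A)
        linarith
      have h7 : 1 ≤ 2 * Real.pi := by linarith [Real.pi_gt_three]
      have h8 : 0 ≤ |β| * S := by positivity
      nlinarith
    nlinarith
  · rw [max_eq_left h, mul_one]
    refine ht.trans ?_
    have : K0 k A ≤ K1 k A := by
      unfold K1; have : 0 ≤ 2 + 32 * Real.pi ^ 2 * K0 k A ^ 2 + 2 * Real.pi * K0 k A := by positivity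
      linarith
    gcongr

lemma abel_id (E φ : ℕ → ℂ) (n : ℕ) : ∑ x ∈ Finset.range n, (E (x + 2) - E (x + 1)) * φ (x + 1) =
    E (n + 1) * φ n - E 1 * φ 0 - ∑ x ∈ Finset.range n, E (x + 1) * (φ (x + 1) - φ x) := by
  induction n with
  | zero => simp
  | succ n ih => rw [Finset.sum_range_succ, ih, Finset.sum_range_succ]; ring

lemma abel (c : ℕ → ℂ) (a : ℂ) (η : ℝ) (hη : ∀ n ≤ M + 1, ‖∑ x ∈ Finset.range n, c x - n * a‖ ≤ η)
    (h1 : (N * |β|) ^ 2 ≤ M) (h2 : N * |β| ≤ M) :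
    ‖∑ x ∈ Finset.range M, c (x + 1) * fi g β (x + 1)‖ ≤
      ‖a‖ * (K1 k A * N * (max 1 (N * |β|))⁻¹) +
      η * (K0 k A * N / M * (3 + 4 * Real.pi * K0 k A * (N * |β|))) := by
  have hM0 : (0 : ℝ) < M := by exact_mod_cast hM
  have hK := K0_nonneg (k := k) (A := A)
  have hη0 : 0 ≤ η := (norm_nonneg _).trans (hη 0 (by omega))
  set E : ℕ → ℂ := fun n => ∑ x ∈ Finset.range n, c x - n * a with hE
  have hsplit : ∑ x ∈ Finset.range M, c (x + 1) * fi g β (x + 1) =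
      a * ∑ x ∈ Finset.range M, fi g β (x + 1) + ∑ x ∈ Finset.range M, (E (x + 2) - E (x + 1)) * fi g β (x + 1) := by
    rw [Finset.mul_sum, ← Finset.sum_add_distrib]
    refine Finset.sum_congr rfl fun x _ => ?_
    simp only [hE]
    rw [Finset.sum_range_succ _ (x + 1)]
    push_cast; ring
  rw [hsplit, abel_id hg hk M N hM hN hN0]
  refine (norm_add_le _ _).trans (add_le_add ?_ ?_)
  · rw [norm_mul]
    exact mul_le_mul_of_nonneg_left (fi_sum hg hk M N hM hN hN0 β h1 h2) (norm_nonneg _)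
  have hB : ∀ m ≤ M, ‖fi g β m‖ ≤ K0 k A * N / M := by
    intro m hm
    rw [fi_norm]
    rcases hm.lt_or_eq with h | h
    · exact (step_bounds hg hk M N hM hN hN0 m h).1
    · obtain ⟨m', rfl⟩ : ∃ m', m = m' + 1 := ⟨m - 1, by omega⟩
      exact (step_bounds hg hk M N hM hN hN0 m' (by omega)).2.1
  have hE1 : ‖E (M + 1) * fi g β M‖ ≤ η * (K0 k A * N / M) := by
    rw [norm_mul]; exact mul_le_mul (hη _ le_rfl) (hB _ le_rfl) (norm_nonneg _) hη0
  have hE2 : ‖E 1 * fi g β 0‖ ≤ η * (K0 k A * N / M) := by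
    rw [norm_mul]; exact mul_le_mul (hη _ (by omega)) (hB _ (by omega)) (norm_nonneg _) hη0
  have hE3 : ‖∑ x ∈ Finset.range M, E (x + 1) * (fi g β (x + 1) - fi g β x)‖ ≤
      M * (η * (K0 k A * N / M ^ 2 * (1 + 4 * Real.pi * K0 k A * (N * |β|)))) := by
    have := (norm_sum_le _ _).trans (Finset.sum_le_card_nsmul (Finset.range M)
      (fun x => ‖E (x + 1) * (fi g β (x + 1) - fi g β x)‖)
      (η * (K0 k A * N / M ^ 2 * (1 + 4 * Real.pi * K0 k A * (N * |β|)))) fun x hx => by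
        have hx' := Finset.mem_range.1 hx
        simp only [norm_mul]
        exact mul_le_mul (hη _ (by omega)) (fi_diff hg hk M N hM hN hN0 β x hx') (norm_nonneg _) hη0)
    rwa [Finset.card_range, nsmul_eq_mul] at this
  have h3 := norm_sub_le (E (M + 1) * fi g β M - E 1 * fi g β 0) (∑ x ∈ Finset.range M, E (x + 1) * (fi g β (x + 1) - fi g β x))
  have h4 := norm_sub_le (E (M + 1) * fi g β M) (E 1 * fi g β 0)
  have h5 : (M : ℝ) * (η * (K0 k A * N / M ^ 2 * (1 + 4 * Real.pi * K0 k A * (N * |β|)))) =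
      η * (K0 k A * N / M * (1 + 4 * Real.pi * K0 k A * (N * |β|))) := by
    field_simp
  have h6 : η * (K0 k A * N / M * (3 + 4 * Real.pi * K0 k A * (N * |β|))) = η * (K0 k A * N / M) + η * (K0 k A * N / M) +
      η * (K0 k A * N / M * (1 + 4 * Real.pi * K0 k A * (N * |β|))) := by ring
  linarith

end

end Ana


set_option linter.unusedSectionVars false
set_option linter.unusedSimpArgs false

namespace Num
open Filter

lemma ev_log (c : ℝ) : ∀ᶠ L : ℝ in atTop, c * Real.log L + 1 ≤ L := by
  have h := (Real.isLittleO_log_id_atTop.bound (show (0 : ℝ) < 1 / (2 * (|c| + 1)) by positivity))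
  filter_upwards [h, eventually_ge_atTop (2 : ℝ)] with L hL h2
  simp only [id, Real.norm_eq_abs] at hL
  have h3 : |c| * |Real.log L| ≤ L / 2 := by
    rw [abs_of_nonneg (by linarith : (0 : ℝ) ≤ L)] at hL
    calc |c| * |Real.log L| ≤ (|c| + 1) * (1 / (2 * (|c| + 1)) * L) := by
          apply mul_le_mul (by linarith) hL (abs_nonneg _) (by positivity)
      _ = L / 2 := by field_simp
  have h4 := le_abs_self (c * Real.log L)
  rw [abs_mul] at h4
  linarith

lemma ev_exp (c : ℝ) : ∀ᶠ L : ℝ in atTop, c * L ^ 4 ≤ Real.exp L := by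
  have h := (Real.isLittleO_pow_exp_atTop (n := 4)).bound (show (0 : ℝ) < 1 / (|c| + 1) by positivity)
  filter_upwards [h] with L hL
  rw [Real.norm_eq_abs, Real.norm_eq_abs, abs_of_pos (Real.exp_pos _), abs_of_nonneg (by positivity)] at hL
  have h1 : (|c| + 1) * L ^ 4 ≤ Real.exp L := by
    calc _ ≤ (|c| + 1) * (1 / (|c| + 1) * Real.exp L) := by gcongr
      _ = _ := by field_simp
  have h2 : 0 ≤ L ^ 4 := by positivity
  nlinarith [le_abs_self c]

lemma ev_const (c : ℝ) : ∀ᶠ L : ℝ in atTop, c ≤ Real.exp L :=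
  Real.tendsto_exp_atTop.eventually_ge_atTop c

lemma numG (k : ℕ) (κ K c3 E X s q ℓ : ℝ) (hκ : 1 ≤ κ) (hK : 0 ≤ K) (hc3 : 0 ≤ c3) (hE : E = Real.exp X) (hE1 : 1 ≤ E)
    (hs : 1 ≤ s) (hsE : s ≤ E) (hq : 1 ≤ q) (hqE : q ≤ κ * E ^ (k + 1)) (hl : 1 + ℓ ≤ (k + 3) * X) :
    Real.exp (c3 * (1 + ℓ)) * (K * (3 + 4 * Real.pi * K * (κ * s))) * (q * (κ * s)) ≤
      (K * (3 + 4 * Real.pi * K * κ) * κ ^ 2) * Real.exp ((c3 * (k + 3) + k + 3) * X) := by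
  have hpi := Real.pi_pos
  have hE0 : 0 ≤ E := by linarith
  have g1 : Real.exp (c3 * (1 + ℓ)) ≤ Real.exp (c3 * ((k + 3) * X)) :=
    Real.exp_le_exp.2 (mul_le_mul_of_nonneg_left hl hc3)
  have g2 : 3 + 4 * Real.pi * K * (κ * s) ≤ (3 + 4 * Real.pi * K * κ) * E := by
    have h1 : 4 * Real.pi * K * (κ * s) ≤ 4 * Real.pi * K * (κ * E) :=
      mul_le_mul_of_nonneg_left (mul_le_mul_of_nonneg_left hsE (by linarith)) (by positivity)
    have h2 : (3 + 4 * Real.pi * K * κ) * E = 3 * E + 4 * Real.pi * K * (κ * E) := by ring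
    linarith
  have g3 : q * (κ * s) ≤ (κ * E ^ (k + 1)) * (κ * E) :=
    mul_le_mul hqE (mul_le_mul_of_nonneg_left hsE (by linarith)) (by positivity) (by positivity)
  have hEp : E ^ (k + 3) = Real.exp ((k + 3 : ℕ) * X) := by rw [hE, ← Real.exp_nat_mul]
  calc _ ≤ Real.exp (c3 * ((k + 3) * X)) * (K * ((3 + 4 * Real.pi * K * κ) * E)) * ((κ * E ^ (k + 1)) * (κ * E)) :=
        mul_le_mul (mul_le_mul g1 (mul_le_mul_of_nonneg_left g2 hK) (by positivity) (Real.exp_pos _).le) g3 (by positivity) (by positivity)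
    _ = (K * (3 + 4 * Real.pi * K * κ) * κ ^ 2) * (Real.exp (c3 * ((k + 3) * X)) * E ^ (k + 3)) := by ring
    _ = _ := by rw [hEp, ← Real.exp_add]; congr 2; push_cast; ring

lemma numF (k D t : ℕ) (hD : 0 < D) (κ E X s q M T : ℝ) (hκ : 1 ≤ κ) (hE : E = Real.exp X)
    (hs : 1 ≤ s) (hsE : s ≤ E) (hq : 1 ≤ q) (hqE : q ≤ κ * E ^ (k + 1)) (hM : Real.exp T ≤ M) :
    6 * q * (t + 1) * (2 * D ^ 2 * (s ^ (k + 2)) ^ 2) ^ t / M ≤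
      6 * κ * Real.exp ((k + 1) * X + t * (1 + Real.log (2 * D ^ 2) + 2 * (k + 2) * X) - T) := by
  have hEp : ∀ n : ℕ, E ^ n = Real.exp (n * X) := fun n => by rw [hE, ← Real.exp_nat_mul]
  have hD1 : (0 : ℝ) < D := by exact_mod_cast hD
  have f1 : (t : ℝ) + 1 ≤ Real.exp t := Real.add_one_le_exp _
  have f2 : 2 * (D : ℝ) ^ 2 * (s ^ (k + 2)) ^ 2 ≤ Real.exp (Real.log (2 * D ^ 2) + 2 * (k + 2) * X) := by
    rw [Real.exp_add, Real.exp_log (by positivity)]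
    have h1 : (s ^ (k + 2)) ^ 2 ≤ (E ^ (k + 2)) ^ 2 :=
      pow_le_pow_left₀ (by positivity) (pow_le_pow_left₀ (by linarith) hsE _) _
    have e2 : (E ^ (k + 2)) ^ 2 = Real.exp (2 * (k + 2) * X) := by
      rw [← pow_mul, hEp]; congr 1; push_cast; ring
    rw [e2] at h1
    exact mul_le_mul_of_nonneg_left h1 (by positivity)
  have f3 : (2 * (D : ℝ) ^ 2 * (s ^ (k + 2)) ^ 2) ^ t ≤ Real.exp (t * (Real.log (2 * D ^ 2) + 2 * (k + 2) * X)) := by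
    rw [Real.exp_nat_mul]; exact pow_le_pow_left₀ (by positivity) f2 _
  have f4 : q ≤ κ * Real.exp ((k + 1) * X) := by
    have := hEp (k + 1); push_cast at this; rw [← this]; exact hqE
  calc _ ≤ 6 * (κ * Real.exp ((k + 1) * X)) * Real.exp t * Real.exp (t * (Real.log (2 * D ^ 2) + 2 * (k + 2) * X)) /
          Real.exp T :=
        div_le_div₀ (by positivity) (mul_le_mul (mul_le_mul (mul_le_mul_of_nonneg_left f4 (by norm_num)) f1 (by positivity) (by positivity))
          f3 (by positivity) (by positivity)) (Real.exp_pos _) hM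
    _ = 6 * κ * (Real.exp ((k + 1) * X) * Real.exp t * Real.exp (t * (Real.log (2 * D ^ 2) + 2 * (k + 2) * X)) *
          Real.exp (-T)) := by rw [Real.exp_neg]; ring
    _ = _ := by rw [← Real.exp_add, ← Real.exp_add, ← Real.exp_add]; congr 2; ring

lemma numS (k : ℕ) (c2 X M L ℓ t : ℝ) (hc2 : 0 ≤ c2) (hM : 1 ≤ M) (hl : 1 + ℓ ≤ (k + 3) * X) (ht : L ^ 2 ≤ t) :
    2 * (M + 1) * Real.exp (c2 * (1 + ℓ) - t) / M ≤ 4 * Real.exp (c2 * ((k + 3) * X) - L ^ 2) := by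
  rw [div_le_iff₀ (by linarith)]
  have s1 : Real.exp (c2 * (1 + ℓ) - t) ≤ Real.exp (c2 * ((k + 3) * X) - L ^ 2) := by
    apply Real.exp_le_exp.2
    have := mul_le_mul_of_nonneg_left hl hc2
    linarith
  calc _ ≤ 2 * (M + M) * Real.exp (c2 * ((k + 3) * X) - L ^ 2) :=
        mul_le_mul (by linarith) s1 (Real.exp_pos _).le (by linarith)
    _ = _ := by ring

lemma numE (C a b L : ℝ) (hC : 0 ≤ C) (h : a + b ≤ -L) (hL : 2 * C ≤ Real.exp L) : C * Real.exp a * Real.exp b ≤ 1 / 2 := by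
  rw [mul_assoc, ← Real.exp_add]
  calc _ ≤ C * Real.exp (-L) := mul_le_mul_of_nonneg_left (Real.exp_le_exp.2 h) hC
    _ ≤ 1 / 2 := by
        rw [Real.exp_neg, ← div_eq_mul_inv, div_le_iff₀ (Real.exp_pos _)]; linarith

lemma numX (k : ℕ) (hk : 0 < k) (c1 lD X t L : ℝ) (hc1 : 0 ≤ c1) (hlD : 0 ≤ lD) (hX0 : 0 ≤ X) (hL2 : 2 ≤ L) (hXL : X ≤ L ^ 2)
    (ht2 : t ≤ 2 * L ^ 2)
    (h2 : ((k + 1 + c1) + 2 * (1 + lD + 2 * (k + 2)) + 1) * (2 * k) * L ^ 4 ≤ Real.exp L) :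
    c1 * X + ((k + 1) * X + t * (1 + lD + 2 * (k + 2) * X) - Real.exp L / (2 * k)) ≤ -L := by
  have hL4 : L ^ 2 ≤ L ^ 4 := pow_le_pow_right₀ (by linarith) (by norm_num)
  have hk0 : (0 : ℝ) < k := by exact_mod_cast hk
  have i1 : (c1 + (k + 1)) * X ≤ (c1 + (k + 1)) * L ^ 4 :=
    mul_le_mul_of_nonneg_left (hXL.trans hL4) (by positivity)
  have j1 : 1 ≤ L ^ 2 := by nlinarith
  have i2 : 1 + lD + 2 * (k + 2) * X ≤ (1 + lD + 2 * (k + 2)) * L ^ 2 := by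
    have j2 : 2 * ((k : ℝ) + 2) * X ≤ 2 * (k + 2) * L ^ 2 := mul_le_mul_of_nonneg_left hXL (by positivity)
    have j3 : (1 + lD) * 1 ≤ (1 + lD) * L ^ 2 := mul_le_mul_of_nonneg_left j1 (by linarith)
    linarith
  have i3 : t * (1 + lD + 2 * (k + 2) * X) ≤ (2 * L ^ 2) * ((1 + lD + 2 * (k + 2)) * L ^ 2) :=
    mul_le_mul ht2 i2 (by positivity) (by positivity)
  have i4 : ((k + 1 + c1) + 2 * (1 + lD + 2 * (k + 2)) + 1) * L ^ 4 ≤ Real.exp L / (2 * k) := by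
    rw [le_div_iff₀ (by positivity)]; linarith
  have i5 : L ≤ L ^ 4 := by
    have := pow_le_pow_right₀ (show (1 : ℝ) ≤ L by linarith) (show 1 ≤ 4 by norm_num)
    linarith
  have i6 : (2 * L ^ 2) * ((1 + lD + 2 * (k + 2)) * L ^ 2) = 2 * (1 + lD + 2 * (k + 2)) * L ^ 4 := by ring
  linarith

lemma num_rew (A F S M K1 K2 Z : ℝ) : A * (F + S) * (K1 / M * K2) * Z = (A * (K1 * K2) * Z) * (F / M + S / M) := by ring

lemma num (k : ℕ) (hk : 0 < k) (D : ℕ) (hD : 0 < D) (κ K c3 c2 : ℝ) (hκ : 1 ≤ κ) (hK : 0 ≤ K) (hc3 : 0 ≤ c3) (hc2 : 0 ≤ c2) :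
    ∀ᶠ L : ℝ in atTop, ∀ s q M : ℝ, 1 ≤ s → s ≤ Real.exp (L * Real.log L) → 1 ≤ q → q ≤ κ * s ^ (k + 1) →
    Real.exp (Real.exp L / (2 * k)) ≤ M →
    Real.exp (c3 * (1 + Real.log (s ^ (k + 2)))) *
      (6 * q * (⌈L ^ 2⌉₊ + 1) * (2 * D ^ 2 * (s ^ (k + 2)) ^ 2) ^ ⌈L ^ 2⌉₊ +
        2 * (M + 1) * Real.exp (c2 * (1 + Real.log (s ^ (k + 2))) - ⌈L ^ 2⌉₊)) *
      (K / M * (3 + 4 * Real.pi * K * (κ * s))) * (q * (κ * s)) ≤ 1 := by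
  obtain ⟨Cst, hCst⟩ : ∃ C : ℝ, C = K * (3 + 4 * Real.pi * K * κ) * κ ^ 2 := ⟨_, rfl⟩
  have hCst0 : 0 ≤ Cst := by rw [hCst]; positivity
  obtain ⟨c1, hc1⟩ : ∃ c : ℝ, c = c3 * (k + 3) + k + 3 := ⟨_, rfl⟩
  have hc10 : 0 ≤ c1 := by rw [hc1]; positivity
  have hD1 : (1 : ℝ) ≤ D := by exact_mod_cast hD
  have hlD : 0 ≤ Real.log (2 * D ^ 2) := Real.log_nonneg (by nlinarith)
  filter_upwards [ev_log (c2 * (k + 3) + c1), ev_exp (((k + 1 + c1) + 2 * (1 + Real.log (2 * D ^ 2) + 2 * (k + 2)) + 1) * (2 * k)),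
    ev_const (2 * (Cst * 4)), ev_const (2 * (Cst * (6 * κ))),
    ev_log 1, eventually_ge_atTop (Real.exp 1)] with L h1 h2 h3 h4 h5 h6
  intro s q M hs hsX hq hqs hM
  have he1 : 2 ≤ Real.exp 1 := by have := Real.add_one_le_exp (1 : ℝ); linarith
  have hL2 : 2 ≤ L := he1.trans h6
  have hlog1 : 1 ≤ Real.log L := by rw [Real.le_log_iff_exp_le (by linarith)]; exact h6
  obtain ⟨X, hX⟩ : ∃ X : ℝ, X = L * Real.log L := ⟨_, rfl⟩
  rw [← hX] at hsX
  have hX1 : 1 ≤ X := by rw [hX]; nlinarith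
  have hXL : X ≤ L ^ 2 := by rw [hX]; nlinarith
  have ht1 : L ^ 2 ≤ ⌈L ^ 2⌉₊ := Nat.le_ceil _
  have ht2 : (⌈L ^ 2⌉₊ : ℝ) ≤ 2 * L ^ 2 := by
    have := Nat.ceil_lt_add_one (show 0 ≤ L ^ 2 by positivity)
    nlinarith
  generalize ⌈L ^ 2⌉₊ = t at ht1 ht2 ⊢
  have hM1 : 1 ≤ M := le_trans (Real.one_le_exp (by positivity)) hM
  have hls : Real.log s ≤ X := (Real.log_le_iff_le_exp (by linarith)).2 hsX
  have hlY1 : 1 + Real.log (s ^ (k + 2)) ≤ (k + 3) * X := by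
    rw [Real.log_pow]; push_cast
    have : ((k : ℝ) + 2) * Real.log s ≤ (k + 2) * X := mul_le_mul_of_nonneg_left hls (by positivity)
    linarith
  generalize Real.log (s ^ (k + 2)) = ℓ at hlY1 ⊢
  obtain ⟨E, hE⟩ : ∃ E : ℝ, E = Real.exp X := ⟨_, rfl⟩
  have hE1 : 1 ≤ E := by rw [hE]; exact Real.one_le_exp (by linarith)
  rw [← hE] at hsX
  have hqE : q ≤ κ * E ^ (k + 1) :=
    hqs.trans (mul_le_mul_of_nonneg_left (pow_le_pow_left₀ (by linarith) hsX _) (by linarith))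
  have hG := numG k κ K c3 E X s q ℓ hκ hK hc3 hE hE1 hs hsX hq hqE hlY1
  have hF := numF k D t hD κ E X s q M (Real.exp L / (2 * k)) hκ hE hs hsX hq hqE hM
  have hS := numS k c2 X M L ℓ t hc2 hM1 hlY1 ht1
  rw [← hCst, ← hc1] at hG
  rw [num_rew]
  have e1 := numE (Cst * (6 * κ)) _ _ L (by positivity)
    (numX k hk c1 (Real.log (2 * D ^ 2)) X t L hc10 hlD (by linarith) hL2 hXL ht2 h2) h4
  have e2 : Cst * 4 * Real.exp (c1 * X) * Real.exp (c2 * ((k + 3) * X) - L ^ 2) ≤ 1 / 2 := by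
    apply numE _ _ _ L (by positivity) ?_ h3
    have h7 : L * ((c2 * (k + 3) + c1) * Real.log L + 1) ≤ L * L := mul_le_mul_of_nonneg_left h1 (by linarith)
    have h8 : L * ((c2 * (k + 3) + c1) * Real.log L + 1) = c1 * X + c2 * ((k + 3) * X) + L := by rw [hX]; ring
    rw [h8] at h7
    linarith
  refine (mul_le_mul hG (add_le_add hF hS) (by positivity) (by positivity)).trans ?_
  rw [mul_add]
  linarith

lemma num2 (k : ℕ) (hk : 0 < k) (κ : ℝ) (hκ : 1 ≤ κ) :
    ∀ᶠ L : ℝ in atTop, ∀ s M : ℝ, 1 ≤ s → s ≤ Real.exp (L * Real.log L) →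
    Real.exp (Real.exp L / (2 * k)) ≤ M → (κ * s) ^ 2 ≤ M := by
  have hl : 0 ≤ Real.log κ := Real.log_nonneg hκ
  filter_upwards [ev_exp ((2 * Real.log κ + 2) * (2 * k)), ev_log 1, eventually_ge_atTop (2 : ℝ)] with L h1 h2 h3
  intro s M hs hsX hM
  refine le_trans ?_ hM
  have hXL : L * Real.log L ≤ L ^ 2 := by nlinarith
  have hL4 : L ^ 2 ≤ L ^ 4 := by
    have : 1 ≤ L ^ 2 := by nlinarith
    nlinarith [sq_nonneg (L ^ 2)]
  have hL41 : 1 ≤ L ^ 4 := by nlinarith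
  calc (κ * s) ^ 2 ≤ (Real.exp (Real.log κ) * Real.exp (L * Real.log L)) ^ 2 := by
        rw [Real.exp_log (by linarith)]; gcongr
    _ = Real.exp (2 * (Real.log κ + L * Real.log L)) := by
        rw [← Real.exp_add, ← Real.exp_nat_mul]; norm_num
    _ ≤ _ := by
        apply Real.exp_le_exp.2
        rw [le_div_iff₀ (by positivity)]
        refine le_trans ?_ h1
        have : 2 * (Real.log κ + L * Real.log L) ≤ (2 * Real.log κ + 2) * L ^ 4 := by nlinarith
        have hk' : (0 : ℝ) ≤ 2 * k := by positivity
        nlinarith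

lemma omega_le (q : ℕ) (hq : 0 < q) (t : ℝ) (ht : 1 ≤ t) :
    (q.primeFactors.card : ℝ) * Real.log t ≤ t * Real.log t + Real.log q := by
  have hlt : 0 ≤ Real.log t := Real.log_nonneg ht
  have h1 : ∑ p ∈ q.primeFactors, Real.log p ≤ Real.log q := by
    rw [← Real.log_prod (fun p hp => by exact_mod_cast (Nat.prime_of_mem_primeFactors hp).ne_zero)]
    apply Real.log_le_log
    · exact Finset.prod_pos fun p hp => by exact_mod_cast (Nat.prime_of_mem_primeFactors hp).pos
    · have := Nat.le_of_dvd hq (Nat.prod_primeFactors_dvd q)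
      rw [← Nat.cast_prod]; exact_mod_cast this
  have h2 : ∀ p ∈ q.primeFactors, Real.log t ≤ Real.log p + if (p : ℝ) ≤ t then Real.log t else 0 := by
    intro p hp
    have hpp := (Nat.prime_of_mem_primeFactors hp).one_le
    have hp1 : (1 : ℝ) ≤ p := by exact_mod_cast hpp
    split_ifs with h
    · have := Real.log_nonneg hp1; linarith
    · push Not at h
      have := Real.log_le_log (by linarith) h.le; linarith
  have h3 := Finset.sum_le_sum h2
  rw [Finset.sum_const, nsmul_eq_mul, Finset.sum_add_distrib, ← Finset.sum_filter, Finset.sum_const, nsmul_eq_mul] at h3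
  have h4 : ((q.primeFactors.filter fun p : ℕ => (p : ℝ) ≤ t).card : ℝ) ≤ t := by
    have : (q.primeFactors.filter fun p : ℕ => (p : ℝ) ≤ t) ⊆ Finset.Icc 1 ⌊t⌋₊ := by
      intro p hp
      rw [Finset.mem_filter] at hp
      rw [Finset.mem_Icc]
      exact ⟨(Nat.prime_of_mem_primeFactors hp.1).one_le, Nat.le_floor hp.2⟩
    have h5 := Finset.card_le_card this
    rw [Nat.card_Icc, Nat.add_sub_cancel] at h5
    have h6 : ((q.primeFactors.filter fun p : ℕ => (p : ℝ) ≤ t).card : ℝ) ≤ (⌊t⌋₊ : ℝ) := by exact_mod_cast h5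
    exact h6.trans (Nat.floor_le (by linarith))
  have := mul_le_mul_of_nonneg_right h4 hlt
  linarith

lemma num3 (k : ℕ) (κ c ε : ℝ) (hκ : 1 ≤ κ) (hc : 1 ≤ c) (hε : 0 ≤ ε) (hεc : 2 * (k + 1) * ε * Real.log c ≤ 1 / 8) :
    ∀ᶠ L : ℝ in atTop, ∀ (s : ℝ) (q : ℕ), 1 ≤ s → s ≤ Real.exp (ε * (L * Real.log L)) → 0 < q →
      (q : ℝ) ≤ κ * s ^ (k + 1) → c ^ q.primeFactors.card ≤ Real.exp (L / 4) := by
  have hlκ : 0 ≤ Real.log κ := Real.log_nonneg hκ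
  have hlc : 0 ≤ Real.log c := Real.log_nonneg hc
  have hsq : ∀ᶠ L : ℝ in atTop, 16 * Real.log c ≤ √L := (Real.tendsto_sqrt_atTop).eventually_ge_atTop _
  filter_upwards [hsq, eventually_ge_atTop (16 * (Real.log c * Real.log κ)), eventually_ge_atTop (Real.exp 2)] with L h1 h2 h3
  intro s q hs hsX hq hqs
  have he2 : 3 ≤ Real.exp 2 := by have := Real.add_one_le_exp (2 : ℝ); linarith
  have hL3 : 3 ≤ L := he2.trans h3
  have hlog : 2 ≤ Real.log L := by rw [Real.le_log_iff_exp_le (by linarith)]; exact h3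
  have hqr : (0 : ℝ) < q := by exact_mod_cast hq
  have hlq : Real.log q ≤ Real.log κ + (k + 1) * (ε * (L * Real.log L)) := by
    have h4 : Real.log q ≤ Real.log (κ * s ^ (k + 1)) := Real.log_le_log hqr hqs
    rw [Real.log_mul (by positivity) (by positivity), Real.log_pow] at h4
    have h5 : Real.log s ≤ ε * (L * Real.log L) := (Real.log_le_iff_le_exp (by linarith)).2 hsX
    push_cast at h4
    have h6 : ((k : ℝ) + 1) * Real.log s ≤ (k + 1) * (ε * (L * Real.log L)) := by gcongr
    linarith
  have hsq1 : 1 ≤ √L := by rw [Real.one_le_sqrt]; linarith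
  have ho := omega_le q hq (√L) hsq1
  rw [Real.log_sqrt (by linarith)] at ho
  set ω : ℝ := (q.primeFactors.card : ℝ) with hω
  have hω2 : ω ≤ √L + Real.log κ + 2 * (k + 1) * ε * L := by
    have h5 : ω * (Real.log L / 2) ≤ (√L + Real.log κ + 2 * (k + 1) * ε * L) * (Real.log L / 2) := by nlinarith
    exact le_of_mul_le_mul_right h5 (by linarith)
  rw [← Real.exp_log (show 0 < c by linarith), ← Real.exp_nat_mul]
  apply Real.exp_le_exp.2
  rw [← hω]
  have hss : √L * √L = L := Real.mul_self_sqrt (by linarith)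
  have h6 : ω * Real.log c ≤ (√L + Real.log κ + 2 * (k + 1) * ε * L) * Real.log c := by gcongr
  have h7 : √L * Real.log c ≤ L / 16 := by nlinarith
  have h8 : 2 * (k + 1) * ε * L * Real.log c ≤ L / 8 := by nlinarith
  nlinarith

end Num


set_option linter.unusedSectionVars false
set_option linter.unusedSimpArgs false

namespace Asm
open Filter Polynomial Avg Cont Loc Ana

variable {k D A : ℕ} {g : ℤ[X]}

lemma gd_norm_eq (p x : ℕ) : ((‖gd g p x‖ : ℝ) : ℂ) = gd g p x := by
  unfold gd; split_ifs <;> simp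

lemma avg_triv (hg : Good k D A g) (hD : 0 < D) (hk : 0 < k) (P : Finset ℕ) (hP : ∀ p ∈ P, p.Prime) (q : ℕ) (hq : 0 < q) (a : ℤ) :
    ‖avg (q * QP g P) (fun x => (∏ p ∈ P, gd g p x) * ph g a q x)‖ ≤ ∏ p ∈ P, (1 - jr g p) := by
  have hQ := QP_pos (g := g) P hP
  have h1 := norm_avg_le_avg (F := fun x => (∏ p ∈ P, gd g p x) * ph g a q x) (G := fun x => ∏ p ∈ P, ‖gd g p x‖) (Q := q * QP g P)
    (fun x => by rw [norm_mul, ph_norm, mul_one, norm_prod])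
  refine h1.trans ?_
  have h2 : (((∑ x ∈ Finset.range (q * QP g P), ∏ p ∈ P, ‖gd g p x‖) / (q * QP g P : ℕ) : ℝ) : ℂ) =
      avg (q * QP g P) (fun x => ∏ p ∈ P, gd g p x) := by
    unfold avg
    push_cast
    congr 1
    exact Finset.sum_congr rfl fun x _ => Finset.prod_congr rfl fun p _ => gd_norm_eq p x
  have hper := per_prod (g := g) (fun p x => gd g p x) (fun p => gd_per g p) P
  rw [avg_dvd hper (Dvd.intro_left _ rfl) (by positivity)] at h2
  have h3 := crt_bound hg hD hk P hP 1 one_pos (fun p hp h => absurd (Nat.dvd_one.1 h) hp.ne_one) 0 (by rw [Nat.cast_one]; exact isCoprime_one_right)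
  have h4 : avg (1 * QP g P) (fun x => (∏ p ∈ P, gd g p x) * ph g 0 1 x) = avg (QP g P) (fun x => ∏ p ∈ P, gd g p x) := by
    rw [one_mul]
    apply avg_congr
    intro x
    have : ph g 0 1 x = 1 := by
      unfold ph; have := e_int 0; simpa using this
    rw [this, mul_one]
  rw [h4, ← h2, Complex.norm_real, Real.norm_eq_abs] at h3
  rw [Nat.primeFactors_one, Finset.card_empty, pow_zero, Nat.cast_one, Real.sqrt_one, div_one, mul_one] at h3
  exact (le_abs_self _).trans h3

lemma avg_bound (hg : Good k D A g) (hD : 0 < D) (hk : 0 < k) (κ s : ℝ) (hκ : 1 ≤ κ) (hs : 1 ≤ s) (q : ℕ) (hq : 0 < q)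
    (hqs : (q : ℝ) ≤ κ * s ^ (k + 1)) (a : ℤ) (ha : IsCoprime a (q : ℤ)) (Z : ℝ) (hZ : 1 ≤ Z)
    (hω : (C1 k D : ℝ) ^ q.primeFactors.card ≤ Z) :
    ‖avg (q * QP g (PY (s ^ (k + 2)))) (fun x => (∏ p ∈ PY (s ^ (k + 2)), gd g p x) * ph g a q x)‖ ≤
      (∏ p ∈ PY (s ^ (k + 2)), (1 - jr g p)) * (√(κ ^ (k + 2)) * (Z / √(q : ℝ))) := by
  have hw : 0 ≤ ∏ p ∈ PY (s ^ (k + 2)), (1 - jr g p) :=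
    Finset.prod_nonneg fun p hp => (one_sub_jr_pos hg (PY_prime p hp)).le
  have hqr : (0 : ℝ) < q := by exact_mod_cast hq
  have hsq : 0 < √(q : ℝ) := Real.sqrt_pos.2 hqr
  have hk1 : 1 ≤ √(κ ^ (k + 2)) := by rw [Real.one_le_sqrt]; exact one_le_pow₀ hκ
  by_cases hall : ∀ p : ℕ, p.Prime → p ∣ q → p ∈ PY (s ^ (k + 2))
  · refine (crt_bound hg hD hk _ PY_prime q hq hall a ha).trans (mul_le_mul_of_nonneg_left ?_ hw)
    calc (C1 k D : ℝ) ^ q.primeFactors.card / √(q : ℝ) ≤ Z / √(q : ℝ) := div_le_div_of_nonneg_right hω hsq.le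
      _ ≤ _ := le_mul_of_one_le_left (by positivity) hk1
  · push Not at hall
    obtain ⟨p, hp, hpq, hpP⟩ := hall
    refine (avg_triv hg hD hk _ PY_prime q hq a).trans (le_mul_of_one_le_right hw ?_)
    rw [PY_mem (by positivity)] at hpP
    push Not at hpP
    have h1 := hpP hp
    have h2 : (p : ℝ) ≤ q := by exact_mod_cast Nat.le_of_dvd hq hpq
    have h3 : s ≤ κ := by
      have h4 : s ^ (k + 1) * s ≤ s ^ (k + 1) * κ := by
        have : s ^ (k + 2) = s ^ (k + 1) * s := by ring
        linarith
      exact le_of_mul_le_mul_left h4 (by positivity)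
    have h5 : (q : ℝ) ≤ κ ^ (k + 2) := by
      calc (q : ℝ) ≤ κ * s ^ (k + 1) := hqs
        _ ≤ κ * κ ^ (k + 1) := mul_le_mul_of_nonneg_left (pow_le_pow_left₀ (by linarith) h3 _) (by linarith)
        _ = _ := by ring
    have h6 := Real.sqrt_le_sqrt h5
    rw [← mul_div_assoc, one_le_div hsq]
    nlinarith

lemma core_alg (w N Av K1' m E G c q T Z : ℝ) (hw : 0 < w) (hN : 0 ≤ N) (hm : 0 ≤ m) (hK : 0 ≤ K1')
    (hAv : Av ≤ w * (c * (Z / √q))) (hq : 1 ≤ q) (hT : 1 ≤ T) (hZ : 1 ≤ Z) (hmT : T⁻¹ ≤ m)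
    (hE : E * G ≤ w * N * (q * T)⁻¹) :
    Av * (K1' * N * m) + E * G ≤ w * N * ((K1' * c + 1) * Z * (√q)⁻¹ * m) := by
  have hs : 1 ≤ √q := by rw [Real.one_le_sqrt]; exact hq
  have hsq : √q ≤ q := by
    have := Real.mul_self_sqrt (show 0 ≤ q by linarith)
    nlinarith
  have h1 : Av * (K1' * N * m) ≤ w * (c * (Z / √q)) * (K1' * N * m) := mul_le_mul_of_nonneg_right hAv (by positivity)
  have h2 : (q * T)⁻¹ ≤ Z * (√q)⁻¹ * m := by
    rw [mul_inv]
    refine mul_le_mul ?_ hmT (by positivity) (by positivity)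
    calc q⁻¹ ≤ (√q)⁻¹ := inv_anti₀ (by linarith) hsq
      _ ≤ _ := le_mul_of_one_le_left (by positivity) hZ
  have h3 : w * N * (q * T)⁻¹ ≤ w * N * (Z * (√q)⁻¹ * m) := mul_le_mul_of_nonneg_left h2 (by positivity)
  have h4 : w * N * ((K1' * c + 1) * Z * (√q)⁻¹ * m) = w * (c * (Z / √q)) * (K1' * N * m) + w * N * (Z * (√q)⁻¹ * m) := by
    rw [div_eq_mul_inv]; ring
  linarith

lemma K1_nonneg : 0 ≤ K1 k A := by
  have := K0_nonneg (k := k) (A := A)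
  unfold K1; positivity

lemma err_alg (w Ew err K M pK b N q T : ℝ) (hw : Ew⁻¹ ≤ w) (hEw : 0 < Ew) (hM : 0 < M) (hN : 0 ≤ N) (hq : 0 < q) (hT : 0 < T)
    (hK : 0 ≤ K) (herr : 0 ≤ err) (hpK : 0 ≤ pK) (hb : b ≤ T)
    (h : Ew * err * (K / M * (3 + pK * T)) * (q * T) ≤ 1) :
    err * (K * N / M * (3 + pK * b)) ≤ w * N * (q * T)⁻¹ := by
  have h1 : err * (K * N / M * (3 + pK * b)) ≤ err * (K * N / M * (3 + pK * T)) := by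
    refine mul_le_mul_of_nonneg_left (mul_le_mul_of_nonneg_left ?_ (by positivity)) herr
    have := mul_le_mul_of_nonneg_left hb hpK
    linarith
  have h2 : err * (K / M * (3 + pK * T)) ≤ Ew⁻¹ * (q * T)⁻¹ := by
    rw [← mul_inv, ← one_div, le_div_iff₀ (by positivity)]
    refine le_trans (le_of_eq ?_) h
    ring
  have h3 : Ew⁻¹ * (q * T)⁻¹ ≤ w * (q * T)⁻¹ := mul_le_mul_of_nonneg_right hw (by positivity)
  calc _ ≤ _ := h1
    _ = (err * (K / M * (3 + pK * T))) * N := by ring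
    _ ≤ (w * (q * T)⁻¹) * N := mul_le_mul_of_nonneg_right (h2.trans h3) hN
    _ = _ := by ring

lemma C3_nonneg (hD : 0 < D) : 0 ≤ C3 k D := by
  unfold C3
  have h1 : (1 : ℝ) ≤ ((D ^ 2 + k : ℕ) : ℝ) := by exact_mod_cast (Nat.one_le_pow _ _ hD).trans (Nat.le_add_right _ _)
  have : 0 ≤ Real.log (2 * ((D ^ 2 + k : ℕ) : ℝ)) := Real.log_nonneg (by linarith)
  positivity

lemma core (k : ℕ) (hk : 0 < k) (D : ℕ) (hD : 0 < D) (A : ℕ) (κ ε : ℝ) (hκ : 1 ≤ κ) (hε : 0 ≤ ε) (hε1 : ε ≤ 1)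
    (hεc : 2 * (k + 1) * ε * Real.log (C1 k D) ≤ 1 / 8) :
    ∀ᶠ L : ℝ in atTop, ∀ g : ℤ[X], Good k D A g → ∀ (s : ℝ) (q M : ℕ) (N γ : ℝ) (a : ℤ), 1 ≤ s →
      s ≤ Real.exp (ε * (L * Real.log L)) → 0 < q → (q : ℝ) ≤ κ * s ^ (k + 1) → IsCoprime a (q : ℤ) →
      Real.exp (Real.exp L / (2 * k)) ≤ M → (g.leadingCoeff : ℝ) * (M : ℝ) ^ k ≤ N → 0 ≤ N → N * |γ - a / q| ≤ κ * s →
      ‖∑ x ∈ Finset.range M, (∏ p ∈ PY (s ^ (k + 2)), gd g p (x + 1)) * fi g γ (x + 1)‖ ≤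
        (∏ p ∈ PY (s ^ (k + 2)), (1 - jr g p)) * N * ((K1 k A * √(κ ^ (k + 2)) + 1) * Real.exp (L / 4) * (√(q : ℝ))⁻¹ *
          (max 1 (N * |γ - a / q|))⁻¹) := by
  have hC1 : (1 : ℝ) ≤ C1 k D := by
    unfold C1; exact_mod_cast (Nat.one_le_pow _ _ hD).trans (Nat.le_add_right _ _)
  filter_upwards [Num.num k hk D hD κ (K0 k A) (C3 k D) (3 * (D ^ 2 + k : ℕ)) hκ K0_nonneg (C3_nonneg hD) (by positivity),
    Num.num2 k hk κ hκ, Num.num3 k κ (C1 k D) ε hκ hC1 hε hεc, eventually_ge_atTop (1 : ℝ)] with L h1 h2 h3 hL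
  intro g hg s q M N γ a hs hsε hq hqs ha hM hN hN0 hβ
  have hlog : 0 ≤ Real.log L := Real.log_nonneg hL
  have hsX : s ≤ Real.exp (L * Real.log L) := hsε.trans (Real.exp_le_exp.2 (mul_le_of_le_one_left (by positivity) hε1))
  have hq1 : (1 : ℝ) ≤ q := by exact_mod_cast hq
  have hY : 1 ≤ s ^ (k + 2) := one_le_pow₀ hs
  have hMr : (0 : ℝ) < M := lt_of_lt_of_le (Real.exp_pos _) hM
  have hM1 : 1 ≤ M := by exact_mod_cast hMr
  specialize h1 s q M hs hsX hq1 hqs hM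
  specialize h2 s M hs hsX hM
  specialize h3 s q hs hsε hq hqs
  have hT1 : 1 ≤ κ * s := by nlinarith
  obtain ⟨β, hβd⟩ : ∃ β : ℝ, β = γ - a / q := ⟨_, rfl⟩
  rw [← hβd] at hβ ⊢
  have hb0 : 0 ≤ N * |β| := by positivity
  have hb1 : (N * |β|) ^ 2 ≤ M := (pow_le_pow_left₀ hb0 hβ 2).trans h2
  have hb2 : N * |β| ≤ M := hβ.trans (le_trans (by nlinarith) h2)
  -- sieve
  obtain ⟨r, hr⟩ : ∃ r, ⌈L ^ 2⌉₊ = r + 1 := by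
    refine ⟨⌈L ^ 2⌉₊ - 1, ?_⟩
    have : 0 < ⌈L ^ 2⌉₊ := Nat.ceil_pos.2 (by positivity)
    omega
  rw [hr] at h1
  obtain ⟨η, hηd⟩ : ∃ η : ℝ, η = 6 * q * (r + 2) * (2 * D ^ 2 * (s ^ (k + 2)) ^ 2) ^ (r + 1) +
      2 * (M + 1) * Real.exp (3 * (D ^ 2 + k : ℕ) * (1 + Real.log (s ^ (k + 2))) - (r + 1 : ℕ)) := ⟨_, rfl⟩
  have hη0 : 0 ≤ η := by rw [hηd]; positivity
  have hη : ∀ n ≤ M + 1, ‖∑ x ∈ Finset.range n, (∏ p ∈ PY (s ^ (k + 2)), gd g p x) * ph g a q x -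
      n * avg (q * QP g (PY (s ^ (k + 2)))) (fun x => (∏ p ∈ PY (s ^ (k + 2)), gd g p x) * ph g a q x)‖ ≤ η := by
    intro n hn
    refine (sieve_bound hg hD hY q hq a n r).trans ?_
    rw [hηd]
    have hn' : (n : ℝ) ≤ M + 1 := by exact_mod_cast hn
    have : 2 * (n : ℝ) * Real.exp (3 * (D ^ 2 + k : ℕ) * (1 + Real.log (s ^ (k + 2))) - (r + 1 : ℕ)) ≤
      2 * (M + 1) * Real.exp (3 * (D ^ 2 + k : ℕ) * (1 + Real.log (s ^ (k + 2))) - (r + 1 : ℕ)) :=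
      mul_le_mul_of_nonneg_right (by linarith) (Real.exp_pos _).le
    linarith
  have hab := abel hg hk M N hM1 hN hN0 β _ _ η hη hb1 hb2
  have hsum : ∑ x ∈ Finset.range M, (∏ p ∈ PY (s ^ (k + 2)), gd g p (x + 1)) * fi g γ (x + 1) =
      ∑ x ∈ Finset.range M, ((∏ p ∈ PY (s ^ (k + 2)), gd g p (x + 1)) * ph g a q (x + 1)) * fi g β (x + 1) := by
    refine Finset.sum_congr rfl fun x _ => ?_
    have h5 : e (gv g (x + 1) * γ) = ph g a q (x + 1) * e (gv g (x + 1) * β) := by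
      unfold ph
      rw [← e_add]
      congr 1
      unfold gv
      rw [hβd]; push_cast; ring
    unfold fi
    rw [h5]; ring
  rw [hsum]
  refine hab.trans ?_
  have hw := wprod_ge hg hD hY
  rw [Real.exp_neg] at hw
  have hw0 : 0 < ∏ p ∈ PY (s ^ (k + 2)), (1 - jr g p) := Finset.prod_pos fun p hp => one_sub_jr_pos hg (PY_prime p hp)
  have hAv := avg_bound hg hD hk κ s hκ hs q hq hqs a ha _ (Real.one_le_exp (by linarith)) h3
  have hr2 : (((r + 1 : ℕ) : ℝ) + 1) = (r : ℝ) + 2 := by push_cast; ring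
  rw [hr2, ← hηd] at h1
  have hE := err_alg _ _ η (K0 k A) M (4 * Real.pi * K0 k A) (N * |β|) N q (κ * s) hw (Real.exp_pos _) hMr hN0 (by linarith) (by linarith)
    K0_nonneg hη0 (mul_nonneg (by positivity) K0_nonneg) hβ h1
  refine core_alg _ N _ (K1 k A) _ η _ _ q (κ * s) _ hw0 hN0 (by positivity) K1_nonneg hAv hq1 hT1 (Real.one_le_exp (by linarith)) ?_ hE
  exact inv_anti₀ (by positivity) (max_le hT1 hβ)

end Asm


set_option linter.unusedSectionVars false
set_option linter.unusedSimpArgs false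

namespace Asm
open Filter Polynomial Avg Cont Loc Ana

lemma wProd_eq (g : ℤ[X]) (Y : ℝ) : wProd g Y = ∏ p ∈ PY Y, (1 - jr g p) := by
  unfold wProd PY jr
  refine Finset.prod_congr ?_ fun _ _ => rfl
  ext p; simp

lemma prod_gd (g : ℤ[X]) (Y : ℝ) (hY : 0 ≤ Y) (x : ℕ) [Decidable ((x : ℤ) ∈ WSet g Y)] :
    ∏ p ∈ PY Y, gd g p x = if (x : ℤ) ∈ WSet g Y then 1 else 0 := by
  split_ifs with h
  · refine Finset.prod_eq_one fun p hp => ?_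
    have h1 := (PY_mem hY).1 hp
    have := h p h1.1 h1.2
    unfold gd bad
    rw [if_neg this]
  · unfold WSet at h
    simp only [Set.mem_ofPred_eq] at h
    push Not at h
    obtain ⟨p, h1, h2, h3⟩ := h
    refine Finset.prod_eq_zero ((PY_mem hY).2 ⟨h1, h2⟩) ?_
    unfold gd bad
    rw [if_pos h3]

lemma sum_shift (F : ℕ → ℂ) (M : ℕ) : ∑ m ∈ Finset.Icc 1 M, F m = ∑ x ∈ Finset.range M, F (x + 1) := by
  induction M with
  | zero => simp
  | succ n ih => rw [Finset.sum_Icc_succ_top (by omega), Finset.sum_range_succ, ih]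

open scoped Classical in
lemma sum_eq (g : ℤ[X]) (Y : ℝ) (hY : 0 ≤ Y) (M : ℕ) (γ : ℝ) :
    ∑ m ∈ (Finset.Icc 1 M).filter (fun m => (m : ℤ) ∈ WSet g Y),
      ((((Polynomial.derivative g).eval (m : ℤ) : ℤ) : ℝ) : ℂ) * e (((g.eval (m : ℤ) : ℤ) : ℝ) * γ) =
    ∑ x ∈ Finset.range M, (∏ p ∈ PY Y, gd g p (x + 1)) * fi g γ (x + 1) := by
  have h0 : ∑ m ∈ (Finset.Icc 1 M).filter (fun m => (m : ℤ) ∈ WSet g Y),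
      ((((Polynomial.derivative g).eval (m : ℤ) : ℤ) : ℝ) : ℂ) * e (((g.eval (m : ℤ) : ℤ) : ℝ) * γ) =
    ∑ m ∈ (Finset.Icc 1 M).filter (fun m : ℕ => (m : ℤ) ∈ WSet g Y),
      ((((Polynomial.derivative g).eval (m : ℤ) : ℤ) : ℝ) : ℂ) * e (((g.eval (m : ℤ) : ℤ) : ℝ) * γ) := by
    symm
    refine Finset.sum_bij (fun (x : ℕ) _ => (x : ℤ)) ?_ ?_ ?_ ?_
    · intro x hx
      simp only [Finset.mem_filter, Finset.bind_def, Finset.pure_def, Finset.mem_sup, Finset.mem_singleton] at hx ⊢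
      exact ⟨⟨x, hx.1, rfl⟩, hx.2⟩
    · intro x _ y _ h
      exact_mod_cast h
    · intro y hy
      simp only [Finset.mem_filter, Finset.bind_def, Finset.pure_def, Finset.mem_sup, Finset.mem_singleton] at hy
      obtain ⟨⟨x, hx, rfl⟩, hy2⟩ := hy
      exact ⟨x, Finset.mem_filter.2 ⟨hx, hy2⟩, rfl⟩
    · intro x _; rfl
  rw [h0, Finset.sum_filter, sum_shift]
  refine Finset.sum_congr rfl fun x _ => ?_
  rw [prod_gd g Y hY (x + 1)]
  split_ifs
  · rw [one_mul]; rfl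
  · rw [zero_mul]

lemma M_bound (k : ℕ) (hk : 0 < k) (B : ℕ) : ∀ᶠ N : ℕ in atTop, ∀ (d : ℕ) (b : ℝ), 1 ≤ b → b ≤ B * (d : ℝ) ^ k →
    (d : ℝ) ≤ (N : ℝ) ^ ((1 : ℝ) / ((2 : ℝ) ^ (k + 2) * (k : ℝ) ^ 2)) →
    Real.exp (Real.log N / (2 * k)) ≤ ⌊((N : ℝ) / b) ^ ((1 : ℝ) / k)⌋₊ ∧
      b * (⌊((N : ℝ) / b) ^ ((1 : ℝ) / k)⌋₊ : ℝ) ^ k ≤ N := by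
  have hk1 : (1 : ℝ) ≤ k := by exact_mod_cast hk
  have hk0 : k ≠ 0 := hk.ne'
  have ht : Tendsto (fun N : ℕ => (N : ℝ) ^ ((3 : ℝ) / 8)) atTop atTop :=
    (tendsto_rpow_atTop (by norm_num)).comp tendsto_natCast_atTop_atTop
  filter_upwards [ht.eventually_ge_atTop (2 ^ k * (B : ℝ)), eventually_ge_atTop 1] with N h1 hN
  intro d b hb hbB hd
  have hN1 : (1 : ℝ) ≤ N := by exact_mod_cast hN
  have hN0 : (0 : ℝ) < N := by linarith
  have hb0 : 0 < b := by linarith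
  have hdk : (d : ℝ) ^ k ≤ (N : ℝ) ^ ((1 : ℝ) / 8) := by
    calc (d : ℝ) ^ k ≤ ((N : ℝ) ^ ((1 : ℝ) / ((2 : ℝ) ^ (k + 2) * (k : ℝ) ^ 2))) ^ k := pow_le_pow_left₀ (by positivity) hd _
      _ = (N : ℝ) ^ ((1 : ℝ) / ((2 : ℝ) ^ (k + 2) * (k : ℝ) ^ 2) * k) := by rw [Real.rpow_mul_natCast hN0.le]
      _ ≤ _ := by
          apply Real.rpow_le_rpow_of_exponent_le hN1
          have h2 : (1 : ℝ) / ((2 : ℝ) ^ (k + 2) * (k : ℝ) ^ 2) * k = 1 / (2 ^ (k + 2) * k) := by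
            field_simp
          rw [h2]
          apply one_div_le_one_div_of_le (by norm_num)
          have h3 : (2 : ℝ) ^ 3 ≤ 2 ^ (k + 2) := pow_le_pow_right₀ (by norm_num) (by omega)
          nlinarith
  have hX : Real.exp (Real.log N / (2 * k)) ^ k = (N : ℝ) ^ ((1 : ℝ) / 2) := by
    rw [← Real.exp_nat_mul, Real.rpow_def_of_pos hN0]
    congr 1; field_simp
  set E := Real.exp (Real.log N / (2 * k)) with hE
  have hE1 : 1 ≤ E := Real.one_le_exp (div_nonneg (Real.log_nonneg hN1) (by positivity))
  have hNb : 0 ≤ (N : ℝ) / b := by positivity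
  have h4 : (2 * E) ^ k ≤ N / b := by
    rw [le_div_iff₀ hb0, mul_pow, hX]
    have h5 : (N : ℝ) ^ ((1 : ℝ) / 2) * (N : ℝ) ^ ((1 : ℝ) / 8) * (N : ℝ) ^ ((3 : ℝ) / 8) = N := by
      rw [← Real.rpow_add hN0, ← Real.rpow_add hN0]; norm_num
    calc 2 ^ k * (N : ℝ) ^ ((1 : ℝ) / 2) * b ≤ 2 ^ k * (N : ℝ) ^ ((1 : ℝ) / 2) * (B * (N : ℝ) ^ ((1 : ℝ) / 8)) := by
          refine mul_le_mul_of_nonneg_left (hbB.trans (mul_le_mul_of_nonneg_left hdk (by positivity))) (by positivity)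
      _ = (N : ℝ) ^ ((1 : ℝ) / 2) * (N : ℝ) ^ ((1 : ℝ) / 8) * (2 ^ k * B) := by ring
      _ ≤ (N : ℝ) ^ ((1 : ℝ) / 2) * (N : ℝ) ^ ((1 : ℝ) / 8) * (N : ℝ) ^ ((3 : ℝ) / 8) :=
          mul_le_mul_of_nonneg_left h1 (by positivity)
      _ = N := h5
  rw [one_div]
  have h6 : 2 * E ≤ ((N : ℝ) / b) ^ ((k : ℝ)⁻¹) := by
    rw [← Real.pow_rpow_inv_natCast (show 0 ≤ 2 * E by positivity) hk0]
    exact Real.rpow_le_rpow (by positivity) h4 (by positivity)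
  refine ⟨?_, ?_⟩
  · have := Nat.lt_floor_add_one (((N : ℝ) / b) ^ ((k : ℝ)⁻¹))
    linarith
  · have h7 : (⌊((N : ℝ) / b) ^ ((k : ℝ)⁻¹)⌋₊ : ℝ) ≤ ((N : ℝ) / b) ^ ((k : ℝ)⁻¹) := Nat.floor_le (by positivity)
    have h8 := pow_le_pow_left₀ (by positivity) h7 k
    rw [Real.rpow_inv_natCast_pow hNb hk0, le_div_iff₀ hb0] at h8
    linarith

open MeasureTheory in
lemma int_bound (f : ℝ → ℂ) (hf : Continuous f) (N x0 R c : ℝ) (hN : 0 < N)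
    (hb : ∀ γ, |γ - x0| ≤ R → ‖f γ‖ ≤ c * (max 1 (N * |γ - x0|))⁻¹) :
    ∫ γ in Set.Icc (x0 - R) (x0 + R), ‖f γ‖ ^ 2 ≤ c ^ 2 * (2 * Real.pi / N) := by
  have hint0 : Integrable (fun y : ℝ => (1 + (N * y) ^ 2)⁻¹) := integrable_inv_one_add_sq.comp_mul_left' hN.ne'
  have hint : Integrable (fun γ : ℝ => c ^ 2 * (2 * (1 + (N * (γ - x0)) ^ 2)⁻¹)) :=
    ((hint0.comp_sub_right x0).const_mul 2).const_mul (c ^ 2)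
  have h1 : ∫ γ in Set.Icc (x0 - R) (x0 + R), ‖f γ‖ ^ 2 ≤
      ∫ γ in Set.Icc (x0 - R) (x0 + R), c ^ 2 * (2 * (1 + (N * (γ - x0)) ^ 2)⁻¹) := by
    refine setIntegral_mono_on ?_ hint.integrableOn measurableSet_Icc ?_
    · exact ((hf.norm.pow 2).continuousOn).integrableOn_compact isCompact_Icc
    · intro γ hγ
      have h2 := hb γ (abs_le.2 ⟨by linarith [hγ.1], by linarith [hγ.2]⟩)
      have h3 := pow_le_pow_left₀ (norm_nonneg _) h2 2
      refine h3.trans ?_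
      rw [mul_pow]
      refine mul_le_mul_of_nonneg_left ?_ (sq_nonneg _)
      have h4 : (N * (γ - x0)) ^ 2 = (N * |γ - x0|) ^ 2 := by rw [mul_pow, mul_pow, sq_abs]
      rw [h4, inv_pow, ← div_eq_mul_inv, inv_eq_one_div, div_le_div_iff₀ (by positivity) (by positivity)]
      have h5 : 1 ≤ max 1 (N * |γ - x0|) := le_max_left _ _
      have h6 : N * |γ - x0| ≤ max 1 (N * |γ - x0|) := le_max_right _ _
      have h7 : 0 ≤ N * |γ - x0| := by positivity
      nlinarith
  refine h1.trans ?_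
  refine (setIntegral_le_integral hint (Filter.Eventually.of_forall fun γ => by positivity)).trans (le_of_eq ?_)
  rw [integral_const_mul, integral_const_mul, integral_sub_right_eq_self (fun y : ℝ => (1 + (N * y) ^ 2)⁻¹) x0,
    Measure.integral_comp_mul_left (fun y : ℝ => (1 + y ^ 2)⁻¹) N, integral_univ_inv_one_add_sq, abs_of_pos (by positivity)]
  rw [smul_eq_mul]; field_simp

end Asm



open scoped Classical in
/-- Lemma 4.7: major-arc bounds for the normalized sieved Weyl sum `S(γ)` attached to
`h_d`: pointwise `|S(γ)| ≪ (log N)^{1/4} q^{-1/2} min{1,(N|β|)⁻¹}` on `𝔐_{a,q}(N,κ/σ)`,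
and `∫_{𝔐_{a,q}(N,κ/σ)} |S|² ≪ (log N)^{1/2}/(qN)`. -/
theorem stmt13
    (k : ℕ) (hk : 0 < k)
    (h : Polynomial ℤ) (hdeg : h.natDegree = k) (hlead : 0 < h.leadingCoeff)
    (hint : ∀ q : ℕ, 0 < q → ∃ n : ℤ, (q : ℤ) ∣ h.eval n)
    (z : ∀ (p : ℕ) [Fact p.Prime], ℤ_[p])
    (hz : ∀ (p : ℕ) [Fact p.Prime], Polynomial.aeval (z p) h = 0)
    (lam : ℕ → ℕ) (hlam1 : lam 1 = 1)
    (hlamMul : ∀ a b : ℕ, lam (a * b) = lam a * lam b)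
    (hlamP : ∀ (p : ℕ) [Fact p.Prime],
      lam p = p ^ Polynomial.rootMultiplicity (z p) (h.map (algebraMap ℤ ℤ_[p])))
    (r : ℕ → ℤ)
    (hr : ∀ d : ℕ, 0 < d → -(d : ℤ) < r d ∧ r d ≤ 0)
    (hrz : ∀ d : ℕ, 0 < d → ∀ (p : ℕ) [Fact p.Prime], ∀ α : ℕ, p ^ α ∣ d →
      (p : ℤ_[p]) ^ α ∣ (z p - (r d : ℤ_[p])))
    (H : ℕ → Polynomial ℤ)
    (hH : ∀ d : ℕ, 0 < d →
      Polynomial.C (lam d : ℤ) * H d =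
        h.comp (Polynomial.C (r d) + Polynomial.C (d : ℤ) * Polynomial.X))
    (κ : ℝ) (hκ : 0 < κ) :
    ∃ ε C : ℝ, 0 < ε ∧ 0 < C ∧ ∃ N₀ : ℕ, ∀ N : ℕ, N₀ ≤ N → ∀ d : ℕ, 0 < d →
      (d : ℝ) ≤ (N : ℝ) ^ ((1 : ℝ) / ((2 : ℝ) ^ (k + 2) * (k : ℝ) ^ 2)) →
      ∀ σ : ℝ, 0 < σ → σ ≤ 1 →
        Real.log N ^ (-(ε * Real.log (Real.log (Real.log N)))) ≤ σ →
        ∀ q : ℕ, 0 < q → (q : ℝ) ≤ κ * σ ^ (-((k : ℝ) + 1)) →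
        ∀ a : ℕ, 1 ≤ a → a ≤ q → Nat.gcd a q = 1 →
          let SS : ℝ → ℂ := fun γ =>
            ((1 / (wProd (H d) (σ ^ (-((k : ℝ) + 2))) * N) : ℝ) : ℂ) *
              ∑ m ∈ (Finset.Icc 1
                  ⌊((N : ℝ) / ((H d).leadingCoeff : ℝ)) ^ ((1 : ℝ) / k)⌋₊).filter
                  (fun m => (m : ℤ) ∈ WSet (H d) (σ ^ (-((k : ℝ) + 2)))),
                ((((Polynomial.derivative (H d)).eval (m : ℤ) : ℤ) : ℝ) : ℂ) *
                  e ((((H d).eval (m : ℤ) : ℤ) : ℝ) * γ)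
          (∀ γ : ℝ, |γ - (a : ℝ) / q| ≤ (κ / σ) / N →
            ‖SS γ‖ ≤ C * Real.log N ^ ((1 : ℝ) / 4) * (q : ℝ) ^ (-(1 : ℝ) / 2) *
              (max 1 ((N : ℝ) * |γ - (a : ℝ) / q|))⁻¹) ∧
          (∫ γ in Set.Icc ((a : ℝ) / q - (κ / σ) / N) ((a : ℝ) / q + (κ / σ) / N),
              ‖SS γ‖ ^ 2) ≤ C * Real.log N ^ ((1 : ℝ) / 2) / (q * N) := by
  classical
  obtain ⟨D, A, B, hD, hfam⟩ := Cont.family k hk h hdeg hlead z hz lam hlam1 hlamMul hlamP r hr hrz H hH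
  have hC1 : (1 : ℝ) ≤ Loc.C1 k D := by
    unfold Loc.C1; exact_mod_cast (Nat.one_le_pow _ _ hD).trans (Nat.le_add_right _ _)
  have hlC : 0 ≤ Real.log (Loc.C1 k D) := Real.log_nonneg hC1
  obtain ⟨κ', hκ'⟩ : ∃ x : ℝ, x = max κ 1 := ⟨_, rfl⟩
  have hκ1 : 1 ≤ κ' := hκ' ▸ le_max_right _ _
  have hκκ : κ ≤ κ' := hκ' ▸ le_max_left _ _
  obtain ⟨ε, hεd⟩ : ∃ x : ℝ, x = 1 / (16 * (k + 1) * (Real.log (Loc.C1 k D) + 1)) := ⟨_, rfl⟩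
  have hε0 : 0 < ε := by rw [hεd]; positivity
  have hε1 : ε ≤ 1 := by
    rw [hεd, div_le_one (by positivity)]
    have : (0 : ℝ) ≤ k := by positivity
    nlinarith [mul_nonneg this hlC]
  have hεc : 2 * (k + 1) * ε * Real.log (Loc.C1 k D) ≤ 1 / 8 := by
    have h1 : 2 * (k + 1) * ε * (Real.log (Loc.C1 k D) + 1) = 1 / 8 := by
      rw [hεd]; field_simp; norm_num
    have h2 : 0 ≤ 2 * (k + 1) * ε := by positivity
    linarith
  obtain ⟨Ci, hCi⟩ : ∃ x : ℝ, x = Ana.K1 k A * √(κ' ^ (k + 2)) + 1 := ⟨_, rfl⟩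
  have hCi0 : 0 < Ci := by
    have := Asm.K1_nonneg (k := k) (A := A)
    rw [hCi]; positivity
  refine ⟨ε, max Ci (Ci ^ 2 * (2 * Real.pi)), hε0, lt_max_of_lt_left hCi0, ?_⟩
  have hcore := Asm.core k hk D hD A κ' ε hκ1 hε0.le hε1 hεc
  have hLL : Filter.Tendsto (fun N : ℕ => Real.log (Real.log N)) Filter.atTop Filter.atTop :=
    Real.tendsto_log_atTop.comp (Real.tendsto_log_atTop.comp tendsto_natCast_atTop_atTop)
  have hlN : Filter.Tendsto (fun N : ℕ => Real.log N) Filter.atTop Filter.atTop :=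
    Real.tendsto_log_atTop.comp tendsto_natCast_atTop_atTop
  have hev := (hLL.eventually hcore).and ((Asm.M_bound k hk B).and ((hlN.eventually_ge_atTop 1).and (Filter.eventually_ge_atTop 1)))
  obtain ⟨N₀, hN₀⟩ := Filter.eventually_atTop.1 hev
  refine ⟨N₀, ?_⟩
  intro N hN d hd hdN σ hσ0 hσ1 hσ q hq hqσ a ha1 haq hcop
  obtain ⟨hc, hMb, hlog1, hN1⟩ := hN₀ N hN
  obtain ⟨hg, hB⟩ := hfam d hd
  have hNr : (0 : ℝ) < N := by exact_mod_cast hN1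
  have hqr : (0 : ℝ) < q := by exact_mod_cast hq
  obtain ⟨s, hsd⟩ : ∃ x : ℝ, x = σ⁻¹ := ⟨_, rfl⟩
  have hs1 : 1 ≤ s := by rw [hsd]; exact (one_le_inv₀ hσ0).2 hσ1
  have hpow : ∀ n : ℕ, σ ^ (-(n : ℝ)) = s ^ n := fun n => by
    rw [Real.rpow_neg hσ0.le, Real.rpow_natCast, hsd, inv_pow]
  have hY : σ ^ (-((k : ℝ) + 2)) = s ^ (k + 2) := by rw [← hpow]; push_cast; rfl
  have hY1 : σ ^ (-((k : ℝ) + 1)) = s ^ (k + 1) := by rw [← hpow]; push_cast; rfl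
  have hexpL : Real.exp (Real.log (Real.log N)) = Real.log N := Real.exp_log (by linarith)
  have hsε : s ≤ Real.exp (ε * (Real.log (Real.log N) * Real.log (Real.log (Real.log N)))) := by
    rw [Real.rpow_def_of_pos (by linarith)] at hσ
    have h1 := inv_anti₀ (Real.exp_pos _) hσ
    rw [← Real.exp_neg, ← hsd] at h1
    refine h1.trans (le_of_eq ?_)
    congr 1; ring
  have hqs : (q : ℝ) ≤ κ' * s ^ (k + 1) := by
    rw [hY1] at hqσ
    exact hqσ.trans (mul_le_mul_of_nonneg_right hκκ (by positivity))
  have hlead1 : (1 : ℝ) ≤ ((H d).leadingCoeff : ℝ) := by exact_mod_cast hg.lead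
  have hB' : ((H d).leadingCoeff : ℝ) ≤ B * (d : ℝ) ^ k := by exact_mod_cast hB
  obtain ⟨hM1, hM2⟩ := hMb d _ hlead1 hB' hdN
  have hw0 : 0 < ∏ p ∈ Loc.PY (s ^ (k + 2)), (1 - Loc.jr (H d) p) :=
    Finset.prod_pos fun p hp => Loc.one_sub_jr_pos hg (Loc.PY_prime p hp)
  have hcop' : IsCoprime ((a : ℕ) : ℤ) (q : ℤ) := Nat.isCoprime_iff_coprime.2 hcop
  intro SS
  have hSS : ∀ γ, SS γ = ((1 / ((∏ p ∈ Loc.PY (s ^ (k + 2)), (1 - Loc.jr (H d) p)) * N) : ℝ) : ℂ) *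
      ∑ x ∈ Finset.range ⌊((N : ℝ) / ((H d).leadingCoeff : ℝ)) ^ ((1 : ℝ) / k)⌋₊,
        (∏ p ∈ Loc.PY (s ^ (k + 2)), Loc.gd (H d) p (x + 1)) * Ana.fi (H d) γ (x + 1) := by
    intro γ
    rw [← Asm.sum_eq (H d) (s ^ (k + 2)) (by positivity), ← Asm.wProd_eq, ← hY]
  have hcont : Continuous SS := by
    rw [show SS = _ from funext hSS]
    unfold Ana.fi e
    fun_prop
  have hz4 : Real.exp (Real.log (Real.log N) / 4) = Real.log N ^ ((1 : ℝ) / 4) := by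
    rw [Real.rpow_def_of_pos (by linarith)]; congr 1; ring
  have hmain : ∀ γ : ℝ, |γ - (a : ℝ) / q| ≤ (κ / σ) / N →
      ‖SS γ‖ ≤ Ci * Real.log N ^ ((1 : ℝ) / 4) * (q : ℝ) ^ (-(1 : ℝ) / 2) * (max 1 ((N : ℝ) * |γ - (a : ℝ) / q|))⁻¹ := by
    intro γ hγ
    have hβ : (N : ℝ) * |γ - ((a : ℤ) : ℝ) / q| ≤ κ' * s := by
      rw [le_div_iff₀ hNr, div_eq_mul_inv κ σ, ← hsd] at hγ
      have : κ * s ≤ κ' * s := mul_le_mul_of_nonneg_right hκκ (by linarith)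
      push_cast
      linarith
    have h1 := hc (H d) hg s q _ N γ a hs1 hsε hq hqs hcop' (by rw [hexpL]; exact hM1) hM2 hNr.le hβ
    rw [← hCi, hz4, Int.cast_natCast] at h1
    have hsq : (√(q : ℝ))⁻¹ = (q : ℝ) ^ (-(1 : ℝ) / 2) := by
      rw [Real.sqrt_eq_rpow, ← Real.rpow_neg hqr.le]; congr 1; ring
    rw [hsq] at h1
    rw [hSS γ, norm_mul, Complex.norm_real, Real.norm_eq_abs, abs_of_pos (by positivity), one_div, inv_mul_le_iff₀ (by positivity)]
    exact h1
  refine ⟨?_, ?_⟩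
  · intro γ hγ
    refine (hmain γ hγ).trans ?_
    have hl : 0 ≤ Real.log N := by linarith
    gcongr
    exact le_max_left _ _
  · refine (Asm.int_bound SS hcont N ((a : ℝ) / q) ((κ / σ) / N) _ hNr hmain).trans ?_
    have e1 : (Real.log N ^ ((1 : ℝ) / 4)) ^ 2 = Real.log N ^ ((1 : ℝ) / 2) := by
      rw [← Real.rpow_mul_natCast (by linarith)]; norm_num
    have e2 : ((q : ℝ) ^ (-(1 : ℝ) / 2)) ^ 2 = (q : ℝ)⁻¹ := by
      rw [← Real.rpow_mul_natCast hqr.le, ← Real.rpow_neg_one]; norm_num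
    rw [mul_pow, mul_pow, e1, e2]
    have h3 : 0 ≤ Real.log N ^ ((1 : ℝ) / 2) := Real.rpow_nonneg (by linarith) _
    calc _ = (Ci ^ 2 * (2 * Real.pi)) * (Real.log N ^ ((1 : ℝ) / 2) / (q * N)) := by field_simp
      _ ≤ max Ci (Ci ^ 2 * (2 * Real.pi)) * (Real.log N ^ ((1 : ℝ) / 2) / (q * N)) :=
        mul_le_mul_of_nonneg_right (le_max_right _ _) (by positivity)
      _ = _ := by ring
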